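/- Let α ∈ [0,1/2). There exists C_α > 0 such that for every integer N ≥ 1, every Borel function F : ℝ → ℂ supported in [0,N], and every point z' = ⟨θ',φ'⟩ ∈ S², the kernel K_F(z,z') := ∑_{(ℓ,m)∈ℕ×ℤ, |m|≤ℓ, λ_{ℓ,m} ≤ N²} F(√λ_{ℓ,m}) Y_{ℓ,m}(z) conj(Y_{ℓ,m}(z')) (a finite sum, since λ_{ℓ,m} ≥ ℓ) satisfies ∫_{S²} (1 + w_{1/N}(z,z'))^{2α} |K_F(z,z')|² dσ(z) ≤ C_α N² min{N, 1/|θ'|} ‖F(N·)‖_{N,2}², with the convention min{N, 1/0} = N. (This is the weighted Plancherel estimate ⦀K_{F(√L)}⦀_{2,0,α,N^{−1}} ≤ C_α ‖F(N·)‖_{N,2}, written using the equivalence of the sub-Riemannian ball volume V(⟨θ',φ'⟩, 1/N) with N^{−2} max{1/N, |θ'|}.) -/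

import Mathlib

open MeasureTheory Set
open scoped ENNReal NNReal

noncomputable section

/-- The Legendre polynomial `P_ℓ(x) = (2^ℓ ℓ!)⁻¹ (d/dx)^ℓ (x²−1)^ℓ`. -/
def legendreP (n : ℕ) (x : ℝ) : ℝ :=
  ((2:ℝ)^n * (Nat.factorial n : ℝ))⁻¹ * iteratedDeriv n (fun y => (y^2 - 1)^n) x

/-- The associated Legendre function `P_ℓ^m` for `0 ≤ m ≤ ℓ`
(on `[-1,1]`, where `√(1-x²)^m = (1-x²)^{m/2}`). -/
def assocP (n m : ℕ) (x : ℝ) : ℝ :=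
  (-1:ℝ)^m * Real.sqrt (1 - x^2) ^ m * iteratedDeriv m (legendreP n) x

/-- The associated Legendre function `P_ℓ^m` for integer `m` with `|m| ≤ ℓ`. -/
def assocPZ (n : ℕ) (m : ℤ) (x : ℝ) : ℝ :=
  if 0 ≤ m then assocP n m.toNat x
  else (-1:ℝ)^m.natAbs *
    ((Nat.factorial (n - m.natAbs) : ℝ) / (Nat.factorial (n + m.natAbs) : ℝ)) *
    assocP n m.natAbs x

/-- `Ỹ_{ℓ,m}(x) = ((2ℓ+1)/(4π) · (ℓ−m)!/(ℓ+m)!)^{1/2} P_ℓ^m(x)`. -/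
def tY (n : ℕ) (m : ℤ) (x : ℝ) : ℝ :=
  Real.sqrt (((2*(n:ℝ)+1) / (4*Real.pi)) *
    ((Nat.factorial ((n : ℤ) - m).toNat : ℝ) / (Nat.factorial ((n : ℤ) + m).toNat : ℝ))) *
  assocPZ n m x

/-- Euclidean `ℝ³`. -/
abbrev E3 : Type := EuclideanSpace ℝ (Fin 3)

/-- The point `⟨θ,φ⟩ = (cosθ cosφ, cosθ sinφ, sinθ)` of the unit sphere. -/
def spt (θ φ : ℝ) : E3 :=
  (WithLp.equiv 2 (Fin 3 → ℝ)).symm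
    ![Real.cos θ * Real.cos φ, Real.cos θ * Real.sin φ, Real.sin θ]

/-- The surface measure `σ` on the unit sphere `S² ⊆ ℝ³` (total mass `4π`),
realised as the pushforward of `cosθ dθ dφ` under the spherical parametrization. -/
def sphereMeasure : Measure E3 :=
  Measure.map (fun p : ℝ × ℝ => spt p.1 p.2)
    (((volume : Measure (ℝ × ℝ)).restrict
        (Set.Ioc (-(Real.pi/2)) (Real.pi/2) ×ˢ Set.Ico (0:ℝ) (2*Real.pi))).withDensity
      (fun p => ENNReal.ofReal (Real.cos p.1)))

/-- The spherical harmonic `Y_{ℓ,m}(⟨θ,φ⟩) = e^{imφ} Ỹ_{ℓ,m}(sinθ)`, written as a function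
of the point `z ∈ S²` (for `z` on the sphere, `e^{im·arg(z₁+iz₂)} = e^{imφ}` whenever
`Ỹ_{ℓ,m}(z₃) ≠ 0`). -/
def Ylm (n : ℕ) (m : ℤ) (z : E3) : ℂ :=
  Complex.exp (Complex.I * (m : ℂ) * (Complex.arg ((z 0 : ℂ) + (z 1 : ℂ) * Complex.I) : ℂ)) *
    (tY n m (z 2) : ℂ)

/-- The eigenvalue `λ_{ℓ,m} = ℓ(ℓ+1) − m²` of the spherical Grushin operator on `Y_{ℓ,m}`. -/
def eigenL (n : ℕ) (m : ℤ) : ℝ := (n : ℝ) * ((n : ℝ) + 1) - (m : ℝ)^2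

/-- The Fourier coefficient `⟨f, Y_{ℓ,m}⟩_{L²(σ)}`. -/
def coeffY (f : E3 → ℂ) (n : ℕ) (m : ℤ) : ℂ :=
  ∫ z, f z * (starRingEnd ℂ) (Ylm n m z) ∂sphereMeasure

/-- The kernel `K_{F(√L)}(z,z') = ∑_{λ_{ℓ,m} ≤ N²} F(√λ_{ℓ,m}) Y_{ℓ,m}(z) conj(Y_{ℓ,m}(z'))`.
Since `λ_{ℓ,m} ≥ ℓ` and `F` is supported in `[0,N]`, summing over all `ℓ ≤ N²` captures all
nonzero terms. -/
def kernF (F : ℝ → ℂ) (N : ℕ) (z z' : E3) : ℂ :=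
  ∑ n ∈ Finset.range (N^2 + 1), ∑ m ∈ Finset.Icc (-(n : ℤ)) (n : ℤ),
    F (Real.sqrt (eigenL n m)) * Ylm n m z * (starRingEnd ℂ) (Ylm n m z')

/-- The square of the norm `‖G‖_{N,2} = (N⁻¹ ∑_{i=1}^N sup_{λ∈[(i−1)/N,i/N]} |G(λ)|²)^{1/2}`,
for `G = F(N·)`, valued in `[0,∞]`. -/
def normN2Sq (F : ℝ → ℂ) (N : ℕ) : ℝ≥0∞ :=
  ((N : ℝ≥0∞))⁻¹ * ∑ i ∈ Finset.Icc 1 N,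
    (⨆ lam ∈ Set.Icc (((i:ℝ)-1)/(N:ℝ)) ((i:ℝ)/(N:ℝ)), (‖F ((N:ℝ) * lam)‖₊ : ℝ≥0∞))^2

section Auxiliary

open Polynomial

/-- The Legendre polynomial `P_ℓ` as an element of `ℝ[X]`, by Rodrigues' formula. -/
def legendrePoly (n : ℕ) : ℝ[X] :=
  C (((2:ℝ)^n * (n.factorial : ℝ))⁻¹) * derivative^[n] ((X^2 - 1)^n)

lemma iteratedDeriv_polynomial_eval (p : ℝ[X]) (k : ℕ) :
    iteratedDeriv k (fun x => p.eval x) = fun x => (derivative^[k] p).eval x := by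
  induction k with
  | zero => simp
  | succ k ih =>
    rw [iteratedDeriv_succ, ih]
    funext x
    rw [Polynomial.deriv, Function.iterate_succ_apply']

lemma legendreP_eq_eval (n : ℕ) : legendreP n = fun x => (legendrePoly n).eval x := by
  funext x
  have h : (fun y : ℝ => (y^2 - 1)^n) = fun y => (((X^2 - 1)^n : ℝ[X])).eval y := by
    funext y; simp
  rw [legendreP, h, iteratedDeriv_polynomial_eval, legendrePoly]
  simp

lemma rodrigues_recurrence (n j : ℕ) :
    (X^2 - 1 : ℝ[X]) * derivative^[j+2] ((X^2 - 1)^n) =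
      C (2 * (n:ℝ) - 2 * j - 2) * (X * derivative^[j+1] ((X^2 - 1)^n)) +
      C (((j:ℝ) + 1) * (2 * n - j)) * derivative^[j] ((X^2 - 1)^n) := by
  have hbase : (X^2 - 1 : ℝ[X]) * derivative ((X^2 - 1)^n) =
      C (2 * (n:ℝ)) * (X * (X^2 - 1)^n) := by
    rcases n with _ | n
    · simp
    · rw [derivative_pow_succ]
      simp only [derivative_sub, derivative_X_sq, derivative_one, map_mul, map_ofNat,
        map_natCast]
      push_cast
      simp only [map_add, map_natCast, map_one]
      ring
  induction j with
  | zero =>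
    have h := congrArg derivative hbase
    simp only [derivative_mul, derivative_sub, derivative_X_sq, derivative_one, derivative_C,
      derivative_X] at h
    simp only [map_mul, map_ofNat, map_natCast] at h
    simp only [Function.iterate_succ_apply', Function.iterate_zero, id_eq, map_sub, map_mul,
      map_ofNat, map_natCast, map_add, map_one, Nat.cast_zero, map_zero]
    linear_combination h
  | succ j ih =>
    have h := congrArg derivative ih
    simp only [derivative_mul, derivative_sub, derivative_X_sq, derivative_one, derivative_C,
      derivative_X, derivative_add, ← Function.iterate_succ_apply' derivative] at h
    simp only [map_sub, map_mul, map_ofNat, map_natCast, map_add, map_one, Nat.cast_add,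
      Nat.cast_one] at h ⊢
    linear_combination h

lemma legendrePoly_ode (n m : ℕ) :
    (1 - X^2 : ℝ[X]) * derivative^[m+2] (legendrePoly n) =
      C (2 * ((m:ℝ) + 1)) * (X * derivative^[m+1] (legendrePoly n)) -
      C (((n:ℝ) - m) * (n + m + 1)) * derivative^[m] (legendrePoly n) := by
  have h := rodrigues_recurrence n (m + n)
  have key : ∀ k, derivative^[k] (legendrePoly n) =
      C (((2:ℝ)^n * (n.factorial : ℝ))⁻¹) * derivative^[k + n] ((X^2 - 1)^n) := by
    intro k
    rw [legendrePoly, iterate_derivative_C_mul, ← Function.iterate_add_apply]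
  rw [key, key, key, show m + 2 + n = m + n + 2 by ring, show m + 1 + n = m + n + 1 by ring]
  simp only [map_sub, map_mul, map_ofNat, map_natCast, map_add, map_one, Nat.cast_add] at h ⊢
  linear_combination -C (((2:ℝ)^n * (n.factorial : ℝ))⁻¹) * h

lemma iterate_derivative_legendrePoly_eq_zero (n : ℕ) :
    derivative^[n + 1] (legendrePoly n) = 0 := by
  rw [legendrePoly, iterate_derivative_C_mul, ← Function.iterate_add_apply,
    iterate_derivative_eq_zero, mul_zero]
  refine lt_of_le_of_lt natDegree_pow_le ?_
  have : (X^2 - 1 : ℝ[X]).natDegree ≤ 2 := by compute_degree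
  nlinarith

lemma legendrePoly_eval_one (n : ℕ) : (legendrePoly n).eval 1 = 1 := by
  have h1 : (taylor (1:ℝ) ((X^2 - 1)^n)).coeff n = 2^n := by
    have : taylor (1:ℝ) ((X^2 - 1)^n) = X^n * (X + 2)^n := by
      rw [taylor_pow]
      simp only [map_sub, taylor_one, taylor_X_pow, map_one]
      rw [← mul_pow]
      congr 1
      ring
    rw [this, coeff_X_pow_mul', if_pos le_rfl, Nat.sub_self, coeff_zero_eq_eval_zero]
    simp
  have h2 : derivative^[n] (((X:ℝ[X])^2 - 1)^n) =
      n.factorial • hasseDeriv n (((X:ℝ[X])^2 - 1)^n) := by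
    rw [← factorial_smul_hasseDeriv]; rfl
  rw [taylor_coeff] at h1
  rw [legendrePoly, h2, eval_mul, eval_C, eval_smul, h1, nsmul_eq_mul]
  have : (n.factorial : ℝ) ≠ 0 := by exact_mod_cast n.factorial_ne_zero
  field_simp

/-- Integration of a polynomial over `[-1,1]`. -/
def polyInt : ℝ[X] →ₗ[ℝ] ℝ where
  toFun p := ∫ x in (-1:ℝ)..1, p.eval x
  map_add' p q := by
    simp only [eval_add]
    exact intervalIntegral.integral_add (p.continuous.intervalIntegrable _ _)
      (q.continuous.intervalIntegrable _ _)
  map_smul' c p := by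
    simp [eval_smul]

lemma polyInt_apply (p : ℝ[X]) : polyInt p = ∫ x in (-1:ℝ)..1, p.eval x := rfl

lemma polyInt_C_mul (c : ℝ) (p : ℝ[X]) : polyInt (C c * p) = c * polyInt p := by
  rw [← smul_eq_C_mul, map_smul, smul_eq_mul]

lemma polyInt_derivative (p : ℝ[X]) : polyInt (derivative p) = p.eval 1 - p.eval (-1) :=
  intervalIntegral.integral_eq_sub_of_hasDerivAt (fun x _ => p.hasDerivAt x)
    ((derivative p).continuous.intervalIntegrable _ _)

lemma polyInt_mono {p q : ℝ[X]} (h : ∀ x ∈ Icc (-1:ℝ) 1, p.eval x ≤ q.eval x) :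
    polyInt p ≤ polyInt q :=
  intervalIntegral.integral_mono_on (by norm_num) (p.continuous.intervalIntegrable _ _)
    (q.continuous.intervalIntegrable _ _) h

lemma polyInt_nonneg {p : ℝ[X]} (h : ∀ x ∈ Icc (-1:ℝ) 1, 0 ≤ p.eval x) : 0 ≤ polyInt p :=
  intervalIntegral.integral_nonneg (by norm_num) h

lemma integral_zero_one_le_polyInt {p : ℝ[X]} (h : ∀ x ∈ Icc (-1:ℝ) 1, 0 ≤ p.eval x)
    {x : ℝ} (hx : x ∈ Icc (0:ℝ) 1) : ∫ y in x..1, p.eval y ≤ polyInt p := by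
  rw [polyInt_apply, ← intervalIntegral.integral_add_adjacent_intervals
    (p.continuous.intervalIntegrable (-1) x) (p.continuous.intervalIntegrable x 1)]
  have : 0 ≤ ∫ y in (-1:ℝ)..x, p.eval y :=
    intervalIntegral.integral_nonneg (by linarith [hx.1])
      (fun y hy => h y ⟨hy.1, hy.2.trans hx.2⟩)
  linarith

lemma polyInt_derivative_legendrePoly (n m : ℕ) (h : ℝ[X]) :
    polyInt ((1 - X^2)^(m+1) * derivative^[m+1] (legendrePoly n) * derivative h) =
      (((n:ℝ) - m) * (n + m + 1)) *
        polyInt ((1 - X^2)^m * derivative^[m] (legendrePoly n) * h) := by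
  have h0 := polyInt_derivative ((1 - X^2)^(m+1) * derivative^[m+1] (legendrePoly n) * h)
  have h1 : derivative ((1 - X^2)^(m+1) * derivative^[m+1] (legendrePoly n) * h) =
      (1 - X^2)^(m+1) * derivative^[m+1] (legendrePoly n) * derivative h -
      C (((n:ℝ) - m) * (n + m + 1)) *
        ((1 - X^2)^m * derivative^[m] (legendrePoly n) * h) := by
    have ode := legendrePoly_ode n m
    rw [derivative_mul, derivative_mul, ← Function.iterate_succ_apply' derivative,
      derivative_pow_succ]
    simp only [derivative_sub, derivative_X_sq, derivative_one]
    simp only [map_sub, map_mul, map_ofNat, map_natCast, map_add, map_one] at ode ⊢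
    linear_combination (1 - X^2)^m * h * ode
  rw [h1, map_sub, polyInt_C_mul] at h0
  have h2 : ∀ y : ℝ, y^2 = 1 →
      ((1 - X^2)^(m+1) * derivative^[m+1] (legendrePoly n) * h).eval y = 0 := by
    intro y hy
    simp [hy]
  rw [h2 1 (by norm_num), h2 (-1) (by norm_num)] at h0
  linarith

/-- The factor `(ℓ-m)!/(ℓ+m)!`. -/
def factRatio (n m : ℕ) : ℝ := ((n - m).factorial : ℝ) / ((n + m).factorial : ℝ)

lemma factRatio_zero (n : ℕ) : factRatio n 0 = 1 := by
  have : (n.factorial : ℝ) ≠ 0 := by exact_mod_cast n.factorial_ne_zero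
  simp [factRatio, this]

lemma factRatio_pos (n m : ℕ) : 0 < factRatio n m := by
  unfold factRatio
  have := Nat.factorial_pos (n - m)
  have := Nat.factorial_pos (n + m)
  positivity

lemma factRatio_succ {n m : ℕ} (h : m < n) :
    factRatio n (m + 1) * (((n:ℝ) - m) * (n + m + 1)) = factRatio n m := by
  obtain ⟨k, rfl⟩ := Nat.exists_eq_add_of_lt h
  unfold factRatio
  rw [show m + k + 1 - (m + 1) = k by omega, show m + k + 1 - m = k + 1 by omega,
    show m + k + 1 + (m + 1) = (m + k + 1 + m) + 1 by ring, Nat.factorial_succ k,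
    Nat.factorial_succ (m + k + 1 + m)]
  have : ((m + k + 1 + m).factorial : ℝ) ≠ 0 := by exact_mod_cast Nat.factorial_ne_zero _
  have : ((m + k + 1 + m + 1 : ℕ) : ℝ) ≠ 0 := by positivity
  push_cast at *
  field_simp
  ring

/-- The polynomial identity behind the addition theorem for spherical harmonics. -/
lemma legendrePoly_addition (n : ℕ) :
    legendrePoly n ^ 2 + 2 * ∑ m ∈ Finset.range n, C (factRatio n (m+1)) *
      ((1 - X^2)^(m+1) * derivative^[m+1] (legendrePoly n) ^ 2) = 1 := by
  set S := legendrePoly n ^ 2 + 2 * ∑ m ∈ Finset.range n, C (factRatio n (m+1)) *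
      ((1 - X^2)^(m+1) * derivative^[m+1] (legendrePoly n) ^ 2) with hS
  have hder : ∀ k ≤ n, derivative (legendrePoly n ^ 2 + 2 * ∑ m ∈ Finset.range k,
      C (factRatio n (m+1)) * ((1 - X^2)^(m+1) * derivative^[m+1] (legendrePoly n) ^ 2)) =
      C (2 * factRatio n k) * ((1 - X^2)^k * derivative^[k] (legendrePoly n) *
        derivative^[k+1] (legendrePoly n)) := by
    intro k
    induction k with
    | zero =>
      intro _
      simp only [Finset.range_zero, Finset.sum_empty, mul_zero, add_zero, derivative_sq,
        factRatio_zero, mul_one, pow_zero, one_mul, Function.iterate_zero, id_eq, zero_add,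
        Function.iterate_one]
      rw [mul_assoc]
    | succ k ih =>
      intro hk
      have ih := ih (by omega)
      have hr := factRatio_succ (n := n) (m := k) (by omega)
      have ode := legendrePoly_ode n k
      rw [Finset.sum_range_succ, mul_add, ← add_assoc, derivative_add, ih]
      have h2 : derivative (2 : ℝ[X]) = 0 := derivative_ofNat 2
      rw [derivative_mul, h2, zero_mul, zero_add, derivative_mul, derivative_C, zero_mul,
        zero_add, derivative_mul, derivative_sq, derivative_pow_succ,
        ← Function.iterate_succ_apply' derivative]
      simp only [derivative_sub, derivative_X_sq, derivative_one]
      have hr' := congrArg (fun r : ℝ => (C r : ℝ[X])) hr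
      simp only [map_sub, map_mul, map_ofNat, map_natCast, map_add, map_one] at ode hr' ⊢
      rw [← hr']
      linear_combination 2 * C (factRatio n (k+1)) * (1 - X^2)^k *
        derivative^[k+1] (legendrePoly n) * ode
  have h0 : derivative S = 0 := by
    rw [hS, hder n le_rfl, iterate_derivative_legendrePoly_eq_zero, mul_zero, mul_zero]
  have h1 : S.eval 1 = 1 := by
    rw [hS]
    simp [legendrePoly_eval_one, eval_finsetSum]
  rw [eq_C_of_derivative_eq_zero h0] at h1 ⊢
  simp only [eval_C] at h1
  rw [h1, map_one]

lemma polyInt_legendrePoly_sq (n m : ℕ) (hm : m ≤ n) :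
    factRatio n m * polyInt ((1 - X^2)^m * derivative^[m] (legendrePoly n) ^ 2) =
      2 / (2 * n + 1) := by
  have hind : ∀ m ≤ n, factRatio n m *
      polyInt ((1 - X^2)^m * derivative^[m] (legendrePoly n) ^ 2) =
      polyInt (legendrePoly n ^ 2) := by
    intro m
    induction m with
    | zero => intro _; simp [factRatio_zero]
    | succ m ih =>
      intro hm
      rw [← ih (by omega), ← factRatio_succ (n := n) (m := m) (by omega)]
      have := polyInt_derivative_legendrePoly n m (derivative^[m] (legendrePoly n))
      rw [← Function.iterate_succ_apply' derivative, mul_assoc, ← sq,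
        mul_assoc ((1 - X^2)^m), ← sq] at this
      rw [this]; ring
  have h := congrArg polyInt (legendrePoly_addition n)
  rw [map_add, show (2:ℝ[X]) = C 2 from rfl, polyInt_C_mul, map_sum] at h
  simp_rw [polyInt_C_mul] at h
  rw [Finset.sum_congr rfl (fun k hk => hind (k+1) (by simpa [Nat.succ_le_iff] using hk)),
    Finset.sum_const, Finset.card_range, nsmul_eq_mul] at h
  have h1 : polyInt 1 = 2 := by
    rw [polyInt_apply]; simp; norm_num
  rw [h1] at h
  rw [hind m hm, eq_div_iff (by positivity)]
  linarith

/-- The polynomial factor of `Ỹ_{ℓ,m}`, so that `Ỹ_{ℓ,m}(x) = (1-x²)^{m/2} · harmPoly`. -/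
def harmPoly (n m : ℕ) : ℝ[X] :=
  C (Real.sqrt ((2*(n:ℝ)+1) / (4*Real.pi) * factRatio n m) * (-1)^m) *
    derivative^[m] (legendrePoly n)

lemma tY_natCast (n m : ℕ) (hm : m ≤ n) (x : ℝ) :
    tY n m x = Real.sqrt (1 - x^2) ^ m * (harmPoly n m).eval x := by
  have h1 : ((n:ℤ) - m).toNat = n - m := by omega
  have h2 : ((n:ℤ) + m).toNat = n + m := by omega
  rw [tY, assocPZ, if_pos (by positivity), h1, h2, assocP, harmPoly, legendreP_eq_eval,
    iteratedDeriv_polynomial_eval, factRatio]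
  simp only [eval_mul, eval_C, Int.toNat_natCast]
  ring

lemma tY_neg (n m : ℕ) (hm : m ≤ n) (x : ℝ) : tY n (-(m:ℤ)) x = (-1)^m * tY n m x := by
  rcases Nat.eq_zero_or_pos m with rfl | hpos
  · simp
  have h1 : ((n:ℤ) - m).toNat = n - m := by omega
  have h2 : ((n:ℤ) + m).toNat = n + m := by omega
  have h3 : ((n:ℤ) - -(m:ℤ)).toNat = n + m := by omega
  have h4 : ((n:ℤ) + -(m:ℤ)).toNat = n - m := by omega
  rw [tY, tY, assocPZ, assocPZ, if_neg (by omega), if_pos (by positivity), h1, h2, h3, h4]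
  simp only [Int.natAbs_neg, Int.natAbs_natCast, Int.toNat_natCast]
  have ha : (0:ℝ) < ((n - m).factorial : ℝ) := by exact_mod_cast Nat.factorial_pos _
  have hb : (0:ℝ) < ((n + m).factorial : ℝ) := by exact_mod_cast Nat.factorial_pos _
  set a := ((n - m).factorial : ℝ)
  set b := ((n + m).factorial : ℝ)
  have hc : 0 ≤ (2 * (n:ℝ) + 1) / (4 * Real.pi) := by positivity
  have : Real.sqrt ((2 * (n:ℝ) + 1) / (4 * Real.pi) * (b / a)) * (a / b) =
      Real.sqrt ((2 * (n:ℝ) + 1) / (4 * Real.pi) * (a / b)) := by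
    rw [Real.sqrt_mul hc, Real.sqrt_mul hc, mul_assoc]
    congr 1
    rw [← inv_div a b, Real.sqrt_inv]
    have hpos : 0 < a / b := by positivity
    have := Real.mul_self_sqrt hpos.le
    have h0 : Real.sqrt (a / b) ≠ 0 := (Real.sqrt_pos.2 hpos).ne'
    field_simp
    rw [Real.sq_sqrt hpos.le]
    field_simp
  rw [← this]
  ring

lemma harmPoly_scale_sq (n m : ℕ) :
    (Real.sqrt ((2*(n:ℝ)+1) / (4*Real.pi) * factRatio n m) * (-1)^m)^2 =
      (2*(n:ℝ)+1) / (4*Real.pi) * factRatio n m := by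
  have := factRatio_pos n m
  rw [mul_pow, Real.sq_sqrt (by positivity), ← pow_mul, mul_comm m 2, pow_mul]
  norm_num

lemma polyInt_harmPoly_sq (n m : ℕ) (hm : m ≤ n) :
    polyInt ((1 - X^2)^m * harmPoly n m ^ 2) = 1 / (2 * Real.pi) := by
  have h := polyInt_legendrePoly_sq n m hm
  have : (1 - X^2)^m * harmPoly n m ^ 2 = C ((2*(n:ℝ)+1) / (4*Real.pi) * factRatio n m) *
      ((1 - X^2)^m * derivative^[m] (legendrePoly n) ^ 2) := by
    rw [harmPoly, mul_pow, ← C_pow, harmPoly_scale_sq]; ring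
  rw [this, polyInt_C_mul, mul_assoc, h]
  have := Real.pi_pos
  field_simp
  norm_num

lemma polyInt_derivative_harmPoly (n m : ℕ) (h : ℝ[X]) :
    polyInt ((1 - X^2)^(m+1) * derivative (harmPoly n m) * derivative h) =
      (((n:ℝ) - m) * (n + m + 1)) * polyInt ((1 - X^2)^m * harmPoly n m * h) := by
  have := polyInt_derivative_legendrePoly n m h
  set c := Real.sqrt ((2*(n:ℝ)+1) / (4*Real.pi) * factRatio n m) * (-1)^m with hc
  have h1 : (1 - X^2)^(m+1) * derivative (harmPoly n m) * derivative h =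
      C c * ((1 - X^2)^(m+1) * derivative^[m+1] (legendrePoly n) * derivative h) := by
    rw [harmPoly, ← hc, derivative_mul, derivative_C, Function.iterate_succ_apply']; ring
  have h2 : (1 - X^2)^m * harmPoly n m * h =
      C c * ((1 - X^2)^m * derivative^[m] (legendrePoly n) * h) := by
    rw [harmPoly, ← hc]; ring
  rw [h1, h2, polyInt_C_mul, polyInt_C_mul, this]
  ring

lemma polyInt_harmPoly_orthogonal {n k m : ℕ} (hne : n ≠ k) :
    polyInt ((1 - X^2)^m * harmPoly n m * harmPoly k m) = 0 := by
  have h1 := polyInt_derivative_harmPoly n m (harmPoly k m)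
  have h2 := polyInt_derivative_harmPoly k m (harmPoly n m)
  rw [show (1 - X^2)^(m+1) * derivative (harmPoly k m) * derivative (harmPoly n m) =
    (1 - X^2)^(m+1) * derivative (harmPoly n m) * derivative (harmPoly k m) by ring, h1,
    show (1 - X^2)^m * harmPoly k m * harmPoly n m =
    (1 - X^2)^m * harmPoly n m * harmPoly k m by ring] at h2
  have h3 : (((n:ℝ) - k) * (n + k + 1)) *
      polyInt ((1 - X^2)^m * harmPoly n m * harmPoly k m) = 0 := by linarith
  rcases mul_eq_zero.1 h3 with h | h
  · exfalso
    rcases mul_eq_zero.1 h with h | h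
    · exact hne (by exact_mod_cast sub_eq_zero.1 h)
    · have : (0:ℝ) < n + k + 1 := by positivity
      linarith
  · exact h

lemma tY_sq_le {n m : ℕ} (hm : m ≤ n) {x : ℝ} (hx : x ∈ Icc (-1:ℝ) 1) :
    tY n m x ^ 2 ≤ (2 * (n:ℝ) + 1) / (4 * Real.pi) := by
  have hx2 : 0 ≤ 1 - x^2 := by nlinarith [hx.1, hx.2]
  have hval : tY n m x ^ 2 = (2 * (n:ℝ) + 1) / (4 * Real.pi) *
      (factRatio n m * ((1 - x^2)^m * (derivative^[m] (legendrePoly n)).eval x ^ 2)) := by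
    rw [tY_natCast n m hm, harmPoly, eval_mul, eval_C, mul_pow, mul_pow, harmPoly_scale_sq,
      ← pow_mul, mul_comm m 2, pow_mul, Real.sq_sqrt hx2]
    ring
  rw [hval]
  refine mul_le_of_le_one_right (by positivity) ?_
  have h := congrArg (fun p : ℝ[X] => p.eval x) (legendrePoly_addition n)
  simp only [eval_add, eval_pow, eval_mul, eval_ofNat, eval_finsetSum, eval_C, eval_sub,
    eval_one, eval_X] at h
  have hnn : ∀ k ∈ Finset.range n, 0 ≤ factRatio n (k+1) *
      ((1 - x^2)^(k+1) * (derivative^[k+1] (legendrePoly n)).eval x ^ 2) := fun k _ => by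
    have := factRatio_pos n (k+1)
    positivity
  rcases m with _ | m
  · simp only [factRatio_zero, pow_zero, one_mul, Function.iterate_zero, id_eq]
    linarith [Finset.sum_nonneg hnn]
  · have := Finset.single_le_sum hnn (Finset.mem_range.2 (show m < n by omega))
    nlinarith [sq_nonneg ((legendrePoly n).eval x)]

lemma polyInt_sq_identity (j : ℕ) (g : ℝ[X]) :
    polyInt ((1 - X^2)^j * ((1 - X^2) * derivative g - C ((j:ℝ)+1) * (X * g))^2) +
      ((j:ℝ)+1)^2 * polyInt (X^2 * (1 - X^2)^j * g^2) =
    polyInt ((1 - X^2)^(j+2) * derivative g ^ 2) +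
      ((j:ℝ)+1) * polyInt ((1 - X^2)^(j+1) * g^2) := by
  have h0 := polyInt_derivative (X * (1 - X^2)^(j+1) * g^2)
  have h1 : ((1 - X^2)^j * ((1 - X^2) * derivative g - C ((j:ℝ)+1) * (X * g))^2) +
      C (((j:ℝ)+1)^2) * (X^2 * (1 - X^2)^j * g^2) +
      C ((j:ℝ)+1) * derivative (X * (1 - X^2)^(j+1) * g^2) =
      (1 - X^2)^(j+2) * derivative g ^ 2 + C ((j:ℝ)+1) * ((1 - X^2)^(j+1) * g^2) := by
    rw [derivative_mul, derivative_mul, derivative_X, derivative_sq, derivative_pow_succ]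
    simp only [derivative_sub, derivative_X_sq, derivative_one, map_add, map_pow, map_natCast,
      map_one, map_ofNat]
    ring
  have h2 := congrArg polyInt h1
  simp only [map_add polyInt, polyInt_C_mul] at h2
  have hz : eval 1 (X * (1 - X^2)^(j+1) * g^2) -
      eval (-1) (X * (1 - X^2)^(j+1) * g^2) = 0 := by simp
  rw [h0, hz] at h2
  linarith

lemma polyInt_X_sq_le (j : ℕ) (g : ℝ[X]) :
    ((j:ℝ)+1)^2 * polyInt (X^2 * (1 - X^2)^j * g^2) ≤
    polyInt ((1 - X^2)^(j+2) * derivative g ^ 2) +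
      ((j:ℝ)+1) * polyInt ((1 - X^2)^(j+1) * g^2) := by
  rw [← polyInt_sq_identity]
  have : 0 ≤ polyInt ((1 - X^2)^j *
      ((1 - X^2) * derivative g - C ((j:ℝ)+1) * (X * g))^2) := by
    refine polyInt_nonneg fun x hx => ?_
    have hx2 : 0 ≤ 1 - x^2 := by nlinarith [hx.1, hx.2]
    simp only [eval_mul, eval_pow, eval_sub, eval_one, eval_X]
    positivity
  linarith

/-- A finite combination of the polynomials `harmPoly n m` for fixed order `m`. -/
def harmComb (s : Finset ℕ) (c : ℕ → ℝ) (m : ℕ) : ℝ[X] := ∑ n ∈ s, C (c n) * harmPoly n m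

lemma polyInt_mul_harmComb (p : ℝ[X]) (s : Finset ℕ) (c : ℕ → ℝ) (m : ℕ) :
    polyInt (p * harmComb s c m) = ∑ n ∈ s, c n * polyInt (p * harmPoly n m) := by
  rw [harmComb, Finset.mul_sum, map_sum]
  refine Finset.sum_congr rfl fun n _ => ?_
  rw [← polyInt_C_mul]; congr 1; ring

lemma polyInt_harmPoly_mul_harmComb {s : Finset ℕ} {m : ℕ} (hs : ∀ n ∈ s, m ≤ n) (c : ℕ → ℝ)
    {n : ℕ} (hn : n ∈ s) :
    polyInt ((1 - X^2)^m * harmPoly n m * harmComb s c m) = c n * (1 / (2 * Real.pi)) := by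
  rw [polyInt_mul_harmComb, Finset.sum_eq_single n]
  · rw [mul_assoc, ← sq, polyInt_harmPoly_sq n m (hs n hn)]
  · intro k hk hkn
    rw [polyInt_harmPoly_orthogonal hkn.symm, mul_zero]
  · exact fun h => absurd hn h

lemma polyInt_harmComb_sq {s : Finset ℕ} {m : ℕ} (hs : ∀ n ∈ s, m ≤ n) (c : ℕ → ℝ) :
    polyInt ((1 - X^2)^m * harmComb s c m ^ 2) = 1 / (2 * Real.pi) * ∑ n ∈ s, c n ^ 2 := by
  rw [sq (harmComb s c m), ← mul_assoc, polyInt_mul_harmComb, Finset.mul_sum]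
  refine Finset.sum_congr rfl fun n hn => ?_
  rw [mul_assoc, mul_comm (harmComb s c m), ← mul_assoc, polyInt_harmPoly_mul_harmComb hs c hn]
  ring

lemma polyInt_derivative_harmComb_sq {s : Finset ℕ} {m : ℕ} (hs : ∀ n ∈ s, m ≤ n)
    (c : ℕ → ℝ) :
    polyInt ((1 - X^2)^(m+1) * derivative (harmComb s c m) ^ 2) =
      1 / (2 * Real.pi) * ∑ n ∈ s, (((n:ℝ) - m) * (n + m + 1)) * c n ^ 2 := by
  have h : (1 - X^2)^(m+1) * derivative (harmComb s c m) ^ 2 = ∑ n ∈ s, C (c n) *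
      ((1 - X^2)^(m+1) * derivative (harmPoly n m) * derivative (harmComb s c m)) := by
    rw [sq (derivative (harmComb s c m)), ← mul_assoc]
    conv_lhs => rw [mul_comm _ (derivative (harmComb s c m))]
    conv_lhs => enter [2, 2]; rw [harmComb]
    rw [derivative_sum, Finset.mul_sum, Finset.mul_sum]
    refine Finset.sum_congr rfl fun n _ => ?_
    rw [derivative_C_mul]; ring
  rw [h, map_sum, Finset.mul_sum]
  refine Finset.sum_congr rfl fun n hn => ?_
  rw [polyInt_C_mul, polyInt_derivative_harmPoly, polyInt_harmPoly_mul_harmComb hs c hn]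
  ring

lemma polyInt_X_sq_harmComb_le {s : Finset ℕ} {j : ℕ} (hs : ∀ n ∈ s, j + 1 ≤ n) (c : ℕ → ℝ) :
    ((j:ℝ)+1)^2 * polyInt (X^2 * (1 - X^2)^j * harmComb s c (j+1) ^ 2) ≤
      1 / (2 * Real.pi) * ∑ n ∈ s, ((n:ℝ) * (n + 1) - ((j:ℝ)+1)^2) * c n ^ 2 := by
  refine (polyInt_X_sq_le j _).trans_eq ?_
  rw [polyInt_derivative_harmComb_sq hs c, polyInt_harmComb_sq hs c, ← mul_assoc,
    mul_comm ((j:ℝ)+1) (1 / (2 * Real.pi)), mul_assoc, ← mul_add, Finset.mul_sum,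
    ← Finset.sum_add_distrib]
  congr 1
  refine Finset.sum_congr rfl fun n _ => ?_
  push_cast; ring

lemma lintegral_cos_mul_eval_sin {q : ℝ[X]} (hq : ∀ x ∈ Icc (-1:ℝ) 1, 0 ≤ q.eval x) :
    ∫⁻ t in Ioc (-(Real.pi/2)) (Real.pi/2), ENNReal.ofReal (q.eval (Real.sin t) * Real.cos t) =
      ENNReal.ofReal (polyInt q) := by
  have hle : -(Real.pi/2) ≤ Real.pi/2 := by linarith [Real.pi_pos]
  have hcont : Continuous fun t => q.eval (Real.sin t) * Real.cos t :=
    (q.continuous.comp Real.continuous_sin).mul Real.continuous_cos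
  rw [← ofReal_integral_eq_lintegral_ofReal]
  · congr 1
    rw [← intervalIntegral.integral_of_le hle, polyInt_apply]
    have := intervalIntegral.integral_comp_mul_deriv (a := -(Real.pi/2)) (b := Real.pi/2)
      (f := Real.sin) (f' := Real.cos) (g := fun x => q.eval x)
      (fun x _ => Real.hasDerivAt_sin x) Real.continuous_cos.continuousOn q.continuous
    simpa using this
  · exact (hcont.integrableOn_Icc).mono_set Ioc_subset_Icc_self
  · refine (ae_restrict_iff' measurableSet_Ioc).2 (Filter.Eventually.of_forall fun t ht => ?_)
    exact mul_nonneg (hq _ ⟨Real.neg_one_le_sin t, Real.sin_le_one t⟩)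
      (Real.cos_nonneg_of_mem_Icc ⟨ht.1.le, ht.2⟩)

lemma sum_tY_eq {s : Finset ℕ} {m : ℕ} (hs : ∀ n ∈ s, m ≤ n) (c : ℕ → ℂ) (x : ℝ)
    (hx : x ∈ Icc (-1:ℝ) 1) :
    ‖∑ n ∈ s, c n * (tY n m x : ℂ)‖^2 = (1 - x^2)^m *
      ((harmComb s (fun n => (c n).re) m).eval x ^ 2 +
        (harmComb s (fun n => (c n).im) m).eval x ^ 2) := by
  have hx2 : 0 ≤ 1 - x^2 := by nlinarith [hx.1, hx.2]
  have hre : (∑ n ∈ s, c n * (tY n m x : ℂ)).re =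
      Real.sqrt (1 - x^2)^m * (harmComb s (fun n => (c n).re) m).eval x := by
    rw [Complex.re_sum, harmComb, eval_finsetSum, Finset.mul_sum]
    refine Finset.sum_congr rfl fun n hn => ?_
    rw [Complex.re_mul_ofReal, tY_natCast n m (hs n hn), eval_mul, eval_C]
    ring
  have him : (∑ n ∈ s, c n * (tY n m x : ℂ)).im =
      Real.sqrt (1 - x^2)^m * (harmComb s (fun n => (c n).im) m).eval x := by
    rw [Complex.im_sum, harmComb, eval_finsetSum, Finset.mul_sum]
    refine Finset.sum_congr rfl fun n hn => ?_
    rw [Complex.im_mul_ofReal, tY_natCast n m (hs n hn), eval_mul, eval_C]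
    ring
  rw [← Complex.normSq_eq_norm_sq, Complex.normSq_apply, hre, him]
  have : (Real.sqrt (1 - x^2)^m)^2 = (1 - x^2)^m := by
    rw [← pow_mul, mul_comm m 2, pow_mul, Real.sq_sqrt hx2]
  rw [← this]
  ring

lemma sum_norm_sq_eq (s : Finset ℕ) (c : ℕ → ℂ) :
    ∑ n ∈ s, ‖c n‖^2 = ∑ n ∈ s, (c n).re^2 + ∑ n ∈ s, (c n).im^2 := by
  rw [← Finset.sum_add_distrib]
  refine Finset.sum_congr rfl fun n _ => ?_
  rw [← Complex.normSq_eq_norm_sq, Complex.normSq_apply]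
  ring

/-- Plancherel's identity on a fixed Fourier mode, as an upper bound with bounded weight. -/
lemma lintegral_sum_tY_le_of_weight_le {s : Finset ℕ} {m : ℕ} (hs : ∀ n ∈ s, m ≤ n) (c : ℕ → ℂ)
    (V : ℝ → ℝ) {A : ℝ} (hA : 0 ≤ A)
    (hV : ∀ t ∈ Ioc (-(Real.pi/2)) (Real.pi/2), V t ≤ A) :
    ∫⁻ t in Ioc (-(Real.pi/2)) (Real.pi/2), ENNReal.ofReal
        (V t * ‖∑ n ∈ s, c n * (tY n m (Real.sin t) : ℂ)‖^2 * Real.cos t) ≤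
      ENNReal.ofReal (A * ∑ n ∈ s, ‖c n‖^2) := by
  set g₁ := harmComb s (fun n => (c n).re) m
  set g₂ := harmComb s (fun n => (c n).im) m
  set q : ℝ[X] := C A * ((1 - X^2)^m * g₁^2) + C A * ((1 - X^2)^m * g₂^2) with hqdef
  have hq : ∀ x ∈ Icc (-1:ℝ) 1, 0 ≤ q.eval x := fun x hx => by
    have hx2 : 0 ≤ 1 - x^2 := by nlinarith [hx.1, hx.2]
    simp only [hqdef, eval_add, eval_mul, eval_C, eval_pow, eval_sub, eval_one, eval_X]
    positivity
  calc _ ≤ ∫⁻ t in Ioc (-(Real.pi/2)) (Real.pi/2),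
        ENNReal.ofReal (q.eval (Real.sin t) * Real.cos t) := by
        refine setLIntegral_mono_ae' measurableSet_Ioc (Filter.Eventually.of_forall
          fun t ht => ENNReal.ofReal_le_ofReal ?_)
        have hcos := Real.cos_nonneg_of_mem_Icc ⟨ht.1.le, ht.2⟩
        refine mul_le_mul_of_nonneg_right ?_ hcos
        refine (mul_le_mul_of_nonneg_right (hV t ht) (by positivity)).trans_eq ?_
        rw [sum_tY_eq hs c _ ⟨Real.neg_one_le_sin t, Real.sin_le_one t⟩]
        simp only [hqdef, eval_add, eval_mul, eval_C, eval_pow, eval_sub, eval_one, eval_X]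
        ring
    _ = ENNReal.ofReal (polyInt q) := lintegral_cos_mul_eval_sin hq
    _ ≤ _ := by
        refine ENNReal.ofReal_le_ofReal ?_
        rw [hqdef, map_add, polyInt_C_mul, polyInt_C_mul, polyInt_harmComb_sq hs,
          polyInt_harmComb_sq hs, ← mul_add, ← mul_add, ← sum_norm_sq_eq]
        refine mul_le_mul_of_nonneg_left ?_ hA
        refine mul_le_of_le_one_left (Finset.sum_nonneg fun _ _ => by positivity) ?_
        rw [div_le_one (by positivity)]
        linarith [Real.pi_gt_three]

lemma weight_interpolation {a R y : ℝ} (ha0 : 0 ≤ a) (ha2 : a ≤ 2) (hR : 1 ≤ R) (hy : 0 ≤ y) :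
    (1 + y)^a ≤ 3 * R^a + 2 * R^a / R^2 * y^2 := by
  have hR0 : 0 < R := by linarith
  have hRa : 0 < R^a := Real.rpow_pos_of_pos hR0 a
  rcases le_total (1 + y) R with h | h
  · have := Real.rpow_le_rpow (by linarith) h ha0
    have : 0 ≤ 2 * R^a / R^2 * y^2 := by positivity
    linarith
  · have h1 : ((1 + y) / R)^a ≤ ((1 + y) / R)^(2:ℝ) :=
      Real.rpow_le_rpow_of_exponent_le ((one_le_div hR0).2 h) ha2
    rw [Real.div_rpow (by linarith) hR0.le, Real.rpow_two, div_le_iff₀ hRa] at h1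
    refine h1.trans ?_
    have h2 : (1 + y)^2 ≤ 2 * R^2 + 2 * y^2 := by nlinarith [sq_nonneg (1 - y)]
    calc ((1 + y) / R)^2 * R^a = (1 + y)^2 * (R^a / R^2) := by rw [div_pow]; ring
      _ ≤ (2 * R^2 + 2 * y^2) * (R^a / R^2) := mul_le_mul_of_nonneg_right h2 (by positivity)
      _ = 2 * R^a + 2 * R^a / R^2 * y^2 := by field_simp
      _ ≤ _ := by linarith

/-- The weighted Plancherel estimate on a Fourier mode of order `m ≥ 1`. -/
lemma lintegral_weight_sum_tY_le {s : Finset ℕ} {m : ℕ} (hm : 1 ≤ m) (hs : ∀ n ∈ s, m ≤ n)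
    (c : ℕ → ℂ) {a μ N : ℝ} (ha0 : 0 ≤ a) (ha2 : a ≤ 2) (hμ : 0 < μ) (hN : 0 ≤ N)
    (hsN : ∀ n ∈ s, (n:ℝ) * (n + 1) - (m:ℝ)^2 ≤ N^2) :
    ∫⁻ t in Ioc (-(Real.pi/2)) (Real.pi/2), ENNReal.ofReal
        ((1 + |t| / μ)^a * ‖∑ n ∈ s, c n * (tY n m (Real.sin t) : ℂ)‖^2 * Real.cos t) ≤
      ENNReal.ofReal (5 * (1 + N / (μ * m))^a * ∑ n ∈ s, ‖c n‖^2) := by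
  obtain ⟨j, rfl⟩ : ∃ j, m = j + 1 := ⟨m - 1, by omega⟩
  set g₁ := harmComb s (fun n => (c n).re) (j+1) with hg₁
  set g₂ := harmComb s (fun n => (c n).im) (j+1) with hg₂
  set R : ℝ := 1 + N / (μ * ((j+1 : ℕ) : ℝ)) with hR
  have hj : (0:ℝ) < ((j+1 : ℕ) : ℝ) := by positivity
  have hR1 : 1 ≤ R := by
    have : 0 ≤ N / (μ * ((j+1 : ℕ) : ℝ)) := by positivity
    linarith
  have hRa : 0 < R^a := Real.rpow_pos_of_pos (by linarith) a
  set B : ℝ := 2 * R^a / R^2 / μ^2 with hB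
  have hB0 : 0 ≤ B := by positivity
  set q : ℝ[X] := C (3 * R^a) * ((1 - X^2)^(j+1) * g₁^2) +
    C (3 * R^a) * ((1 - X^2)^(j+1) * g₂^2) + (C B * (X^2 * (1 - X^2)^j * g₁^2) +
    C B * (X^2 * (1 - X^2)^j * g₂^2)) with hqdef
  have hq : ∀ x ∈ Icc (-1:ℝ) 1, 0 ≤ q.eval x := fun x hx => by
    have hx2 : 0 ≤ 1 - x^2 := by nlinarith [hx.1, hx.2]
    simp only [hqdef, eval_add, eval_mul, eval_C, eval_pow, eval_sub, eval_one, eval_X]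
    positivity
  calc _ ≤ ∫⁻ t in Ioc (-(Real.pi/2)) (Real.pi/2),
        ENNReal.ofReal (q.eval (Real.sin t) * Real.cos t) := by
        refine setLIntegral_mono_ae' measurableSet_Ioc (Filter.Eventually.of_forall
          fun t ht => ENNReal.ofReal_le_ofReal ?_)
        rcases eq_or_lt_of_le ht.2 with rfl | htlt
        · simp
        have hcos := Real.cos_pos_of_mem_Ioo ⟨ht.1, htlt⟩
        refine mul_le_mul_of_nonneg_right ?_ hcos.le
        rw [sum_tY_eq hs c _ ⟨Real.neg_one_le_sin t, Real.sin_le_one t⟩]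
        have hx2 : 1 - Real.sin t ^ 2 = Real.cos t ^ 2 := by
          rw [← Real.cos_sq']
        have ht2 : t^2 * Real.cos t ^ 2 ≤ Real.sin t ^ 2 := by
          have h1 : |t| ≤ |Real.tan t| := by
            rcases le_total 0 t with h | h
            · rw [abs_of_nonneg h]
              exact (Real.le_tan h htlt).trans (le_abs_self _)
            · rw [abs_of_nonpos h, ← abs_neg, ← Real.tan_neg]
              exact (Real.le_tan (by linarith) (by linarith [ht.1])).trans (le_abs_self _)
          have h2 : t^2 ≤ Real.tan t ^ 2 := sq_le_sq.2 h1
          calc _ ≤ Real.tan t ^ 2 * Real.cos t ^ 2 :=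
                mul_le_mul_of_nonneg_right h2 (by positivity)
            _ = _ := by rw [← mul_pow, Real.tan_mul_cos hcos.ne']
        have hw := weight_interpolation ha0 ha2 hR1 (y := |t| / μ) (by positivity)
        rw [div_pow, sq_abs] at hw
        simp only [hqdef, eval_add, eval_mul, eval_C, eval_pow, eval_sub, eval_one, eval_X]
        rw [hx2]
        set G := g₁.eval (Real.sin t) ^ 2 + g₂.eval (Real.sin t) ^ 2 with hG
        have hG0 : 0 ≤ G := by positivity
        calc _ ≤ (3 * R^a + 2 * R^a / R^2 * (t^2 / μ^2)) *
              ((Real.cos t ^ 2)^(j+1) * G) :=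
              mul_le_mul_of_nonneg_right hw (by positivity)
          _ = 3 * R^a * ((Real.cos t ^ 2)^(j+1) * G) +
              B * (t^2 * Real.cos t ^ 2) * ((Real.cos t ^ 2)^j * G) := by
              rw [hB]; ring
          _ ≤ 3 * R^a * ((Real.cos t ^ 2)^(j+1) * G) +
              B * (Real.sin t ^ 2) * ((Real.cos t ^ 2)^j * G) := by gcongr
          _ = _ := by rw [hG]; ring
    _ = ENNReal.ofReal (polyInt q) := lintegral_cos_mul_eval_sin hq
    _ ≤ _ := by
        refine ENNReal.ofReal_le_ofReal ?_
        have hbd : ∀ d : ℕ → ℝ, polyInt (X^2 * (1 - X^2)^j * harmComb s d (j+1) ^ 2) ≤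
            N^2 / ((j+1 : ℕ) : ℝ)^2 * (1 / (2 * Real.pi) * ∑ n ∈ s, d n ^ 2) := by
          intro d
          have h1 := polyInt_X_sq_harmComb_le hs d
          have h2 : ∑ n ∈ s, ((n:ℝ) * (n + 1) - ((j:ℝ)+1)^2) * d n ^ 2 ≤
              N^2 * ∑ n ∈ s, d n ^ 2 := by
            rw [Finset.mul_sum]
            refine Finset.sum_le_sum fun n hn => mul_le_mul_of_nonneg_right ?_ (sq_nonneg _)
            have := hsN n hn
            push_cast at this
            exact this
          rw [div_mul_eq_mul_div, le_div_iff₀ (by positivity)]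
          have h3 := mul_le_mul_of_nonneg_left h2
            (show 0 ≤ 1 / (2 * Real.pi) by positivity)
          push_cast
          nlinarith
        have hb₁ := mul_le_mul_of_nonneg_left (hbd fun n => (c n).re) hB0
        have hb₂ := mul_le_mul_of_nonneg_left (hbd fun n => (c n).im) hB0
        rw [← hg₁] at hb₁
        rw [← hg₂] at hb₂
        rw [hqdef, map_add, map_add, map_add, polyInt_C_mul, polyInt_C_mul, polyInt_C_mul,
          polyInt_C_mul, polyInt_harmComb_sq hs, polyInt_harmComb_sq hs, sum_norm_sq_eq]
        set S₁ := ∑ n ∈ s, (c n).re ^ 2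
        set S₂ := ∑ n ∈ s, (c n).im ^ 2
        have hS₁ : 0 ≤ S₁ := Finset.sum_nonneg fun _ _ => sq_nonneg _
        have hS₂ : 0 ≤ S₂ := Finset.sum_nonneg fun _ _ => sq_nonneg _
        have hBN : B * (N^2 / ((j+1 : ℕ) : ℝ)^2) ≤ 2 * R^a := by
          have h1 : B * (N^2 / ((j+1 : ℕ) : ℝ)^2) = 2 * R^a * ((R - 1)/R)^2 := by
            rw [hB, hR]; field_simp; ring
          rw [h1]
          refine mul_le_of_le_one_right (by positivity) ?_
          rw [div_pow, div_le_one (by positivity)]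
          nlinarith
        have hpi : 1 / (2 * Real.pi) ≤ 1 := by
          rw [div_le_one (by positivity)]; linarith [Real.pi_gt_three]
        set ν := 1 / (2 * Real.pi)
        have hν : 0 ≤ ν := by positivity
        have e1 : B * (N^2 / ((j+1 : ℕ) : ℝ)^2 * (ν * S₁)) ≤ 2 * R^a * (ν * S₁) := by
          rw [← mul_assoc]; exact mul_le_mul_of_nonneg_right hBN (by positivity)
        have e2 : B * (N^2 / ((j+1 : ℕ) : ℝ)^2 * (ν * S₂)) ≤ 2 * R^a * (ν * S₂) := by
          rw [← mul_assoc]; exact mul_le_mul_of_nonneg_right hBN (by positivity)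
        have e3 : 5 * R^a * (ν * (S₁ + S₂)) ≤ 5 * R^a * (S₁ + S₂) :=
          mul_le_mul_of_nonneg_left (mul_le_of_le_one_left (by positivity) hpi) (by positivity)
        linarith

/-- A solution `u` of the associated Legendre equation on `[0,1]`, written as a first order
system in `(u, v)` with `v = (1-x²) u'`, vanishing at `1` and normalised at `0`. -/
structure LegendrePair (u v : ℝ → ℝ) (lam m : ℝ) : Prop where
  one_le_order : 1 ≤ m
  one_le_lam : 1 ≤ lam
  cont_u : Continuous u
  cont_v : Continuous v
  deriv_u : ∀ x ∈ Ico (0:ℝ) 1, HasDerivAt u (v x / (1 - x^2)) x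
  deriv_v : ∀ x ∈ Ico (0:ℝ) 1,
    HasDerivAt v (-(lam - (lam + m^2) * x^2) * u x / (1 - x^2)) x
  lam_large : lam + m^2 ≤ 2 * lam^2
  u_one : u 1 = 0
  v_one : v 1 = 0
  energy_zero : lam * u 0 ^ 2 + v 0 ^ 2 ≤ Real.sqrt (lam + m^2) * Real.sqrt lam

namespace LegendrePair

variable {u v : ℝ → ℝ} {lam m : ℝ}

lemma one_sub_sq_pos {x : ℝ} (hx : x ∈ Ico (0:ℝ) 1) : 0 < 1 - x^2 := by
  nlinarith [hx.1, hx.2]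

lemma hasDerivAt_energy (h : LegendrePair u v lam m) {x : ℝ} (hx : x ∈ Ico (0:ℝ) 1) :
    HasDerivAt (fun y => (lam - (lam + m^2) * y^2) * u y ^ 2 + v y ^ 2)
      (-(2 * (lam + m^2) * x * u x ^ 2)) x := by
  have hw := one_sub_sq_pos hx
  have hQ : HasDerivAt (fun y : ℝ => lam - (lam + m^2) * y^2) (-((lam + m^2) * (2 * x))) x := by
    simpa using ((hasDerivAt_pow 2 x).const_mul (lam + m^2)).const_sub lam
  have := (hQ.mul ((h.deriv_u x hx).pow 2)).add ((h.deriv_v x hx).pow 2)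
  refine this.congr_deriv ?_
  simp only [Pi.pow_apply]
  field_simp
  ring

lemma energy_antitoneOn (h : LegendrePair u v lam m) :
    AntitoneOn (fun y => (lam - (lam + m^2) * y^2) * u y ^ 2 + v y ^ 2) (Icc 0 1) := by
  have hu := h.cont_u
  have hv := h.cont_v
  have hl := h.one_le_lam
  refine antitoneOn_of_deriv_nonpos (convex_Icc 0 1) (by fun_prop) ?_ ?_
  · intro x hx
    rw [interior_Icc] at hx
    exact (h.hasDerivAt_energy ⟨hx.1.le, hx.2⟩).differentiableAt.differentiableWithinAt
  · intro x hx
    rw [interior_Icc] at hx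
    rw [(h.hasDerivAt_energy ⟨hx.1.le, hx.2⟩).deriv]
    have := hx.1
    have : 0 ≤ 2 * (lam + m^2) * x * u x ^ 2 := by positivity
    linarith

lemma energy_nonneg (h : LegendrePair u v lam m) {x : ℝ} (hx : x ∈ Icc (0:ℝ) 1) :
    0 ≤ (lam - (lam + m^2) * x^2) * u x ^ 2 + v x ^ 2 := by
  have := h.energy_antitoneOn hx ⟨zero_le_one, le_rfl⟩ hx.2
  simpa [h.u_one, h.v_one] using this

lemma amplitude_le_of_le (h : LegendrePair u v lam m) {b q : ℝ} (hb : b ∈ Ioo (0:ℝ) 1) (hq : 0 < q)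
    (hqb : q^2 = lam - (lam + m^2) * b^2) (hβ : (lam + m^2) * b * (1 - b^2) ≤ q^3)
    {x : ℝ} (hx : x ∈ Icc 0 b) :
    Real.sqrt (lam - (lam + m^2) * x^2) * u x ^ 2 +
      v x ^ 2 / Real.sqrt (lam - (lam + m^2) * x^2) ≤ 6 * Real.sqrt (lam + m^2) := by
  have hu := h.cont_u
  have hv := h.cont_v
  have hl := h.one_le_lam
  set L := lam + m^2 with hL
  have hL0 : 0 < L := by positivity
  set p : ℝ → ℝ := fun x => Real.sqrt (lam - L * x^2) with hp
  have hQpos : ∀ x ∈ Icc (0:ℝ) b, 0 < lam - L * x^2 := by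
    intro x hx
    have : x^2 ≤ b^2 := by nlinarith [hx.1, hx.2]
    have : 0 < q^2 := by positivity
    nlinarith
  have hppos : ∀ x ∈ Icc (0:ℝ) b, 0 < p x := fun x hx => Real.sqrt_pos.2 (hQpos x hx)
  have hpsq : ∀ x ∈ Icc (0:ℝ) b, p x ^ 2 = lam - L * x^2 := fun x hx =>
    Real.sq_sqrt (hQpos x hx).le
  have hpb : p b = q := by rw [hp]; simp only; rw [← hqb, Real.sqrt_sq hq.le]
  set β : ℝ → ℝ := fun x => -(L * x * (1 - x^2) / p x ^ 3) with hβdef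
  set β' : ℝ → ℝ := fun x => -(L * ((1 - 3*x^2) * p x ^ 2 + 3 * L * x^2 * (1 - x^2)) / p x ^ 5)
    with hβ'def
  have dp : ∀ x ∈ Icc (0:ℝ) b, HasDerivAt p (-(L * x / p x)) x := by
    intro x hx
    have h1 : HasDerivAt (fun y : ℝ => lam - L * y^2) (-(L * (2 * x))) x := by
      simpa using ((hasDerivAt_pow 2 x).const_mul L).const_sub lam
    refine (h1.sqrt (hQpos x hx).ne').congr_deriv ?_
    have := hppos x hx
    change _ = -(L * x / Real.sqrt (lam - L * x^2))
    have h2 : Real.sqrt (lam - L * x^2) ≠ 0 := this.ne'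
    field_simp
  have dβ : ∀ x ∈ Icc (0:ℝ) b, HasDerivAt β (β' x) x := by
    intro x hx
    have hpx := (hppos x hx).ne'
    have h1 : HasDerivAt (fun y : ℝ => L * y * (1 - y^2)) (L * (1 - 3 * x^2)) x := by
      have := ((hasDerivAt_id x).const_mul L).mul (((hasDerivAt_pow 2 x)).const_sub 1)
      refine this.congr_deriv ?_
      simp; ring
    have := (h1.div ((dp x hx).pow 3) (pow_ne_zero 3 hpx)).neg
    refine this.congr_deriv ?_
    simp only [hβ'def]
    field_simp
    simp
    ring
  have hβ'le : ∀ x ∈ Icc (0:ℝ) b, β' x ≤ 0 := by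
    intro x hx
    have hpx := hppos x hx
    have hx1 : 0 < 1 - x^2 := one_sub_sq_pos ⟨hx.1, hx.2.trans_lt hb.2⟩
    have : 0 ≤ (1 - 3*x^2) * p x ^ 2 + 3 * L * x^2 * (1 - x^2) := by
      rw [hpsq x hx]
      have e : (1 - 3*x^2) * (lam - L * x^2) + 3 * L * x^2 * (1 - x^2) =
        lam * (1 - x^2) + 2 * x^2 * m^2 := by rw [hL]; ring
      rw [e]; positivity
    simp only [hβ'def, neg_nonpos]
    positivity
  have hβanti : AntitoneOn β (Icc 0 b) := by
    refine antitoneOn_of_deriv_nonpos (convex_Icc 0 b)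
      (fun x hx => (dβ x hx).continuousAt.continuousWithinAt) ?_ ?_
    · intro x hx
      exact (dβ x (interior_subset hx)).differentiableAt.differentiableWithinAt
    · intro x hx
      rw [(dβ x (interior_subset hx)).deriv]
      exact hβ'le x (interior_subset hx)
  have hbm : b ∈ Icc (0:ℝ) b := ⟨hb.1.le, le_rfl⟩
  have h0m : (0:ℝ) ∈ Icc (0:ℝ) b := ⟨le_rfl, hb.1.le⟩
  have hβb : -1 ≤ β b := by
    simp only [hβdef, hpb]
    rw [neg_le_neg_iff, div_le_one (by positivity)]
    exact hβ
  have hβ0 : β 0 = 0 := by simp [hβdef]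
  have hβrange : ∀ x ∈ Icc (0:ℝ) b, |β x| ≤ 1 := by
    intro x hx
    have h1 := hβanti hx hbm hx.2
    have h2 := hβanti h0m hx hx.1
    rw [abs_le]; constructor <;> linarith
  set A : ℝ → ℝ := fun x => p x * u x ^ 2 + v x ^ 2 / p x with hA
  have hAuv : ∀ x ∈ Icc (0:ℝ) b, |u x * v x| ≤ A x / 2 := by
    intro x hx
    have hpx := hppos x hx
    have e1 : A x - 2 * (u x * v x) = (p x * u x - v x)^2 / p x := by
      simp only [hA]; field_simp; ring
    have e2 : A x + 2 * (u x * v x) = (p x * u x + v x)^2 / p x := by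
      simp only [hA]; field_simp; ring
    have i1 : 0 ≤ (p x * u x - v x)^2 / p x := by positivity
    have i2 : 0 ≤ (p x * u x + v x)^2 / p x := by positivity
    rw [abs_le]; constructor <;> linarith
  set W : ℝ → ℝ := fun x => A x + β x * (u x * v x) with hW
  have hWge : ∀ x ∈ Icc (0:ℝ) b, A x / 2 ≤ W x := by
    intro x hx
    have h1 : |β x * (u x * v x)| ≤ 1 * (A x / 2) := by
      rw [abs_mul]
      exact mul_le_mul (hβrange x hx) (hAuv x hx) (abs_nonneg _) zero_le_one
    have := (abs_le.1 h1).1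
    simp only [hW]; linarith
  have dW : ∀ x ∈ Icc (0:ℝ) b, HasDerivAt W (β' x * (u x * v x)) x := by
    intro x hx
    have hx1 : x ∈ Ico (0:ℝ) 1 := ⟨hx.1, hx.2.trans_lt hb.2⟩
    have hw := one_sub_sq_pos hx1
    have hpx := (hppos x hx).ne'
    have du := h.deriv_u x hx1
    have dv := h.deriv_v x hx1
    rw [← hL, ← hpsq x hx] at dv
    have := (((dp x hx).mul (du.pow 2)).add ((dv.pow 2).div (dp x hx) hpx)).add
      ((dβ x hx).mul (du.mul dv))
    refine this.congr_deriv ?_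
    simp only [hβdef, Pi.pow_apply, Pi.mul_apply]
    field_simp
    ring
  have hanti : AntitoneOn (fun x => W x * Real.exp (β x)) (Icc 0 b) := by
    have dWe : ∀ x ∈ Icc (0:ℝ) b, HasDerivAt (fun x => W x * Real.exp (β x))
        (β' x * (u x * v x) * Real.exp (β x) + W x * (Real.exp (β x) * β' x)) x :=
      fun x hx => (dW x hx).mul (dβ x hx).exp
    refine antitoneOn_of_deriv_nonpos (convex_Icc 0 b)
      (fun x hx => (dWe x hx).continuousAt.continuousWithinAt) ?_ ?_
    · intro x hx
      exact (dWe x (interior_subset hx)).differentiableAt.differentiableWithinAt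
    · intro x hx
      have hx := interior_subset hx
      rw [(dWe x hx).deriv]
      have h1 := (abs_le.1 (hAuv x hx)).1
      have h2 := hWge x hx
      have e : β' x * (u x * v x) * Real.exp (β x) + W x * (Real.exp (β x) * β' x) =
        β' x * (Real.exp (β x) * (u x * v x + W x)) := by ring
      rw [e]
      exact mul_nonpos_of_nonpos_of_nonneg (hβ'le x hx)
        (mul_nonneg (Real.exp_pos _).le (by linarith))
  have key := hanti h0m hx hx.1
  simp only at key
  rw [hβ0, Real.exp_zero, mul_one] at key
  have hW0 : W 0 ≤ Real.sqrt L := by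
    have h1 := h.energy_zero
    have hp0 : p 0 = Real.sqrt lam := by simp [hp]
    have hs : 0 < Real.sqrt lam := Real.sqrt_pos.2 (by linarith)
    simp only [hW, hβ0, hA, hp0]
    rw [zero_mul, add_zero]
    have e : Real.sqrt lam * u 0 ^ 2 + v 0 ^ 2 / Real.sqrt lam =
        (lam * u 0 ^ 2 + v 0 ^ 2) / Real.sqrt lam := by
      field_simp
      rw [Real.sq_sqrt (by linarith)]
      ring
    rw [e, div_le_iff₀ hs]
    exact h1
  have hexp : Real.exp (-1) ≤ Real.exp (β x) :=
    Real.exp_le_exp.2 (abs_le.1 (hβrange x hx)).1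
  have he : (1/3 : ℝ) ≤ Real.exp (-1) := by
    rw [Real.exp_neg, one_div]
    exact inv_anti₀ (Real.exp_pos 1) (by linarith [Real.exp_one_lt_d9])
  have hWx := hWge x hx
  have hpx := hppos x hx
  have hAx0 : 0 ≤ A x := by
    simp only [hA]; positivity
  have : A x ≤ 6 * Real.sqrt L := by nlinarith
  exact this

lemma exists_transition (h : LegendrePair u v lam m) :
    ∃ b q x₀ : ℝ, b ∈ Ioo 0 x₀ ∧ x₀ ∈ Ioo 0 1 ∧ (lam + m^2) * x₀^2 = lam ∧ 0 < q ∧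
      q^2 = lam - (lam + m^2) * b^2 ∧ (lam + m^2) * b * (1 - b^2) = q^3 := by
  have hl := h.one_le_lam
  have hm := h.one_le_order
  set L := lam + m^2 with hL
  have hL0 : 0 < L := by positivity
  have hx0 : 0 < lam / L := by positivity
  have hx1 : lam / L < 1 := by rw [div_lt_one hL0, hL]; nlinarith
  set x₀ := Real.sqrt (lam / L) with hx₀
  have hx₀0 : 0 < x₀ := Real.sqrt_pos.2 hx0
  have hx₀sq : x₀^2 = lam / L := Real.sq_sqrt hx0.le
  have hx₀1 : x₀ < 1 := by
    nlinarith
  have hx₀L : L * x₀^2 = lam := by rw [hx₀sq]; field_simp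
  set f : ℝ → ℝ := fun x => Real.sqrt (lam - L * x^2) ^ 3 - L * x * (1 - x^2) with hf
  have hcont : ContinuousOn f (Icc 0 x₀) := by fun_prop
  have hf0 : 0 < f 0 := by
    have : 0 < Real.sqrt lam := Real.sqrt_pos.2 (by linarith)
    simp only [hf]; norm_num; positivity
  have hfx : f x₀ < 0 := by
    have : 0 < 1 - x₀^2 := by nlinarith
    have : 0 < L * x₀ * (1 - x₀^2) := by positivity
    simp only [hf, hx₀L, sub_self, Real.sqrt_zero]
    linarith
  obtain ⟨b, hb, hfb⟩ := intermediate_value_Icc' hx₀0.le hcont ⟨hfx.le, hf0.le⟩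
  have hb0 : 0 < b := lt_of_le_of_ne hb.1 (by rintro rfl; linarith)
  have hbx : b < x₀ := lt_of_le_of_ne hb.2 (by rintro rfl; linarith)
  have hQ : 0 < lam - L * b^2 := by nlinarith [mul_pos hL0 (sub_pos.2 hbx)]
  refine ⟨b, Real.sqrt (lam - L * b^2), x₀, ⟨hb0, hbx⟩, ⟨hx₀0, hx₀1⟩, hx₀L, Real.sqrt_pos.2 hQ,
    Real.sq_sqrt hQ.le, ?_⟩
  simp only [hf] at hfb
  linarith

lemma transition_length_le {lam m b q x₀ : ℝ} (hm : 1 ≤ m) (hb : b ∈ Ioo 0 x₀)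
    (hx₀ : x₀ ∈ Ioo (0:ℝ) 1) (hq : 0 < q) (hx₀L : (lam + m^2) * x₀^2 = lam)
    (hqb : q^2 = lam - (lam + m^2) * b^2) (hbq : (lam + m^2) * b * (1 - b^2) = q^3) :
    (x₀ - b) * (lam + m^2) * q ≤ 5/2 * m^2 := by
  have hb1 : b < 1 := hb.2.trans hx₀.2
  set L := lam + m^2 with hL
  have hbq2 : b * (m^2 + q^2) = q^3 := by
    have : L * (1 - b^2) = m^2 + q^2 := by rw [hqb, hL]; ring
    rw [← this, ← hbq]; ring
  have hq4 : q^2 ≤ 4 * m^2 := by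
    by_contra hcon
    push Not at hcon
    have h1 : q^3 ≤ 1 * (m^2 + q^2) := by
      rw [← hbq2]; exact mul_le_mul_of_nonneg_right hb1.le (by positivity)
    have h2 : q^3 < 5/4 * q^2 := by nlinarith
    have h3 : q < 5/4 := by
      by_contra hc
      push Not at hc
      nlinarith [mul_le_mul_of_nonneg_right hc (sq_nonneg q)]
    nlinarith
  have hq3 : q^3 ≤ 5 * m^2 * b := by
    rw [← hbq2]; nlinarith [hb.1]
  have e1 : L * (x₀ - b) * (x₀ + b) = q^2 := by rw [hqb]; linarith
  have hs : 0 < x₀ + b := by linarith [hb.1, hx₀.1]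
  have : (x₀ - b) * L * q * (x₀ + b) ≤ 5/2 * m^2 * (x₀ + b) := by
    calc _ = q^3 := by rw [pow_succ, ← e1]; ring
      _ ≤ 5 * m^2 * b := hq3
      _ ≤ _ := by nlinarith [hb.2, mul_pos (show 0 < m^2 by positivity) (sub_pos.2 hb.2)]
  exact le_of_mul_le_mul_right this hs

set_option maxHeartbeats 1000000 in
/-- Bounds for a Legendre pair up to the turning point. -/
lemma bounds_le_turning (h : LegendrePair u v lam m) {x : ℝ} (hx : 0 ≤ x)
    (hQx : (lam + m^2) * x^2 ≤ lam) :
    Real.sqrt (lam - (lam + m^2) * x^2) * u x ^ 2 ≤ 74 * Real.sqrt (lam + m^2) ∧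
    ((lam + m^2) * x^2 = lam → |u x * v x| ≤ 21 * Real.sqrt (lam + m^2)) := by
  obtain ⟨b, q, x₀, hb, hx₀, hx₀L, hq, hqb, hbq⟩ := h.exists_transition
  have hl := h.one_le_lam
  have hm := h.one_le_order
  have hb1 : b < 1 := hb.2.trans hx₀.2
  have hqs : Real.sqrt (lam - (lam + m^2) * b^2) = q := by rw [← hqb, Real.sqrt_sq hq.le]
  have hamp := fun {y : ℝ} (hy : y ∈ Icc 0 b) =>
    h.amplitude_le_of_le ⟨hb.1, hb1⟩ hq hqb hbq.le hy
  set L := lam + m^2 with hL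
  have hL0 : 0 < L := by positivity
  set B := 6 * Real.sqrt L with hB
  have hB0 : 0 < B := by
    have := Real.sqrt_pos.2 hL0
    positivity
  have hxx₀ : x ≤ x₀ := by
    have : x^2 ≤ x₀^2 := by
      have : L * x^2 ≤ L * x₀^2 := by linarith
      exact le_of_mul_le_mul_left this hL0
    exact (sq_le_sq₀ hx hx₀.1.le).1 this
  rcases lt_or_ge x b with hxb | hbx
  · constructor
    · have h1 := hamp ⟨hx, hxb.le⟩
      have : 0 ≤ v x ^ 2 / Real.sqrt (lam - L * x^2) := by positivity
      linarith
    · intro he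
      exfalso
      have h1 : L * (x₀^2 - x^2) = 0 := by linarith
      have h2 : 0 < x₀^2 - x^2 := by nlinarith [hb.2]
      have := mul_pos hL0 h2
      linarith
  set S := Real.sqrt (B / q) with hS
  have hS0 : 0 < S := Real.sqrt_pos.2 (by positivity)
  have hSB : q * S^2 = B := by
    rw [hS, Real.sq_sqrt (by positivity)]; field_simp
  have hampb := hamp ⟨hb.1.le, le_rfl⟩
  rw [hqs] at hampb
  have hub : |u b| ≤ S := by
    refine abs_le_of_sq_le_sq ?_ hS0.le
    have : 0 ≤ v b ^ 2 / q := by positivity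
    have : q * u b ^ 2 ≤ q * S^2 := by linarith
    exact le_of_mul_le_mul_left this hq
  have hv : ∀ y ∈ Icc b x₀, |v y| ≤ q * S := by
    intro y hy
    refine abs_le_of_sq_le_sq ?_ (by positivity)
    have hanti := h.energy_antitoneOn ⟨hb.1.le, hb1.le⟩
      ⟨hb.1.le.trans hy.1, hy.2.trans hx₀.2.le⟩ hy.1
    simp only at hanti
    rw [← hL, ← hqb] at hanti
    have h1 : 0 ≤ (lam - L * y^2) * u y ^ 2 := by
      refine mul_nonneg ?_ (sq_nonneg _)
      have : y^2 ≤ x₀^2 := by nlinarith [hy.1, hy.2, hb.1]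
      nlinarith
    have h2 : q^2 * u b ^ 2 + v b ^ 2 = q * (q * u b ^ 2 + v b ^ 2 / q) := by field_simp
    have h3 : q * (q * u b ^ 2 + v b ^ 2 / q) ≤ q * B := mul_le_mul_of_nonneg_left hampb hq.le
    calc v y ^ 2 ≤ q * B := by linarith
      _ = (q * S)^2 := by rw [← hSB]; ring
  have hm2 : 0 < m^2 := by positivity
  have hlen : (x₀ - b) * L * q ≤ 5/2 * m^2 := transition_length_le hm hb hx₀ hq hx₀L hqb hbq
  have hw0 : 1 - x₀^2 = m^2 / L := by
    rw [eq_div_iff hL0.ne', hL]; linarith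
  have hmv : |u x - u b| ≤ q * S / (m^2 / L) * |x - b| := by
    have := Convex.norm_image_sub_le_of_norm_hasDerivWithin_le
      (f := u) (f' := fun y => v y / (1 - y^2)) (s := Icc b x₀) (C := q * S / (m^2 / L))
      (x := b) (y := x)
      (fun y hy => (h.deriv_u y
        ⟨hb.1.le.trans hy.1, hy.2.trans_lt hx₀.2⟩).hasDerivWithinAt) ?_ (convex_Icc _ _)
      ⟨le_rfl, hb.2.le⟩ ⟨hbx, hxx₀⟩
    · simpa [Real.norm_eq_abs] using this
    · intro y hy
      have hwy : m^2 / L ≤ 1 - y^2 := by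
        rw [← hw0]; nlinarith [hy.1, hy.2, hb.1]
      have hmL : 0 < m^2 / L := by positivity
      rw [Real.norm_eq_abs, abs_div, abs_of_pos (hmL.trans_le hwy)]
      exact div_le_div₀ (by positivity) (hv y hy) hmL hwy
  have hux : |u x| ≤ 7/2 * S := by
    have h1 : q * S / (m^2 / L) * |x - b| ≤ 5/2 * S := by
      rw [abs_of_nonneg (by linarith)]
      have : (x - b) * L * q ≤ 5/2 * m^2 := by
        refine le_trans ?_ hlen
        gcongr
      calc _ = S * ((x - b) * L * q) / m^2 := by field_simp
        _ ≤ S * (5/2 * m^2) / m^2 := by gcongr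
        _ = _ := by field_simp
    have h2 := abs_sub_abs_le_abs_sub (u x) (u b)
    linarith
  have hux2 : u x ^ 2 ≤ 49/4 * S^2 := by
    rw [← sq_abs]
    calc |u x|^2 ≤ (7/2 * S)^2 := by gcongr
      _ = _ := by ring
  constructor
  · have hQq : Real.sqrt (lam - L * x^2) ≤ q := by
      rw [← hqs]
      refine Real.sqrt_le_sqrt ?_
      have : b^2 ≤ x^2 := by nlinarith [hb.1]
      nlinarith
    calc _ ≤ q * (49/4 * S^2) := mul_le_mul hQq hux2 (sq_nonneg _) hq.le
      _ = 49/4 * B := by rw [← hSB]; ring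
      _ ≤ _ := by rw [hB]; linarith [Real.sqrt_nonneg L]
  · intro _
    rw [abs_mul]
    calc _ ≤ (7/2 * S) * (q * S) :=
          mul_le_mul hux (hv x ⟨hbx, hxx₀⟩) (abs_nonneg _) (by positivity)
      _ = 7/2 * B := by rw [← hSB]; ring
      _ ≤ _ := by rw [hB]; linarith

/-- Beyond the turning point `-u v` controls the solution. -/
lemma beyond_turning (h : LegendrePair u v lam m) {x : ℝ} (hx : x ∈ Icc (0:ℝ) 1)
    (hQx : lam ≤ (lam + m^2) * x^2) :
    0 ≤ -(u x * v x) ∧ -(u x * v x) ≤ 21 * Real.sqrt (lam + m^2) ∧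
      ((lam + m^2) * x^2 - lam) * (u x ^ 2)^2 ≤ (-(u x * v x))^2 := by
  have hl := h.one_le_lam
  have hm := h.one_le_order
  have hu := h.cont_u
  have hv := h.cont_v
  obtain ⟨-, -, x₀, -, hx₀, hx₀L, -⟩ := h.exists_transition
  set L := lam + m^2 with hL
  have hL0 : 0 < L := by positivity
  have hxx₀ : x₀ ≤ x := by
    have : x₀^2 ≤ x^2 := by
      have : L * x₀^2 ≤ L * x^2 := by linarith
      exact le_of_mul_le_mul_left this hL0
    exact (sq_le_sq₀ hx₀.1.le hx.1).1 this
  have hanti : AntitoneOn (fun y => -(u y * v y)) (Icc x₀ 1) := by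
    have hd : ∀ y ∈ Ioo x₀ 1, HasDerivAt (fun y => -(u y * v y))
        (-((v y ^ 2 + (L * y^2 - lam) * u y ^ 2) / (1 - y^2))) y := by
      intro y hy
      have hy1 : y ∈ Ico (0:ℝ) 1 := ⟨hx₀.1.le.trans hy.1.le, hy.2⟩
      have hw := one_sub_sq_pos hy1
      refine ((h.deriv_u y hy1).mul (h.deriv_v y hy1)).neg.congr_deriv ?_
      rw [← hL]
      field_simp
      ring
    refine antitoneOn_of_deriv_nonpos (convex_Icc _ _) (by fun_prop) ?_ ?_
    · intro y hy
      rw [interior_Icc] at hy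
      exact (hd y hy).differentiableAt.differentiableWithinAt
    · intro y hy
      rw [interior_Icc] at hy
      rw [(hd y hy).deriv, neg_nonpos]
      have hw := one_sub_sq_pos (x := y) ⟨hx₀.1.le.trans hy.1.le, hy.2⟩
      have : x₀^2 ≤ y^2 := by nlinarith [hy.1, hx₀.1]
      have : 0 ≤ L * y^2 - lam := by nlinarith
      positivity
  have h1 := hanti ⟨hxx₀, hx.2⟩ ⟨hx₀.2.le, le_rfl⟩ hx.2
  have h2 := hanti ⟨le_rfl, hx₀.2.le⟩ ⟨hxx₀, hx.2⟩ hxx₀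
  simp only [h.u_one, zero_mul, neg_zero] at h1 h2
  refine ⟨h1, ?_, ?_⟩
  · have := (h.bounds_le_turning hx₀.1.le hx₀L.le).2 hx₀L
    exact h2.trans ((neg_le_abs _).trans this)
  · have hE := h.energy_nonneg hx
    rw [← hL] at hE
    have : (L * x^2 - lam) * u x ^ 2 ≤ v x ^ 2 := by linarith
    calc _ = (L * x^2 - lam) * u x ^ 2 * u x ^ 2 := by ring
      _ ≤ v x ^ 2 * u x ^ 2 := mul_le_mul_of_nonneg_right this (sq_nonneg _)
      _ = _ := by ring

/-- The Airy type bound, uniform on `[0,1]`. -/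
lemma sqrt_abs_mul_sq_le (h : LegendrePair u v lam m) {x : ℝ} (hx : x ∈ Icc (0:ℝ) 1) :
    Real.sqrt |lam - (lam + m^2) * x^2| * u x ^ 2 ≤ 74 * Real.sqrt (lam + m^2) := by
  rcases le_total ((lam + m^2) * x^2) lam with hQ | hQ
  · rw [abs_of_nonneg (by linarith)]
    exact (h.bounds_le_turning hx.1 hQ).1
  · obtain ⟨h1, h2, h3⟩ := h.beyond_turning hx hQ
    have h4 := Real.sqrt_le_sqrt h3
    rw [Real.sqrt_sq h1, Real.sqrt_mul (by linarith), Real.sqrt_sq (sq_nonneg _)] at h4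
    rw [abs_of_nonpos (by linarith), neg_sub]
    linarith [Real.sqrt_nonneg (lam + m^2)]

/-- Decay well beyond the turning point. -/
lemma decay_of_four_mul_le (h : LegendrePair u v lam m) {x : ℝ} (hx : x ∈ Icc (0:ℝ) 1)
    (hQx : 4 * lam ≤ (lam + m^2) * x^2) :
    (lam + m^2) * x^3 * u x ^ 2 ≤ 100 * lam := by
  have hl := h.one_le_lam
  have hm := h.one_le_order
  have hL2 := h.lam_large
  have hu := h.cont_u
  have hv := h.cont_v
  set L := lam + m^2 with hL
  have hL0 : 0 < L := by positivity
  set x₁ := Real.sqrt (4 * lam / L) with hx₁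
  have hx₁0 : 0 < x₁ := Real.sqrt_pos.2 (by positivity)
  have hx₁L : L * x₁^2 = 4 * lam := by
    rw [hx₁, Real.sq_sqrt (by positivity)]; field_simp
  have hx₁x : x₁ ≤ x := by
    have : x₁^2 ≤ x^2 := by
      have : L * x₁^2 ≤ L * x^2 := by linarith
      exact le_of_mul_le_mul_left this hL0
    exact (sq_le_sq₀ hx₁0.le hx.1).1 this
  have hanti : AntitoneOn (fun y => -(u y * v y) * y^2) (Icc x₁ 1) := by
    have hd : ∀ y ∈ Ioo x₁ 1, HasDerivAt (fun y => -(u y * v y) * y^2)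
        (-(((v y ^ 2 + (L * y^2 - lam) * u y ^ 2) * y^2 + 2 * y * (1 - y^2) * (u y * v y)) /
          (1 - y^2))) y := by
      intro y hy
      have hy1 : y ∈ Ico (0:ℝ) 1 := ⟨hx₁0.le.trans hy.1.le, hy.2⟩
      have hw := one_sub_sq_pos hy1
      refine (((h.deriv_u y hy1).mul (h.deriv_v y hy1)).neg.mul (hasDerivAt_pow 2 y)).congr_deriv ?_
      simp only [Pi.neg_apply, Pi.mul_apply]
      rw [← hL]
      field_simp
      simp
      ring
    refine antitoneOn_of_deriv_nonpos (convex_Icc _ _) (by fun_prop) ?_ ?_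
    · intro y hy
      rw [interior_Icc] at hy
      exact (hd y hy).differentiableAt.differentiableWithinAt
    · intro y hy
      rw [interior_Icc] at hy
      rw [(hd y hy).deriv, neg_nonpos]
      have hy0 : 0 < y := hx₁0.trans hy.1
      have hw := one_sub_sq_pos (x := y) ⟨hy0.le, hy.2⟩
      have hy2 : x₁^2 ≤ y^2 := by nlinarith [hy.1]
      have hLy : 4 * lam ≤ L * y^2 := by rw [← hx₁L]; exact mul_le_mul_of_nonneg_left hy2 hL0.le
      have hK : 1 ≤ (L * y^2 - lam) * y^2 := by
        have h1 : 3/4 * (L * y^2) * y^2 ≤ (L * y^2 - lam) * y^2 :=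
          mul_le_mul_of_nonneg_right (by linarith) (sq_nonneg _)
        have h2 : L * 8 ≤ L * (L * y^2 * y^2) := by
          calc L * 8 ≤ 16 * lam^2 := by linarith
            _ ≤ (L * y^2)^2 := by nlinarith
            _ = _ := by ring
        have := le_of_mul_le_mul_left h2 hL0
        linarith
      refine div_nonneg ?_ hw.le
      have h1 : u y ^ 2 * 1 ≤ u y ^ 2 * ((L * y^2 - lam) * y^2) :=
        mul_le_mul_of_nonneg_left hK (sq_nonneg _)
      have h2 : 0 ≤ (y * v y + (1 - y^2) * u y)^2 := sq_nonneg _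
      have h3 : ((1 - y^2) * u y)^2 ≤ u y ^ 2 := by
        rw [mul_pow]
        exact mul_le_of_le_one_left (sq_nonneg _) (by nlinarith [sq_nonneg y])
      nlinarith
  have hQ : lam ≤ L * x^2 := by linarith
  obtain ⟨h1, -, h3⟩ := h.beyond_turning hx hQ
  obtain ⟨-, h4, -⟩ := h.beyond_turning ⟨hx₁0.le, hx₁x.trans hx.2⟩ (by rw [← hL]; linarith)
  have h5 := hanti ⟨le_rfl, hx₁x.trans hx.2⟩ ⟨hx₁x, hx.2⟩ hx₁x
  simp only at h5
  rw [← hL] at h3 h4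
  set Z := -(u x * v x)
  have hsq : Real.sqrt L ^ 2 = L := Real.sq_sqrt hL0.le
  have hs0 : 0 < Real.sqrt L := Real.sqrt_pos.2 hL0
  have h6 : Z * x^2 * Real.sqrt L ≤ 84 * lam := by
    calc Z * x^2 * Real.sqrt L ≤ -(u x₁ * v x₁) * x₁^2 * Real.sqrt L :=
          mul_le_mul_of_nonneg_right h5 hs0.le
      _ ≤ 21 * Real.sqrt L * x₁^2 * Real.sqrt L := by gcongr
      _ = 21 * (L * x₁^2) := by rw [← hsq, Real.sqrt_sq hs0.le]; ring
      _ = _ := by rw [hx₁L]; ring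
  have hx0 : 0 < x := hx₁0.trans_le hx₁x
  have h7 : 3/4 * (Real.sqrt L * x * u x ^ 2)^2 ≤ Z^2 := by
    refine le_trans ?_ h3
    have : 3/4 * (L * x^2) * (u x ^ 2)^2 ≤ (L * x^2 - lam) * (u x ^ 2)^2 :=
      mul_le_mul_of_nonneg_right (by linarith) (sq_nonneg _)
    rw [mul_pow, mul_pow, hsq]
    linarith
  have h8 : Real.sqrt L * x * u x ^ 2 ≤ 100/84 * Z := by
    refine abs_le_of_sq_le_sq' ?_ (by positivity) |>.2
    nlinarith
  calc L * x^3 * u x ^ 2 = (Real.sqrt L * x * u x ^ 2) * (x^2 * Real.sqrt L) := by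
        rw [← hsq, Real.sqrt_sq hs0.le]; ring
    _ ≤ 100/84 * Z * (x^2 * Real.sqrt L) := by gcongr
    _ = 100/84 * (Z * x^2 * Real.sqrt L) := by ring
    _ ≤ 100/84 * (84 * lam) := by gcongr
    _ = _ := by ring

/-- Decay near the endpoint. -/
lemma decay_near_one (h : LegendrePair u v lam m) {x : ℝ} (hx : x ∈ Ico (0:ℝ) 1)
    (hQx : 4 * ((lam + m^2) * (1 - x^2)) ≤ m^2) :
    m^2 * u x ^ 2 ≤ 50 * (lam + m^2) * Real.sqrt (1 - x^2) := by
  have hl := h.one_le_lam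
  have hm := h.one_le_order
  set L := lam + m^2 with hL
  have hL0 : 0 < L := by positivity
  have hwx := one_sub_sq_pos hx
  set w₁ := m^2 / (4 * L) with hw₁
  have hw₁0 : 0 < w₁ := by positivity
  have hw₁1 : w₁ < 1 := by rw [hw₁, div_lt_one (by positivity)]; nlinarith
  set x₁ := Real.sqrt (1 - w₁) with hx₁
  have hx₁0 : 0 < x₁ := Real.sqrt_pos.2 (by linarith)
  have hx₁L : 1 - x₁^2 = w₁ := by
    rw [hx₁, Real.sq_sqrt (by linarith)]; ring
  have hw₁L : 4 * L * w₁ = m^2 := by rw [hw₁]; field_simp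
  have hx₁x : x₁ ≤ x := by
    have : x₁^2 ≤ x^2 := by
      have : L * (1 - x^2) ≤ L * w₁ := by linarith
      have := le_of_mul_le_mul_left this hL0
      linarith
    exact (sq_le_sq₀ hx₁0.le hx.1).1 this
  have hK : ∀ y ∈ Icc x₁ x, 3/4 * m^2 ≤ L * y^2 - lam := by
    intro y hy
    have : x₁^2 ≤ y^2 := by nlinarith [hy.1]
    have : L * x₁^2 ≤ L * y^2 := mul_le_mul_of_nonneg_left this hL0.le
    have : L * x₁^2 = L - m^2 / 4 := by rw [← hw₁L, ← hx₁L]; ring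
    linarith
  have hanti : AntitoneOn (fun y => (u y * v y)^2 / (1 - y^2)) (Icc x₁ x) := by
    have hd : ∀ y ∈ Icc x₁ x, HasDerivAt (fun y => (u y * v y)^2 / (1 - y^2))
        (-(2 * -(u y * v y) * (v y ^ 2 + (L * y^2 - lam) * u y ^ 2 + y * (u y * v y)) /
          (1 - y^2)^2)) y := by
      intro y hy
      have hy1 : y ∈ Ico (0:ℝ) 1 := ⟨hx₁0.le.trans hy.1, hy.2.trans_lt hx.2⟩
      have hw := one_sub_sq_pos hy1
      have := (((h.deriv_u y hy1).mul (h.deriv_v y hy1)).pow 2).div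
        ((hasDerivAt_pow 2 y).const_sub 1) hw.ne'
      refine this.congr_deriv ?_
      simp only [Pi.pow_apply, Pi.mul_apply]
      rw [← hL]
      field_simp
      simp
      ring
    refine antitoneOn_of_deriv_nonpos (convex_Icc _ _)
      (fun y hy => (hd y hy).continuousAt.continuousWithinAt) ?_ ?_
    · intro y hy
      exact (hd y (interior_subset hy)).differentiableAt.differentiableWithinAt
    · intro y hy
      have hy := interior_subset hy
      rw [(hd y hy).deriv, neg_nonpos]
      have hy0 : 0 < y := hx₁0.trans_le hy.1
      have hy1 : y < 1 := hy.2.trans_lt hx.2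
      have hKy := hK y hy
      obtain ⟨hZ, -, -⟩ := h.beyond_turning ⟨hy0.le, hy1.le⟩ (by nlinarith)
      have h1 : 3/4 * u y ^ 2 ≤ (L * y^2 - lam) * u y ^ 2 :=
        mul_le_mul_of_nonneg_right (by nlinarith) (sq_nonneg _)
      have h2 : y * (u y * v y) ≥ 1 * (u y * v y) := by nlinarith
      have h3 : 0 ≤ v y ^ 2 + (L * y^2 - lam) * u y ^ 2 + y * (u y * v y) := by
        nlinarith [sq_nonneg (v y + 1/2 * u y)]
      positivity
  have h5 := hanti ⟨le_rfl, hx₁x⟩ ⟨hx₁x, le_rfl⟩ hx₁x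
  have hKx := hK x ⟨hx₁x, le_rfl⟩
  have hKx₁ := hK x₁ ⟨le_rfl, hx₁x⟩
  obtain ⟨h1, -, h3⟩ := h.beyond_turning ⟨hx.1, hx.2.le⟩ (by nlinarith)
  obtain ⟨h4', h4, -⟩ := h.beyond_turning ⟨hx₁0.le, hx₁x.trans hx.2.le⟩ (by nlinarith)
  rw [← hL] at h3 h4
  simp only [hx₁L] at h5
  rw [div_le_div_iff₀ hwx hw₁0] at h5
  have hsq : Real.sqrt L ^ 2 = L := Real.sq_sqrt hL0.le
  have h6 : (u x₁ * v x₁)^2 ≤ 441 * L := by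
    rw [← neg_sq]
    calc _ ≤ (21 * Real.sqrt L)^2 := pow_le_pow_left₀ h4' h4 2
      _ = _ := by rw [mul_pow, hsq]; norm_num
  have h7 : m^2 * (u x * v x)^2 ≤ 1764 * L^2 * (1 - x^2) := by
    rw [← hw₁L]
    calc _ = 4 * L * ((u x * v x)^2 * w₁) := by ring
      _ ≤ 4 * L * ((u x₁ * v x₁)^2 * (1 - x^2)) := by gcongr
      _ ≤ 4 * L * (441 * L * (1 - x^2)) := by gcongr
      _ = _ := by ring
  have h8 : 3/4 * m^2 * (u x ^ 2)^2 ≤ (u x * v x)^2 := by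
    rw [neg_sq] at h3
    exact (mul_le_mul_of_nonneg_right hKx (sq_nonneg _)).trans h3
  refine abs_le_of_sq_le_sq' ?_ (by positivity) |>.2
  have hw2 : Real.sqrt (1 - x^2) ^ 2 = 1 - x^2 := Real.sq_sqrt hwx.le
  calc (m^2 * u x ^ 2)^2 = 4/3 * m^2 * (3/4 * m^2 * (u x ^ 2)^2) := by ring
    _ ≤ 4/3 * m^2 * (u x * v x)^2 := by gcongr
    _ = 4/3 * (m^2 * (u x * v x)^2) := by ring
    _ ≤ 4/3 * (1764 * L^2 * (1 - x^2)) := by gcongr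
    _ ≤ 2500 * L^2 * (1 - x^2) := by nlinarith [mul_pos (pow_pos hL0 2) hwx]
    _ = _ := by rw [mul_pow, mul_pow, hw2]; ring

end LegendrePair

lemma iterate_derivative_comp_neg_X (p : ℝ[X]) (k : ℕ) :
    derivative^[k] (p.comp (-X)) = C ((-1)^k) * (derivative^[k] p).comp (-X) := by
  induction k with
  | zero => simp
  | succ k ih =>
    rw [Function.iterate_succ_apply', Function.iterate_succ_apply', ih, derivative_C_mul,
      derivative_comp, derivative_neg, derivative_X, pow_succ, C_mul]
    simp

lemma tY_neg_sq {n m : ℕ} (hm : m ≤ n) (x : ℝ) : tY n m (-x) ^ 2 = tY n m x ^ 2 := by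
  have h : ∀ (k : ℕ) (p : ℝ[X]), p.comp (-X) = p →
      (derivative^[k] p).eval (-x) ^ 2 = (derivative^[k] p).eval x ^ 2 := by
    intro k p hp
    have h1 := congrArg (eval x) (iterate_derivative_comp_neg_X p k)
    rw [hp, eval_mul, eval_C, eval_comp, eval_neg, eval_X] at h1
    rw [h1, mul_pow, ← pow_mul, mul_comm k 2, pow_mul]
    norm_num
  have h2 := h (m + n) ((X^2 - 1)^n) (by simp)
  rw [tY_natCast n m hm, tY_natCast n m hm, neg_sq, mul_pow, mul_pow]
  congr 1
  rw [harmPoly, legendrePoly, iterate_derivative_C_mul, eval_mul, eval_mul, eval_mul, eval_mul,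
    ← Function.iterate_add_apply, mul_pow, mul_pow, mul_pow, mul_pow, h2]
  simp only [eval_C]

lemma harmPoly_ode (n m : ℕ) :
    (1 - X^2) * derivative (derivative (harmPoly n m)) =
      C (2 * ((m:ℝ) + 1)) * (X * derivative (harmPoly n m)) -
        C (((n:ℝ) - m) * (n + m + 1)) * harmPoly n m := by
  have h := legendrePoly_ode n m
  rw [harmPoly, derivative_C_mul, derivative_C_mul, ← Function.iterate_succ_apply' derivative,
    ← Function.iterate_succ_apply' derivative]
  rw [Function.iterate_succ_apply' derivative (m+1), ← Function.iterate_succ_apply' derivative] at *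
  linear_combination (C (Real.sqrt ((2*(n:ℝ)+1) / (4*Real.pi) * factRatio n m) * (-1)^m)) * h

/-- `(1-x²)` times the derivative of `tY n m`. -/
def tYFlux (n m : ℕ) (x : ℝ) : ℝ :=
  Real.sqrt (1 - x^2) ^ m *
    ((1 - x^2) * (derivative (harmPoly n m)).eval x - m * x * (harmPoly n m).eval x)

lemma hasDerivAt_sqrt_one_sub_sq_pow (m : ℕ) {x : ℝ} (hx : 0 < 1 - x^2) :
    HasDerivAt (fun y : ℝ => Real.sqrt (1 - y^2) ^ m)
      (-(m * x * Real.sqrt (1 - x^2) ^ m / (1 - x^2))) x := by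
  have hs : Real.sqrt (1 - x^2) ≠ 0 := (Real.sqrt_pos.2 hx).ne'
  have h1 := ((((hasDerivAt_pow 2 x)).const_sub 1).sqrt hx.ne').pow m
  refine h1.congr_deriv ?_
  rcases m with _ | k
  · simp
  have h2 : 1 - x^2 = Real.sqrt (1 - x^2) ^ 2 := (Real.sq_sqrt hx.le).symm
  conv_rhs => rw [h2, Real.sqrt_sq (Real.sqrt_nonneg _)]
  field_simp
  simp
  ring

lemma hasDerivAt_tY {n m : ℕ} (hm : m ≤ n) {x : ℝ} (hx : 0 < 1 - x^2) :
    HasDerivAt (fun y => tY n m y) (tYFlux n m x / (1 - x^2)) x := by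
  have h := (hasDerivAt_sqrt_one_sub_sq_pow m hx).mul ((harmPoly n m).hasDerivAt x)
  simp only [tY_natCast n m hm]
  refine h.congr_deriv ?_
  rw [tYFlux]
  field_simp
  ring

lemma hasDerivAt_tYFlux {n m : ℕ} (hm : m ≤ n) {x : ℝ} (hx : 0 < 1 - x^2) :
    HasDerivAt (tYFlux n m)
      (-(((n:ℝ) * (n + 1) - (m:ℝ)^2) - (n:ℝ) * (n + 1) * x^2) * tY n m x / (1 - x^2)) x := by
  have h1 : HasDerivAt (fun y : ℝ => (1 - y^2) * (derivative (harmPoly n m)).eval y -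
      m * y * (harmPoly n m).eval y)
      (-(2 * x) * (derivative (harmPoly n m)).eval x +
        (1 - x^2) * (derivative (derivative (harmPoly n m))).eval x -
        (m * (harmPoly n m).eval x + m * x * (derivative (harmPoly n m)).eval x)) x := by
    refine ((((hasDerivAt_pow 2 x).const_sub 1).mul ((derivative (harmPoly n m)).hasDerivAt x)).sub
      (((hasDerivAt_id x).const_mul (m:ℝ)).mul ((harmPoly n m).hasDerivAt x))).congr_deriv ?_
    simp
  have h2 := congrArg (eval x) (harmPoly_ode n m)
  simp only [eval_mul, eval_sub, eval_one, eval_pow, eval_X, eval_C] at h2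
  refine ((hasDerivAt_sqrt_one_sub_sq_pow m hx).mul h1).congr_deriv ?_
  rw [tY_natCast n m hm]
  field_simp
  rw [h2]
  ring

lemma polyInt_X_sq_harmPoly_le (n j : ℕ) (h : j + 1 ≤ n) :
    ((j:ℝ)+1)^2 * polyInt (X^2 * (1 - X^2)^j * harmPoly n (j+1) ^ 2) ≤
      1 / (2 * Real.pi) * ((n:ℝ) * (n + 1) - ((j:ℝ)+1)^2) := by
  have := polyInt_X_sq_harmComb_le (s := {n}) (j := j) (by simpa using h) (fun _ => 1)
  simpa [harmComb] using this

lemma polyInt_X_sq_harmPoly_le' (n j : ℕ) (h : j + 1 ≤ n) :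
    polyInt (X^2 * (1 - X^2)^(j+1) * harmPoly n (j+1) ^ 2) ≤
      1 / (2 * Real.pi) * (2 * ((n:ℝ) * (n + 1) - ((j:ℝ)+1)^2) / ((n:ℝ) * (n + 1))) := by
  have h1 := polyInt_X_sq_harmPoly_le n j h
  have h2 : polyInt (X^2 * (1 - X^2)^(j+1) * harmPoly n (j+1) ^ 2) ≤
      polyInt (X^2 * (1 - X^2)^j * harmPoly n (j+1) ^ 2) := by
    refine polyInt_mono fun x hx => ?_
    have hx2 : 0 ≤ 1 - x^2 := by nlinarith [hx.1, hx.2]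
    simp only [eval_mul, eval_pow, eval_sub, eval_one, eval_X]
    have h3 : (1 - x^2)^(j+1) ≤ (1 - x^2)^j :=
      pow_le_pow_of_le_one hx2 (by linarith [sq_nonneg x]) j.le_succ
    gcongr
  have h3 : polyInt (X^2 * (1 - X^2)^(j+1) * harmPoly n (j+1) ^ 2) ≤ 1 / (2 * Real.pi) := by
    rw [← polyInt_harmPoly_sq n (j+1) h]
    refine polyInt_mono fun x hx => ?_
    have hx2 : 0 ≤ 1 - x^2 := by nlinarith [hx.1, hx.2]
    simp only [eval_mul, eval_pow, eval_sub, eval_one, eval_X]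
    have : 0 ≤ (1 - x^2)^(j+1) * (harmPoly n (j+1)).eval x ^ 2 := by positivity
    nlinarith
  have hn : (j:ℝ) + 1 ≤ n := by exact_mod_cast h
  set I := polyInt (X^2 * (1 - X^2)^(j+1) * harmPoly n (j+1) ^ 2)
  set lam := (n:ℝ) * (n + 1) - ((j:ℝ)+1)^2 with hlam
  have hM : 0 < ((j:ℝ)+1)^2 := by positivity
  have hL : (n:ℝ) * (n + 1) = lam + ((j:ℝ)+1)^2 := by rw [hlam]; ring
  have hl : 0 ≤ lam := by rw [hlam]; nlinarith
  have hν : 0 < 1 / (2 * Real.pi) := by positivity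
  set ν := 1 / (2 * Real.pi)
  have h4 : ((j:ℝ)+1)^2 * I ≤ ν * lam := (mul_le_mul_of_nonneg_left h2 hM.le).trans h1
  rw [hL, ← mul_div_assoc, le_div_iff₀ (by positivity)]
  nlinarith

lemma derivative_energyPoly (n j : ℕ) :
    derivative ((1 - X^2)^(j+1) * ((C ((n:ℝ) * (n + 1) - ((j:ℝ)+1)^2) - C ((n:ℝ) * (n + 1)) * X^2) *
        harmPoly n (j+1) ^ 2 +
        ((1 - X^2) * derivative (harmPoly n (j+1)) - C ((j:ℝ)+1) * X * harmPoly n (j+1))^2)) =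
      -(C (2 * ((n:ℝ) * (n + 1))) * X * ((1 - X^2)^(j+1) * harmPoly n (j+1) ^ 2)) := by
  have h := harmPoly_ode n (j+1)
  set p := harmPoly n (j+1)
  rw [derivative_mul, derivative_pow_succ]
  simp only [derivative_add, derivative_sub, derivative_mul, derivative_one,
    derivative_sq, derivative_C, derivative_X]
  push_cast at h
  simp only [map_add, map_sub, map_mul, map_pow, map_natCast, map_one, map_ofNat] at h ⊢
  linear_combination (2 * (1 - X^2)^(j+1) *
    ((1 - X^2) * derivative p - ((j:ℝ[X])+1) * X * p)) * h

lemma legendrePair_tY {n m : ℕ} (hm1 : 1 ≤ m) (hm : m ≤ n) :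
    LegendrePair (fun x => tY n m x) (tYFlux n m) ((n:ℝ) * (n + 1) - (m:ℝ)^2) m := by
  have hm1' : (1:ℝ) ≤ m := by exact_mod_cast hm1
  have hm' : (m:ℝ) ≤ n := by exact_mod_cast hm
  have hL : (n:ℝ) * (n + 1) - (m:ℝ)^2 + (m:ℝ)^2 = (n:ℝ) * (n + 1) := by ring
  have hln : (n:ℝ) ≤ (n:ℝ) * (n + 1) - (m:ℝ)^2 := by nlinarith
  have hpos : ∀ x ∈ Ico (0:ℝ) 1, 0 < 1 - x^2 := fun x hx => LegendrePair.one_sub_sq_pos hx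
  refine ⟨hm1', by linarith, ?_, ?_, fun x hx => hasDerivAt_tY hm (hpos x hx), fun x hx => ?_,
    by rw [hL]; nlinarith, ?_, ?_, ?_⟩
  · simp only [tY_natCast n m hm]
    exact Continuous.mul (by fun_prop) (harmPoly n m).continuous
  · unfold tYFlux
    have := (harmPoly n m).continuous
    have := (derivative (harmPoly n m)).continuous
    fun_prop
  · rw [hL]; exact hasDerivAt_tYFlux hm (hpos x hx)
  · rw [tY_natCast n m hm]
    have : m ≠ 0 := by omega
    simp [this]
  · have : m ≠ 0 := by omega
    simp [tYFlux, this]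
  · obtain ⟨j, rfl⟩ : ∃ j, m = j + 1 := ⟨m - 1, by omega⟩
    rw [hL, tY_natCast n (j+1) hm, tYFlux]
    have hJ : (((j+1 : ℕ)) : ℝ) = (j:ℝ) + 1 := by push_cast; ring
    rw [hJ] at hm1' hm' hL hln ⊢
    have hd := derivative_energyPoly n j
    have hI1 := polyInt_X_sq_harmPoly_le' n j hm
    have hI0 := polyInt_harmPoly_sq n (j+1) hm
    set p := harmPoly n (j+1)
    set L := (n:ℝ) * (n + 1) with hLdef
    set lam := L - ((j:ℝ)+1)^2 with hlam
    set G : ℝ[X] := (1 - X^2)^(j+1) * ((C lam - C L * X^2) * p ^ 2 +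
        ((1 - X^2) * derivative p - C ((j:ℝ)+1) * X * p)^2) with hG
    have hlpos : 0 < lam := by linarith
    have hLpos : 0 < L := by nlinarith
    set r := Real.sqrt lam with hr
    set R := Real.sqrt L with hR
    have hr0 : 0 < r := Real.sqrt_pos.2 hlpos
    have hR0 : 0 < R := Real.sqrt_pos.2 hLpos
    have hr2 : r^2 = lam := Real.sq_sqrt hlpos.le
    have hR2 : R^2 = L := Real.sq_sqrt hLpos.le
    have hG0 : lam * (√(1 - 0 ^ 2) ^ (j + 1) * eval 0 p) ^ 2 + (√(1 - 0 ^ 2) ^ (j + 1) *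
        ((1 - 0 ^ 2) * eval 0 (derivative p) - ((j:ℝ) + 1) * 0 * eval 0 p)) ^ 2 = eval 0 G := by
      rw [hG]; simp
    have hG1 : eval 1 G = 0 := by rw [hG]; simp
    have hftc : ∫ x in (0:ℝ)..1, eval x (derivative G) = eval 1 G - eval 0 G :=
      intervalIntegral.integral_eq_sub_of_hasDerivAt (fun x _ => G.hasDerivAt x)
        ((derivative G).continuous.intervalIntegrable _ _)
    set q : ℝ[X] := C (R * r) * ((1 - X^2)^(j+1) * p^2) +
      C (L * R / r) * (X^2 * (1 - X^2)^(j+1) * p^2) with hq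
    have hle : -∫ x in (0:ℝ)..1, eval x (derivative G) ≤ ∫ x in (0:ℝ)..1, eval x q := by
      rw [← intervalIntegral.integral_neg]
      refine intervalIntegral.integral_mono_on zero_le_one
        ((derivative G).continuous.neg.intervalIntegrable _ _)
        (q.continuous.intervalIntegrable _ _) fun x hx => ?_
      have hw : 0 ≤ 1 - x^2 := by nlinarith [hx.1, hx.2]
      rw [hd, hq]
      simp only [eval_mul, eval_pow, eval_sub, eval_one, eval_X, eval_C, eval_add, eval_neg,
        neg_neg]
      have h1 : 2 * L * x ≤ R * r + L * R / r * x^2 := by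
        have : R * r + L * R / r * x^2 - 2 * L * x = R * (r - R * x)^2 / r := by
          rw [← hR2]; field_simp; ring
        have h2 : 0 ≤ R * (r - R * x)^2 / r := by positivity
        linarith
      calc _ = (2 * L * x) * ((1 - x^2)^(j+1) * eval x p ^ 2) := by ring
        _ ≤ (R * r + L * R / r * x^2) * ((1 - x^2)^(j+1) * eval x p ^ 2) :=
            mul_le_mul_of_nonneg_right h1 (by positivity)
        _ = _ := by ring
    have hle2 : ∫ x in (0:ℝ)..1, eval x q ≤ polyInt q := by
      refine integral_zero_one_le_polyInt (fun x hx => ?_) ⟨le_rfl, zero_le_one⟩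
      have hw : 0 ≤ 1 - x^2 := by nlinarith [hx.1, hx.2]
      rw [hq]
      simp only [eval_mul, eval_pow, eval_sub, eval_one, eval_X, eval_C, eval_add]
      positivity
    rw [hG0]
    have hqI : polyInt q ≤ R * r := by
      rw [hq, map_add, polyInt_C_mul, polyInt_C_mul, hI0]
      have hν : 3 * (1 / (2 * Real.pi)) ≤ 1 := by
        rw [mul_one_div, div_le_one (by positivity)]
        linarith [Real.pi_gt_three]
      have hRr : 0 < R * r := by positivity
      calc _ ≤ R * r * (1 / (2 * Real.pi)) +
            L * R / r * (1 / (2 * Real.pi) * (2 * lam / L)) := by gcongr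
        _ = R * r * (3 * (1 / (2 * Real.pi))) := by
            rw [← hr2]; field_simp; ring
        _ ≤ R * r * 1 := by gcongr
        _ = _ := mul_one _
    linarith

/-- A sup bound adapted to small eigenvalues. -/
lemma tY_sq_le_sqrt {n m : ℕ} (hm1 : 1 ≤ m) (hm : m ≤ n)
    (hlm : (n:ℝ) * (n + 1) - (m:ℝ)^2 ≤ (m:ℝ)^2) {x : ℝ} (hx : x ∈ Icc (0:ℝ) 1) :
    tY n m x ^ 2 ≤ Real.sqrt ((n:ℝ) * (n + 1) - (m:ℝ)^2) := by
  obtain ⟨j, rfl⟩ : ∃ j, m = j + 1 := ⟨m - 1, by omega⟩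
  have hm' : (j:ℝ) + 1 ≤ n := by exact_mod_cast hm
  have hJ : (((j+1 : ℕ)) : ℝ) = (j:ℝ) + 1 := by push_cast; ring
  rw [hJ] at hlm ⊢
  have hI0 := polyInt_harmPoly_sq n (j+1) hm
  have hI1 := polyInt_X_sq_harmPoly_le n j hm
  have hid := polyInt_sq_identity j (harmPoly n (j+1))
  have hID : polyInt ((1 - X^2)^(j+2) * derivative (harmPoly n (j+1)) ^ 2) =
      1 / (2 * Real.pi) * (((n:ℝ) - (j + 1)) * (n + (j + 1) + 1)) := by
    have := polyInt_derivative_harmComb_sq (s := {n}) (m := j+1) (by simpa using hm) (fun _ => 1)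
    simpa [harmComb] using this
  rw [tY_natCast n (j+1) hm]
  set p := harmPoly n (j+1)
  set lam := (n:ℝ) * (n + 1) - ((j:ℝ)+1)^2 with hlam
  have hlpos : 0 < lam := by nlinarith
  set r := Real.sqrt lam with hr
  have hr0 : 0 < r := Real.sqrt_pos.2 hlpos
  have hr2 : r^2 = lam := Real.sq_sqrt hlpos.le
  have hw : 0 ≤ 1 - x^2 := by nlinarith [hx.1, hx.2]
  set T : ℝ[X] := (1 - X^2) * derivative p - C ((j:ℝ)+1) * (X * p) with hT
  set H : ℝ[X] := (1 - X^2)^(j+1) * p^2 with hH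
  have hHd : derivative H = C 2 * ((1 - X^2)^j * p * T) := by
    rw [hH, hT, derivative_mul, derivative_pow_succ, derivative_sq]
    simp only [derivative_sub, derivative_X_sq, derivative_one, map_add, map_natCast, map_one,
      map_ofNat]
    ring
  have hH1 : eval 1 H = 0 := by rw [hH]; simp
  have hftc : ∫ y in x..1, eval y (derivative H) = eval 1 H - eval x H :=
    intervalIntegral.integral_eq_sub_of_hasDerivAt (fun y _ => H.hasDerivAt y)
      ((derivative H).continuous.intervalIntegrable _ _)
  set q : ℝ[X] := C r * ((1 - X^2)^j * p^2) + C r⁻¹ * ((1 - X^2)^j * T^2) with hq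
  have hle : -∫ y in x..1, eval y (derivative H) ≤ ∫ y in x..1, eval y q := by
    rw [← intervalIntegral.integral_neg]
    refine intervalIntegral.integral_mono_on hx.2
      ((derivative H).continuous.neg.intervalIntegrable _ _)
      (q.continuous.intervalIntegrable _ _) fun y hy => ?_
    have hwy : 0 ≤ 1 - y^2 := by nlinarith [hy.1, hy.2, hx.1]
    rw [hHd, hq]
    simp only [eval_mul, eval_pow, eval_sub, eval_one, eval_X, eval_C, eval_add]
    have e : r * ((1 - y^2)^j * eval y p ^ 2) + r⁻¹ * ((1 - y^2)^j * eval y T ^ 2) -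
        -(2 * ((1 - y^2)^j * eval y p * eval y T)) =
        (1 - y^2)^j * (r * eval y p + eval y T)^2 / r := by field_simp; ring
    have : 0 ≤ (1 - y^2)^j * (r * eval y p + eval y T)^2 / r := by positivity
    linarith
  have hle2 : ∫ y in x..1, eval y q ≤ polyInt q := by
    refine integral_zero_one_le_polyInt (fun y hy => ?_) hx
    have hwy : 0 ≤ 1 - y^2 := by nlinarith [hy.1, hy.2]
    rw [hq]
    simp only [eval_mul, eval_pow, eval_sub, eval_one, eval_X, eval_C, eval_add]
    positivity
  have hHx : eval x H = (√(1 - x ^ 2) ^ (j + 1) * eval x p) ^ 2 := by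
    rw [hH, mul_pow, ← pow_mul, mul_comm (j+1) 2, pow_mul, Real.sq_sqrt hw]; simp
  have hpj : polyInt ((1 - X^2)^j * p^2) =
      polyInt ((1 - X^2)^(j+1) * p^2) + polyInt (X^2 * (1 - X^2)^j * p^2) := by
    rw [← map_add]; congr 1; ring
  have hX0 : 0 ≤ polyInt (X^2 * (1 - X^2)^j * p^2) := by
    refine polyInt_nonneg fun y hy => ?_
    have hwy : 0 ≤ 1 - y^2 := by nlinarith [hy.1, hy.2]
    simp only [eval_mul, eval_pow, eval_sub, eval_one, eval_X]
    positivity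
  have hν : 3 * (1 / (2 * Real.pi)) ≤ 1 := by
    rw [mul_one_div, div_le_one (by positivity)]
    linarith [Real.pi_gt_three]
  have hν0 : 0 < 1 / (2 * Real.pi) := by positivity
  rw [hI0, hID] at hid
  rw [hI0] at hpj
  set ν := 1 / (2 * Real.pi)
  set I := polyInt (X^2 * (1 - X^2)^j * p^2)
  have hM : 0 < ((j:ℝ)+1)^2 := by positivity
  have hIν : I ≤ ν := by nlinarith
  have hTI : polyInt ((1 - X^2)^j * T^2) ≤ ν * lam := by
    have e : ν * (((n:ℝ) - (j + 1)) * (n + (j + 1) + 1)) + ((j:ℝ)+1) * ν = ν * lam := by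
      rw [hlam]; ring
    have := mul_nonneg hM.le hX0
    linarith
  have hqI : polyInt q ≤ r := by
    rw [hq, map_add, polyInt_C_mul, polyInt_C_mul, hpj]
    calc _ ≤ r * (ν + ν) + r⁻¹ * (ν * lam) := by gcongr
      _ = r * (3 * ν) := by rw [← hr2]; field_simp; ring
      _ ≤ r * 1 := by gcongr
      _ = r := mul_one r
  rw [← hHx]
  linarith

lemma tY_abs_sq {n m : ℕ} (hm : m ≤ n) (x : ℝ) : tY n m |x| ^ 2 = tY n m x ^ 2 := by
  rcases abs_choice x with h | h <;> rw [h]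
  exact tY_neg_sq hm x

lemma sqrt_abs_mul_tY_sq_le {n m : ℕ} {x : ℝ} (hm1 : 1 ≤ m) (hm : m ≤ n) (hx : |x| ≤ 1) :
    Real.sqrt |((n:ℝ) * (n + 1) - (m:ℝ)^2) * (1 - x^2) - (m:ℝ)^2 * x^2| * tY n m x ^ 2 ≤
      74 * Real.sqrt ((n:ℝ) * (n + 1)) := by
  have := (legendrePair_tY hm1 hm).sqrt_abs_mul_sq_le ⟨abs_nonneg x, hx⟩
  simp only [tY_abs_sq hm, sq_abs] at this
  ring_nf at this ⊢
  exact this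

lemma tY_sq_decay {n m : ℕ} {x : ℝ} (hm1 : 1 ≤ m) (hm : m ≤ n) (hx : |x| ≤ 1)
    (h : 4 * ((n:ℝ) * (n + 1) - (m:ℝ)^2) ≤ (n:ℝ) * (n + 1) * x^2) :
    (n:ℝ) * (n + 1) * |x|^3 * tY n m x ^ 2 ≤ 100 * ((n:ℝ) * (n + 1) - (m:ℝ)^2) := by
  have h0 := (legendrePair_tY hm1 hm).decay_of_four_mul_le ⟨abs_nonneg x, hx⟩
  rw [sub_add_cancel, sq_abs, tY_abs_sq hm] at h0
  exact h0 h

lemma tY_sq_decay_near_one {n m : ℕ} {x : ℝ} (hm1 : 1 ≤ m) (hm : m ≤ n) (hx : |x| ≤ 1)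
    (h : 4 * ((n:ℝ) * (n + 1) * (1 - x^2)) ≤ (m:ℝ)^2) :
    (m:ℝ)^2 * tY n m x ^ 2 ≤ 50 * ((n:ℝ) * (n + 1)) * Real.sqrt (1 - x^2) := by
  rcases hx.lt_or_eq with hlt | heq
  · have h0 := (legendrePair_tY hm1 hm).decay_near_one ⟨abs_nonneg x, hlt⟩
    rw [sub_add_cancel, sq_abs, tY_abs_sq hm] at h0
    exact h0 h
  · have h1 := (legendrePair_tY hm1 hm).u_one
    rw [← tY_abs_sq hm, heq, h1]
    simp only [ne_eq, OfNat.ofNat_ne_zero, not_false_eq_true, zero_pow, mul_zero]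
    positivity

lemma tY_sq_le_sqrt_eigen {n m : ℕ} {x : ℝ} (hm1 : 1 ≤ m) (hm : m ≤ n) (hx : |x| ≤ 1)
    (h : (n:ℝ) * (n + 1) - (m:ℝ)^2 ≤ (m:ℝ)^2) :
    tY n m x ^ 2 ≤ Real.sqrt ((n:ℝ) * (n + 1) - (m:ℝ)^2) := by
  rw [← tY_abs_sq hm]
  exact tY_sq_le_sqrt hm1 hm h ⟨abs_nonneg x, hx⟩

lemma tY_sq_le_degree {n m : ℕ} {x : ℝ} (hm1 : 1 ≤ m) (hm : m ≤ n) (hx : |x| ≤ 1) :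
    tY n m x ^ 2 ≤ n := by
  have hn : (1:ℝ) ≤ n := by exact_mod_cast hm1.trans hm
  refine (tY_sq_le hm (abs_le.1 hx)).trans ?_
  rw [div_le_iff₀ (by positivity)]
  nlinarith [Real.pi_gt_three]

lemma sum_le_sum_Icc {T : Finset ℕ} {K : ℕ} {f : ℕ → ℝ} (hf : ∀ n, 0 ≤ f n)
    (hT : ∀ n ∈ T, 1 ≤ n ∧ n ≤ K) : ∑ n ∈ T, f n ≤ ∑ n ∈ Finset.range K, f (n + 1) := by
  rw [Finset.sum_bij_ne_zero (s := Finset.range K) (t := Finset.Icc 1 K)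
    (f := fun n => f (n+1)) (g := f) (fun n _ _ => n + 1)]
  · exact Finset.sum_le_sum_of_subset_of_nonneg
      (fun n hn => Finset.mem_Icc.2 (hT n hn)) fun n _ _ => hf n
  · intro n hn _; simp at hn ⊢; omega
  · intro a _ _ b _ _ h; omega
  · intro b hb _
    simp at hb
    exact ⟨b - 1, by simp; omega, by rwa [Nat.sub_add_cancel hb.1], by omega⟩
  · intro n _ _; rfl

lemma inv_sqrt_le_sqrt_sub {t : ℝ} (ht : 1 ≤ t) :
    1 / Real.sqrt t ≤ 2 * (Real.sqrt t - Real.sqrt (t - 1)) := by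
  have h0 : 0 < Real.sqrt t := Real.sqrt_pos.2 (by linarith)
  have h1 := Real.sqrt_nonneg (t - 1)
  have e1 : Real.sqrt t ^ 2 = t := Real.sq_sqrt (by linarith)
  have e2 : Real.sqrt (t - 1) ^ 2 = t - 1 := Real.sq_sqrt (by linarith)
  rw [div_le_iff₀ h0]
  nlinarith [sq_nonneg (Real.sqrt t - Real.sqrt (t - 1))]

lemma sum_inv_sqrt_abs_le {T : Finset ℕ} {c R : ℝ} (hc : 0 ≤ c) (hcR : c ≤ R)
    (hT : ∀ n ∈ T, 1 ≤ n ∧ 1 ≤ |(n:ℝ) - c| ∧ |(n:ℝ) - c| ≤ R) :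
    ∑ n ∈ T, 1 / Real.sqrt |(n:ℝ) - c| ≤ 4 * Real.sqrt R := by
  set f : ℕ → ℝ := fun n => 2 * (Real.sqrt ((n:ℝ) - c) - Real.sqrt ((n:ℝ) - c - 1)) +
    2 * (Real.sqrt (c - n) - Real.sqrt (c - n - 1)) with hf
  have hf0 : ∀ n, 0 ≤ f n := fun n => by
    have h1 : Real.sqrt ((n:ℝ) - c - 1) ≤ Real.sqrt ((n:ℝ) - c) :=
      Real.sqrt_le_sqrt (by linarith)
    have h2 : Real.sqrt (c - n - 1) ≤ Real.sqrt (c - n) := Real.sqrt_le_sqrt (by linarith)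
    simp only [hf]; linarith
  set K := ⌊c + R⌋₊ with hK
  have hTK : ∀ n ∈ T, 1 ≤ n ∧ n ≤ K := fun n hn => by
    obtain ⟨h1, -, h3⟩ := hT n hn
    exact ⟨h1, Nat.le_floor (by linarith [(abs_le.1 h3).2])⟩
  have hle : ∀ n ∈ T, 1 / Real.sqrt |(n:ℝ) - c| ≤ f n := fun n hn => by
    obtain ⟨-, h2, -⟩ := hT n hn
    rcases le_total c n with h | h
    · rw [abs_of_nonneg (by linarith)] at h2 ⊢
      have h4 : Real.sqrt (c - n - 1) = 0 := Real.sqrt_eq_zero_of_nonpos (by linarith)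
      have := inv_sqrt_le_sqrt_sub h2
      simp only [hf, h4]
      linarith [Real.sqrt_nonneg (c - n)]
    · rw [abs_of_nonpos (by linarith), neg_sub] at h2 ⊢
      have h4 : Real.sqrt ((n:ℝ) - c - 1) = 0 := Real.sqrt_eq_zero_of_nonpos (by linarith)
      have := inv_sqrt_le_sqrt_sub h2
      simp only [hf, h4]
      linarith [Real.sqrt_nonneg ((n:ℝ) - c)]
  refine (Finset.sum_le_sum hle).trans ((sum_le_sum_Icc hf0 hTK).trans ?_)
  have t1 := Finset.sum_range_sub (fun n : ℕ => 2 * Real.sqrt ((n:ℝ) - c) -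
    2 * Real.sqrt (c - n - 1)) K
  have e : ∀ n : ℕ, f (n+1) = (2 * Real.sqrt (((n+1 : ℕ) : ℝ) - c) -
      2 * Real.sqrt (c - ((n+1 : ℕ) : ℝ) - 1)) -
      (2 * Real.sqrt ((n:ℝ) - c) - 2 * Real.sqrt (c - n - 1)) := fun n => by
    simp only [hf]
    have a1 : ((n+1 : ℕ) : ℝ) - c - 1 = n - c := by push_cast; ring
    have a2 : c - (n:ℝ) - 1 = c - ((n+1 : ℕ) : ℝ) := by push_cast; ring
    rw [a1, a2]; ring
  rw [Finset.sum_congr rfl fun n _ => e n, t1]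
  have hKR : (K:ℝ) ≤ c + R := Nat.floor_le (by linarith)
  have b1 : Real.sqrt ((K:ℝ) - c) ≤ Real.sqrt R := Real.sqrt_le_sqrt (by linarith)
  have b2 : Real.sqrt (c - ((0:ℕ):ℝ) - 1) ≤ Real.sqrt R :=
    Real.sqrt_le_sqrt (by push_cast; linarith)
  have b3 : Real.sqrt (((0:ℕ):ℝ) - c) = 0 := Real.sqrt_eq_zero_of_nonpos (by push_cast; linarith)
  have b4 := Real.sqrt_nonneg (c - (K:ℝ) - 1)
  rw [b3]
  linarith

lemma card_abs_sub_lt_le {T : Finset ℕ} {c : ℝ} {K : ℕ} (hT : ∀ n ∈ T, |(n:ℝ) - c| < K) :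
    (T.card : ℝ) ≤ 2 * K := by
  rcases T.eq_empty_or_nonempty with rfl | hne
  · simp
  set a := T.min' hne
  have hsub : T ⊆ Finset.Ico a (a + 2 * K) := by
    intro n hn
    have h1 := abs_lt.1 (hT n hn)
    have h2 := abs_lt.1 (hT a (T.min'_mem hne))
    have h3 : (n:ℝ) < a + 2 * K := by linarith [h1.2, h2.1]
    exact Finset.mem_Ico.2 ⟨T.min'_le n hn, by exact_mod_cast h3⟩
  have := Finset.card_le_card hsub
  rw [Nat.card_Ico] at this
  exact_mod_cast (by omega : T.card ≤ 2 * K)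

lemma sum_inv_sq_le {T : Finset ℕ} {t : ℝ} (ht : 0 < t) (hT : ∀ n ∈ T, 1 ≤ n ∧ t ≤ n) :
    ∑ n ∈ T, 1 / (n:ℝ)^2 ≤ 2 / t := by
  set f : ℕ → ℝ := fun n => 2 * (1 / (max t n) - 1 / (max t ((n:ℝ)+1))) with hf
  have hf0 : ∀ n, 0 ≤ f n := fun n => by
    have h1 : 0 < max t (n:ℝ) := lt_max_of_lt_left ht
    have : 1 / (max t ((n:ℝ)+1)) ≤ 1 / (max t n) :=
      one_div_le_one_div_of_le h1 (max_le_max le_rfl (by linarith))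
    simp only [hf]; linarith
  have hle : ∀ n ∈ T, 1 / (n:ℝ)^2 ≤ f n := fun n hn => by
    obtain ⟨h1, h2⟩ := hT n hn
    have h1' : (1:ℝ) ≤ n := by exact_mod_cast h1
    simp only [hf]
    rw [max_eq_right h2, max_eq_right (by linarith),
      div_sub_div _ _ (by positivity) (by positivity),
      ← mul_div_assoc, div_le_div_iff₀ (by positivity) (by positivity)]
    nlinarith
  refine (Finset.sum_le_sum hle).trans
    ((Finset.sum_le_sum_of_subset_of_nonneg (t := Finset.range (T.sup id + 1)) (fun n hn =>
      Finset.mem_range.2 (Nat.lt_succ_of_le (Finset.le_sup (f := id) hn)))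
      fun n _ _ => hf0 n).trans ?_)
  have t1 := Finset.sum_range_sub' (fun n : ℕ => 2 * (1 / max t (n:ℝ))) (T.sup id + 1)
  have e : ∀ n : ℕ, f n = 2 * (1 / max t (n:ℝ)) - 2 * (1 / max t ((n+1 : ℕ) : ℝ)) := fun n => by
    simp only [hf]; push_cast; ring
  rw [Finset.sum_congr rfl fun n _ => e n, t1]
  have b1 : max t ((0:ℕ):ℝ) = t := max_eq_left (by push_cast; exact ht.le)
  have b2 : 0 ≤ 2 * (1 / max t ((T.sup id + 1 : ℕ) : ℝ)) := by positivity
  rw [b1, mul_one_div]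
  linarith

lemma rpow_neg_one_sub_le {b t : ℝ} (hb0 : 0 < b) (hb1 : b ≤ 1) (ht : 1 ≤ t) :
    t ^ (-1 - b) ≤ 4 / b * (t ^ (-b) - (t + 1) ^ (-b)) := by
  have ht0 : 0 < t := by linarith
  have hbern : 1 + b * (1 / t) / 2 ≤ (1 + 1 / t) ^ b := by
    have h1 : 1 + b * (1 / t / 2) ≤ Real.exp (b * (1 / t / 2)) := by
      linarith [Real.add_one_le_exp (b * (1 / t / 2))]
    have h2 : Real.exp (1 / t / 2) ≤ 1 + 1 / t := by
      have hz : 1 / t ≤ 1 := by rw [div_le_one ht0]; exact ht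
      have hz0 : 0 < 1 / t := by positivity
      have h3 : 1 - 1 / t / 2 ≤ Real.exp (-(1 / t / 2)) := by
        linarith [Real.add_one_le_exp (-(1 / t / 2))]
      have h4 : Real.exp (1 / t / 2) * Real.exp (-(1 / t / 2)) = 1 := by
        rw [← Real.exp_add]; simp
      have h5 := Real.exp_pos (1 / t / 2)
      nlinarith
    calc _ = 1 + b * (1 / t / 2) := by ring
      _ ≤ Real.exp (b * (1 / t / 2)) := h1
      _ = Real.exp (1 / t / 2) ^ b := by rw [← Real.exp_mul, mul_comm]
      _ ≤ _ := Real.rpow_le_rpow (Real.exp_pos _).le h2 hb0.le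
  have e1 : (t + 1) ^ b = t ^ b * (1 + 1 / t) ^ b := by
    rw [← Real.mul_rpow ht0.le (by positivity)]; congr 1; field_simp
  have hu : (1 + 1 / t) ^ b ≤ 2 := by
    have hz : 1 / t ≤ 1 := by rw [div_le_one ht0]; exact ht
    calc _ ≤ (2:ℝ) ^ b := Real.rpow_le_rpow (by positivity) (by linarith) hb0.le
      _ ≤ (2:ℝ) ^ (1:ℝ) := Real.rpow_le_rpow_of_exponent_le (by norm_num) hb1
      _ = 2 := Real.rpow_one 2
  have htb : 0 < t ^ b := Real.rpow_pos_of_pos ht0 b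
  rw [Real.rpow_sub ht0, Real.rpow_neg ht0.le, Real.rpow_neg ht0.le b,
    Real.rpow_neg (by linarith) b, e1, Real.rpow_one]
  set z := (1 + 1 / t) ^ b
  have hz1 : 0 < z := lt_of_lt_of_le (by positivity) hbern
  have : 4 / b * ((t ^ b)⁻¹ - (t ^ b * z)⁻¹) = 4 / b * (z - 1) / z / t ^ b := by field_simp
  rw [this]
  gcongr
  rw [le_div_iff₀ hz1]
  calc t⁻¹ * z ≤ t⁻¹ * 2 := by gcongr
    _ = 4 / b * (b * (1 / t) / 2) := by field_simp; norm_num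
    _ ≤ _ := by gcongr; linarith

lemma sum_rpow_neg_le {T : Finset ℕ} {b t : ℝ} (hb0 : 0 < b) (hb1 : b ≤ 1) (ht : 1 ≤ t)
    (hT : ∀ n ∈ T, t ≤ n) : ∑ n ∈ T, (n:ℝ) ^ (-1 - b) ≤ 4 / b * t ^ (-b) := by
  have ht0 : 0 < t := by linarith
  set f : ℕ → ℝ := fun n => 4 / b * ((max t n) ^ (-b) - (max t ((n:ℝ)+1)) ^ (-b)) with hf
  have hf0 : ∀ n, 0 ≤ f n := fun n => by
    have h1 : 0 < max t (n:ℝ) := lt_max_of_lt_left ht0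
    have : (max t ((n:ℝ)+1)) ^ (-b) ≤ (max t n) ^ (-b) :=
      Real.rpow_le_rpow_of_nonpos h1 (max_le_max le_rfl (by linarith)) (by linarith)
    simp only [hf]
    exact mul_nonneg (by positivity) (by linarith)
  have hle : ∀ n ∈ T, (n:ℝ) ^ (-1 - b) ≤ f n := fun n hn => by
    have h2 := hT n hn
    simp only [hf]
    rw [max_eq_right h2, max_eq_right (by linarith)]
    exact rpow_neg_one_sub_le hb0 hb1 (ht.trans h2)
  refine (Finset.sum_le_sum hle).trans
    ((Finset.sum_le_sum_of_subset_of_nonneg (t := Finset.range (T.sup id + 1)) (fun n hn =>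
      Finset.mem_range.2 (Nat.lt_succ_of_le (Finset.le_sup (f := id) hn)))
      fun n _ _ => hf0 n).trans ?_)
  have t1 := Finset.sum_range_sub' (fun n : ℕ => 4 / b * (max t (n:ℝ)) ^ (-b)) (T.sup id + 1)
  have e : ∀ n : ℕ, f n = 4 / b * (max t (n:ℝ)) ^ (-b) -
      4 / b * (max t ((n+1 : ℕ) : ℝ)) ^ (-b) := fun n => by
    simp only [hf]; push_cast; ring
  rw [Finset.sum_congr rfl fun n _ => e n, t1]
  have b1 : max t ((0:ℕ):ℝ) = t := max_eq_left (by push_cast; exact ht0.le)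
  have b2 : 0 ≤ 4 / b * (max t ((T.sup id + 1 : ℕ) : ℝ)) ^ (-b) := by positivity
  rw [b1]
  linarith

lemma sum_rpow_neg_Icc_le {T : Finset ℕ} {a : ℝ} {i : ℕ} (ha0 : 0 ≤ a) (ha1 : a < 1)
    (hT : ∀ n ∈ T, 1 ≤ n ∧ n ≤ i) :
    ∑ n ∈ T, (n:ℝ) ^ (-a) ≤ (i:ℝ) ^ (1 - a) / (1 - a) := by
  have hb0 : 0 < 1 - a := by linarith
  refine (sum_le_sum_Icc (f := fun n => (n:ℝ) ^ (-a)) (fun n => by positivity) hT).trans ?_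
  rw [le_div_iff₀ hb0, Finset.sum_mul]
  have t1 := Finset.sum_range_sub (fun n : ℕ => (n:ℝ) ^ (1 - a)) i
  have e0 : ((0:ℕ):ℝ) ^ (1 - a) = 0 := by push_cast; exact Real.zero_rpow hb0.ne'
  rw [e0, sub_zero] at t1
  rw [← t1]
  refine Finset.sum_le_sum fun n _ => ?_
  set t : ℝ := ((n+1 : ℕ) : ℝ) with ht
  have ht0 : 0 < t := by positivity
  have hn : (n:ℝ) = t * (1 + (-(1 / t))) := by
    rw [ht]; push_cast; field_simp; ring
  have hs : -1 ≤ -(1 / t) := by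
    have : 1 / t ≤ 1 := by rw [div_le_one ht0, ht]; push_cast; linarith [n.cast_nonneg (α := ℝ)]
    linarith
  have hbern := rpow_one_add_le_one_add_mul_self hs hb0.le (by linarith : 1 - a ≤ 1)
  rw [hn, Real.mul_rpow ht0.le (by linarith)]
  have hta : t ^ (-a) = t ^ (1 - a) / t := by
    rw [show -a = (1 - a) - 1 by ring, Real.rpow_sub ht0, Real.rpow_one]
  have htb : 0 < t ^ (1 - a) := Real.rpow_pos_of_pos ht0 _
  have := mul_le_mul_of_nonneg_left hbern htb.le
  rw [hta]
  calc _ = t ^ (1 - a) - t ^ (1 - a) * (1 + (1 - a) * -(1 / t)) := by ring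
    _ ≤ _ := by linarith

/-- The pairs `(n, m)` with `1 ≤ m ≤ n` whose eigenvalue satisfies `i - 1 < √λ ≤ i`. -/
structure InWindow (i n m : ℕ) : Prop where
  one_le : 1 ≤ m
  le : m ≤ n
  lt_eigen : ((i:ℝ) - 1)^2 < (n:ℝ) * (n + 1) - (m:ℝ)^2
  eigen_le : (n:ℝ) * (n + 1) - (m:ℝ)^2 ≤ (i:ℝ)^2

namespace InWindow

variable {i n m : ℕ}

lemma one_le_real (h : InWindow i n m) : (1:ℝ) ≤ m := by exact_mod_cast h.one_le

lemma le_real (h : InWindow i n m) : (m:ℝ) ≤ n := by exact_mod_cast h.le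

lemma one_le_window (h : InWindow i n m) : (1:ℝ) ≤ i := by
  have h1 := h.one_le_real
  have h2 := h.le_real
  have h3 := h.eigen_le
  have h4 : (0:ℝ) < i := by
    rcases (Nat.cast_nonneg (α := ℝ) i).lt_or_eq with h5 | h5
    · exact h5
    · rw [← h5] at h3; nlinarith
  exact_mod_cast h4

lemma sq_le_four_mul (h : InWindow i n m) :
    (i:ℝ)^2 ≤ 4 * ((n:ℝ) * (n + 1) - (m:ℝ)^2) := by
  have h1 := h.one_le_real
  have h2 := h.le_real
  have h3 := h.lt_eigen
  have h0 := h.one_le_window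
  rcases h0.eq_or_lt with h4 | h4
  · rw [← h4]; nlinarith
  · have h5 : (2:ℝ) ≤ i := by
      have : 1 < i := by exact_mod_cast h4
      exact_mod_cast this
    nlinarith

lemma unique {n' : ℕ} (h : InWindow i n m) (h' : InWindow i n' m) : n = n' := by
  have key : ∀ {k l : ℕ}, InWindow i k m → InWindow i l m → ¬ k < l := by
    intro k l hk hl hkl
    have e1 : (k:ℝ) + 1 ≤ l := by exact_mod_cast hkl
    have e2 := hk.lt_eigen
    have e3 := hl.eigen_le
    have e4 := hk.one_le_window
    have e5 := hk.le_real
    have e6 := hk.one_le_real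
    by_cases hik : (i:ℝ) ≤ k + 1
    · nlinarith
    · push Not at hik
      have e7 : (k:ℝ) + 2 ≤ i := by
        have : k + 1 < i := by exact_mod_cast hik
        exact_mod_cast this
      nlinarith
  exact le_antisymm (not_lt.1 (key h' h)) (not_lt.1 (key h h'))

end InWindow

lemma sum_snd_le {i : ℕ} {S : Finset (ℕ × ℕ)} (hS : ∀ p ∈ S, InWindow i p.1 p.2) {y : ℕ × ℕ → ℝ}
    {f : ℕ → ℝ} (h : ∀ p ∈ S, y p ≤ f p.2) : ∑ p ∈ S, y p ≤ ∑ m ∈ S.image Prod.snd, f m := by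
  rw [Finset.sum_image]
  · exact Finset.sum_le_sum h
  · intro p hp q hq hpq
    refine Prod.ext ?_ hpq
    have := hS p hp
    rw [hpq] at this
    exact this.unique (hS q hq)

lemma le_div_sqrt_of_mul_le {q r y A : ℝ} (hr : 0 < r) (hrq : r ≤ q) (hy : 0 ≤ y)
    (h : Real.sqrt q * y ≤ A) : y ≤ A / Real.sqrt r := by
  rw [le_div_iff₀ (Real.sqrt_pos.2 hr)]
  nlinarith [Real.sqrt_le_sqrt hrq]

section FarFromEquator

variable {i : ℕ} {S : Finset (ℕ × ℕ)} {x : ℝ}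

lemma sum_near_transition (hS : ∀ p ∈ S, InWindow i p.1 p.2) (hx : |x| ≤ 1)
    {M : ℝ} (hM : M ≤ 4 * i) (h : ∀ p ∈ S, |(p.2:ℝ) - M| < (16:ℕ)) :
    ∑ p ∈ S, tY p.1 p.2 x ^ 2 ≤ 700 * i := by
  refine (sum_snd_le hS (f := fun _ => 21 * (i:ℝ)) fun p hp => ?_).trans ?_
  · have hw := hS p hp
    refine (tY_sq_le_degree hw.one_le hw.le hx).trans ?_
    have h1 := (abs_lt.1 (h p hp)).2
    have h2 := hw.one_le_window
    have h3 := hw.eigen_le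
    have h4 := hw.one_le_real
    have h5 := hw.le_real
    push_cast at h1
    have h6 : (p.2:ℝ) ≤ 20 * i := by linarith
    by_contra hcon
    push Not at hcon
    nlinarith
  · rw [Finset.sum_const, nsmul_eq_mul]
    have := card_abs_sub_lt_le (T := S.image Prod.snd) (c := M) (K := 16) (by
      intro m hm
      obtain ⟨p, hp, rfl⟩ := Finset.mem_image.1 hm
      exact h p hp)
    push_cast at this
    have hi : (0:ℝ) ≤ i := by positivity
    nlinarith

lemma sum_large_order (hS : ∀ p ∈ S, InWindow i p.1 p.2) (hx : |x| ≤ 1) (hx4 : 1/4 ≤ |x|)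
    (h : ∀ p ∈ S, 8 * (i:ℝ) ≤ p.2) :
    ∑ p ∈ S, tY p.1 p.2 x ^ 2 ≤ 1600 * i := by
  rcases S.eq_empty_or_nonempty with rfl | ⟨q, hq⟩
  · simp
  have hi := (hS q hq).one_le_window
  refine (sum_snd_le hS (f := fun m => 6400 * (i:ℝ)^2 * (1 / (m:ℝ)^2)) fun p hp => ?_).trans ?_
  · have hw := hS p hp
    have h1 := h p hp
    have h3 := hw.eigen_le
    have h4 := hw.one_le_real
    have h5 := hw.le_real
    have hL : (p.2:ℝ)^2 ≤ (p.1:ℝ) * (p.1 + 1) := by nlinarith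
    have hx2 : 1/16 ≤ x^2 := by rw [← sq_abs]; nlinarith
    have hx3 : 1/64 ≤ |x|^3 := by
      have := pow_le_pow_left₀ (by norm_num) hx4 3
      norm_num at this ⊢; exact this
    have hd := tY_sq_decay hw.one_le hw.le hx (by nlinarith)
    rw [mul_one_div, le_div_iff₀ (by positivity)]
    have hy : 0 ≤ tY p.1 p.2 x ^ 2 := sq_nonneg _
    have e1 : (p.2:ℝ)^2 * (1/64) ≤ (p.1:ℝ) * (p.1 + 1) * |x|^3 :=
      mul_le_mul hL hx3 (by norm_num) (by positivity)
    nlinarith [mul_le_mul_of_nonneg_right e1 hy]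
  · rw [← Finset.mul_sum]
    have := sum_inv_sq_le (T := S.image Prod.snd) (t := 8 * i) (by positivity) (by
      intro m hm
      obtain ⟨p, hp, rfl⟩ := Finset.mem_image.1 hm
      exact ⟨(hS p hp).one_le, h p hp⟩)
    refine (mul_le_mul_of_nonneg_left this (by positivity)).trans (le_of_eq ?_)
    field_simp; norm_num

lemma sum_near_pole (hS : ∀ p ∈ S, InWindow i p.1 p.2) (hx : |x| ≤ 1)
    {M : ℝ} (hM : M * |x| = i * Real.sqrt (1 - x^2)) (hM0 : 0 ≤ M)
    (h : ∀ p ∈ S, 32 * M < p.2 ∧ (p.2:ℝ) ≤ 8 * i) :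
    ∑ p ∈ S, tY p.1 p.2 x ^ 2 ≤ 210 * i := by
  rcases S.eq_empty_or_nonempty with rfl | ⟨q, hq⟩
  · simp
  have hi := (hS q hq).one_le_window
  set c := Real.sqrt (1 - x^2) with hc
  have hc0 : 0 ≤ c := Real.sqrt_nonneg _
  have hx2 : x^2 ≤ 1 := by rw [← sq_abs]; nlinarith [abs_nonneg x]
  have hc2 : c^2 = 1 - x^2 := Real.sq_sqrt (by linarith)
  have hcM : i * c ≤ M := by rw [← hM]; nlinarith
  refine (sum_snd_le hS (f := fun m => 3250 * (i:ℝ) * M * (1 / (m:ℝ)^2)) fun p hp => ?_).trans ?_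
  · have hw := hS p hp
    obtain ⟨h1, h2⟩ := h p hp
    have h3 := hw.eigen_le
    have h4 := hw.one_le_real
    have hL : (p.1:ℝ) * (p.1 + 1) ≤ 65 * (i:ℝ)^2 := by nlinarith
    have hL0 : 0 ≤ (p.1:ℝ) * (p.1 + 1) := by positivity
    have hd := tY_sq_decay_near_one hw.one_le hw.le hx (by
      rw [← hc2]
      have e1 : (i * c)^2 ≤ M^2 := pow_le_pow_left₀ (by positivity) hcM 2
      have e2 : (32 * M)^2 ≤ (p.2:ℝ)^2 := pow_le_pow_left₀ (by positivity) h1.le 2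
      nlinarith [mul_le_mul_of_nonneg_right hL (sq_nonneg c)])
    rw [← hc] at hd
    rw [mul_one_div, le_div_iff₀ (by positivity)]
    have e3 := mul_le_mul_of_nonneg_right hL hc0
    have e4 := mul_le_mul_of_nonneg_left hcM (by linarith : (0:ℝ) ≤ i)
    nlinarith
  · rw [← Finset.mul_sum]
    rcases hM0.eq_or_lt with h0 | h0
    · rw [← h0]; simp
    have := sum_inv_sq_le (T := S.image Prod.snd) (t := 32 * M) (by positivity) (by
      intro m hm
      obtain ⟨p, hp, rfl⟩ := Finset.mem_image.1 hm
      exact ⟨(hS p hp).one_le, (h p hp).1.le⟩)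
    refine (mul_le_mul_of_nonneg_left this (by positivity)).trans ?_
    have e : 3250 * (i:ℝ) * M * (2 / (32 * M)) = 203.125 * i := by field_simp; norm_num
    rw [e]; nlinarith

lemma sum_off_transition (hS : ∀ p ∈ S, InWindow i p.1 p.2) (hx : |x| ≤ 1) (hx4 : 1/4 ≤ |x|)
    {M : ℝ} (hM : M * |x| = i * Real.sqrt (1 - x^2)) (hM0 : 0 ≤ M)
    (h : ∀ p ∈ S, 16 ≤ |(p.2:ℝ) - M| ∧ (p.2:ℝ) ≤ 32 * M ∧ (p.2:ℝ) ≤ 8 * i) :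
    ∑ p ∈ S, tY p.1 p.2 x ^ 2 ≤ 90000 * i := by
  rcases S.eq_empty_or_nonempty with rfl | ⟨q, hq⟩
  · simp
  have hi := (hS q hq).one_le_window
  have hMpos : 0 < M := by
    have := (hS q hq).one_le_real
    linarith [(h q hq).2.1]
  set c := Real.sqrt (1 - x^2) with hc
  have hc0 : 0 ≤ c := Real.sqrt_nonneg _
  have hx2 : x^2 ≤ 1 := by rw [← sq_abs]; nlinarith [abs_nonneg x]
  have hc2 : c^2 = 1 - x^2 := Real.sq_sqrt (by linarith)
  have hc1 : c ≤ 1 := by nlinarith [sq_nonneg x]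
  have hsM : 0 < Real.sqrt M := Real.sqrt_pos.2 hMpos
  have hs2 : |x|^2 = x^2 := sq_abs x
  refine (sum_snd_le hS (f := fun m => 3550 * (i:ℝ) / Real.sqrt M *
    (1 / Real.sqrt |(m:ℝ) - M|)) fun p hp => ?_).trans ?_
  · have hw := hS p hp
    obtain ⟨h1, h2, h2'⟩ := h p hp
    have h3 := hw.eigen_le
    have h3' := hw.lt_eigen
    have h4 := hw.one_le_real
    have hL : (p.1:ℝ) * (p.1 + 1) ≤ 65 * (i:ℝ)^2 := by nlinarith
    have hsL : Real.sqrt ((p.1:ℝ) * (p.1 + 1)) ≤ 8.07 * i := by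
      rw [Real.sqrt_le_left (by positivity)]; nlinarith
    have hd := sqrt_abs_mul_tY_sq_le hw.one_le hw.le hx
    set d := |(p.2:ℝ) - M| with hdd
    set lam := (p.1:ℝ) * (p.1 + 1) - (p.2:ℝ)^2 with hlam
    have hq : 1 / 32 * (M * d) ≤ |lam * (1 - x^2) - (p.2:ℝ)^2 * x^2| := by
      have e1 : lam * (1 - x^2) - (p.2:ℝ)^2 * x^2 =
          x^2 * ((M - p.2) * (M + p.2)) - ((i:ℝ)^2 - lam) * c^2 := by
        have : (M * |x|)^2 = (i * c)^2 := by rw [hM]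
        rw [mul_pow, mul_pow, hs2] at this
        rw [← hc2]; linear_combination (-1) * this
      have e2 : |x^2 * ((M - p.2) * (M + p.2))| = x^2 * (d * (M + p.2)) := by
        rw [abs_mul, abs_mul, abs_of_nonneg (sq_nonneg x), abs_sub_comm,
          abs_of_nonneg (by positivity : 0 ≤ M + p.2)]
      have e3 : ((i:ℝ)^2 - lam) * c^2 ≤ 8 * x^2 * M := by
        have f1 : (i:ℝ)^2 - lam ≤ 2 * i := by
          have : ((i:ℝ) - 1)^2 = (i:ℝ)^2 - 2 * i + 1 := by ring
          linarith
        have f2 : 2 * (i:ℝ) * c^2 = 2 * c * (M * |x|) := by rw [hM]; ring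
        have f0 : 0 ≤ M * |x| := by positivity
        have f3 : c * (M * |x|) ≤ M * |x| := mul_le_of_le_one_left f0 hc1
        have f4 : 0 ≤ M * |x| * (|x| - 1/4) := mul_nonneg f0 (by linarith)
        have f5 : M * |x| * (|x| - 1/4) = M * |x|^2 - M * |x| / 4 := by ring
        rw [f5] at f4
        rw [hs2] at f4
        linarith [mul_le_mul_of_nonneg_right f1 (sq_nonneg c)]
      have e3' : 0 ≤ ((i:ℝ)^2 - lam) * c^2 := mul_nonneg (by linarith) (sq_nonneg c)
      have e4 := abs_sub_abs_le_abs_sub (x^2 * ((M - p.2) * (M + p.2))) (((i:ℝ)^2 - lam) * c^2)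
      rw [e2, abs_of_nonneg e3', ← e1] at e4
      have e5 : 1/16 ≤ x^2 := by rw [← hs2]; nlinarith
      have e6 : M * 16 ≤ M * d := mul_le_mul_of_nonneg_left h1 hM0
      have e7 : 0 ≤ d * p.2 := by positivity
      have e8 : 1/16 * (M * d) ≤ x^2 * (M * d) := mul_le_mul_of_nonneg_right e5 (by positivity)
      have e9 : x^2 * (M * 16) ≤ x^2 * (M * d) := mul_le_mul_of_nonneg_left e6 (sq_nonneg x)
      have e10 : 0 ≤ x^2 * (d * p.2) := mul_nonneg (sq_nonneg x) e7
      linarith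
    have hdpos : 0 < d := by linarith
    have hb := le_div_sqrt_of_mul_le (by positivity) hq (sq_nonneg _) hd
    refine hb.trans ?_
    have hs32 : Real.sqrt (1/32) * Real.sqrt M * Real.sqrt d = Real.sqrt (1/32 * (M * d)) := by
      rw [Real.sqrt_mul (by norm_num), Real.sqrt_mul hM0]; ring
    have h32 : 0.17 ≤ Real.sqrt (1/32) := Real.le_sqrt_of_sq_le (by norm_num)
    have hsd : 0 < Real.sqrt d := Real.sqrt_pos.2 hdpos
    rw [← hs32, div_mul_div_comm, mul_one, div_le_div_iff₀ (by positivity) (by positivity)]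
    have g1 : 0 < Real.sqrt M * Real.sqrt d := by positivity
    have g2 : 74 * Real.sqrt ((p.1:ℝ) * (p.1 + 1)) ≤ 3550 * i * Real.sqrt (1/32) := by
      have := mul_le_mul_of_nonneg_left h32 (by linarith : (0:ℝ) ≤ 3550 * i)
      linarith
    refine (mul_le_mul_of_nonneg_right g2 g1.le).trans (le_of_eq ?_)
    ring
  · rw [← Finset.mul_sum]
    have := sum_inv_sqrt_abs_le (T := S.image Prod.snd) (c := M) (R := 31 * M) hM0 (by linarith) (by
      intro m hm
      obtain ⟨p, hp, rfl⟩ := Finset.mem_image.1 hm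
      obtain ⟨h1, h2, -⟩ := h p hp
      refine ⟨(hS p hp).one_le, by linarith, abs_le.2 ⟨?_, by linarith⟩⟩
      have := (hS p hp).one_le_real
      linarith)
    refine (mul_le_mul_of_nonneg_left this (by positivity)).trans ?_
    rw [Real.sqrt_mul (by norm_num)]
    have h31 : Real.sqrt 31 ≤ 6 := by rw [Real.sqrt_le_left (by norm_num)]; norm_num
    have e : 3550 * (i:ℝ) / Real.sqrt M * (4 * (Real.sqrt 31 * Real.sqrt M)) =
      14200 * i * Real.sqrt 31 := by field_simp; norm_num
    rw [e]; nlinarith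

lemma sum_far_from_equator (hS : ∀ p ∈ S, InWindow i p.1 p.2) (hx : |x| ≤ 1) (hx4 : 1/4 ≤ |x|) :
    ∑ p ∈ S, tY p.1 p.2 x ^ 2 ≤ 100000 * i := by
  classical
  set M := (i:ℝ) * Real.sqrt (1 - x^2) / |x| with hMdef
  have hxpos : 0 < |x| := by linarith
  have hM : M * |x| = i * Real.sqrt (1 - x^2) := div_mul_cancel₀ _ hxpos.ne'
  have hM0 : 0 ≤ M := by positivity
  have hi : (0:ℝ) ≤ i := by positivity
  have hM4 : M ≤ 4 * i := by
    have : Real.sqrt (1 - x^2) ≤ 1 := by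
      rw [Real.sqrt_le_left (by norm_num)]; nlinarith [sq_nonneg x]
    rw [hMdef, div_le_iff₀ hxpos]
    nlinarith
  rw [← Finset.sum_filter_add_sum_filter_not S (fun p => |(p.2:ℝ) - M| < (16:ℕ))]
  set S1 := S.filter (fun p => ¬ |(p.2:ℝ) - M| < (16:ℕ)) with hS1
  rw [← Finset.sum_filter_add_sum_filter_not S1 (fun p => 8 * (i:ℝ) ≤ p.2)]
  set S2 := S1.filter (fun p => ¬ 8 * (i:ℝ) ≤ p.2) with hS2
  rw [← Finset.sum_filter_add_sum_filter_not S2 (fun p => 32 * M < p.2)]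
  have b1 := sum_near_transition (S := S.filter (fun p => |(p.2:ℝ) - M| < (16:ℕ))) (i := i)
    (fun p hp => hS p (Finset.mem_filter.1 hp).1) hx hM4 (fun p hp => (Finset.mem_filter.1 hp).2)
  have hS1w : ∀ p ∈ S1, InWindow i p.1 p.2 := fun p hp => hS p (Finset.mem_filter.1 hp).1
  have b2 := sum_large_order (S := S1.filter (fun p => 8 * (i:ℝ) ≤ p.2)) (i := i)
    (fun p hp => hS1w p (Finset.mem_filter.1 hp).1) hx hx4 (fun p hp => (Finset.mem_filter.1 hp).2)
  have hS2w : ∀ p ∈ S2, InWindow i p.1 p.2 := fun p hp => hS1w p (Finset.mem_filter.1 hp).1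
  have hS2b : ∀ p ∈ S2, (p.2:ℝ) ≤ 8 * i := fun p hp =>
    (not_le.1 (Finset.mem_filter.1 hp).2).le
  have b3 := sum_near_pole (S := S2.filter (fun p => 32 * M < p.2)) (i := i)
    (fun p hp => hS2w p (Finset.mem_filter.1 hp).1) hx hM hM0
    (fun p hp => ⟨(Finset.mem_filter.1 hp).2, hS2b p (Finset.mem_filter.1 hp).1⟩)
  have b4 := sum_off_transition (S := S2.filter (fun p => ¬ 32 * M < p.2)) (i := i)
    (fun p hp => hS2w p (Finset.mem_filter.1 hp).1) hx hx4 hM hM0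
    (fun p hp => by
      obtain ⟨hp2, hp3⟩ := Finset.mem_filter.1 hp
      have := not_lt.1 (Finset.mem_filter.1 (Finset.mem_filter.1 hp2).1).2
      push_cast at this
      exact ⟨this, not_lt.1 hp3, hS2b p hp2⟩)
  linarith

end FarFromEquator

lemma fifteen_sixteenths_le {x : ℝ} (hx : |x| ≤ 1/4) : 15/16 ≤ 1 - x^2 := by
  have := abs_nonneg x
  rw [← sq_abs]; nlinarith

lemma exists_gap_root {t s : ℝ} (ht : 1 ≤ t) (hs0 : 0 ≤ s) (hs : s ≤ 1/4) :
    ∃ r, 0.86 * (t * s) ≤ r ∧ r ≤ 1.5 * (t * s) ∧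
      t * r * Real.sqrt (1 - s^2) = (t^2 - (r^2 - 1) / 4) * s := by
  set c := Real.sqrt (1 - s^2) with hc
  have hc1 : c ≤ 1 := by rw [hc, Real.sqrt_le_left (by norm_num)]; nlinarith
  have hc2 : 0.968 ≤ c := Real.le_sqrt_of_sq_le (by nlinarith)
  have hD : 0 ≤ t * s := by positivity
  set g : ℝ → ℝ := fun r => t * r * c - (t^2 - (r^2 - 1) / 4) * s with hg
  have hcont : ContinuousOn g (Icc (0.86 * (t * s)) (1.5 * (t * s))) := by fun_prop
  have hts : 0 ≤ t * (t * s) := by positivity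
  have hs3 : (t * s)^2 * s ≤ 1/16 * (t * (t * s)) := by
    have e : (t * s)^2 * s = s^2 * (t * (t * s)) := by ring
    rw [e]
    exact mul_le_mul_of_nonneg_right (by nlinarith) hts
  have hs4 : s ≤ t * (t * s) := by nlinarith [mul_nonneg hs0 (by linarith : 0 ≤ t - 1)]
  have h1 : g (0.86 * (t * s)) ≤ 0 := by
    have e : g (0.86 * (t * s)) = 0.86 * (t * (t * s)) * c - t * (t * s) +
      0.1849 * ((t * s)^2 * s) - s / 4 := by simp only [hg]; ring
    rw [e]
    have := mul_le_mul_of_nonneg_left hc1 hts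
    linarith
  have h2 : 0 ≤ g (1.5 * (t * s)) := by
    have e : g (1.5 * (t * s)) = 1.5 * (t * (t * s) * c) - t * (t * s) +
      0.5625 * ((t * s)^2 * s) - s / 4 := by simp only [hg]; ring
    rw [e]
    have := mul_le_mul_of_nonneg_left hc2 hts
    have h3 : 0 ≤ (t * s)^2 * s := by positivity
    linarith
  obtain ⟨r, hr, hr0⟩ := intermediate_value_Icc (by linarith) hcont ⟨h1, h2⟩
  exact ⟨r, hr.1, hr.2, by simp only [hg] at hr0; linarith⟩

section NearEquator

variable {i n m : ℕ} {x k : ℝ}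

lemma tY_sq_le_of_lt_window (h : InWindow i n m) (hmi : m ≤ i) (hx4 : |x| ≤ 1/4) :
    tY n m x ^ 2 ≤ 260 := by
  have hi := h.one_le_window
  have h1 := h.sq_le_four_mul
  have h2 := h.eigen_le
  have hmi' : (m:ℝ) ≤ i := by exact_mod_cast hmi
  have hm0 : (0:ℝ) ≤ m := by positivity
  have hx2 := fifteen_sixteenths_le hx4
  have hd := sqrt_abs_mul_tY_sq_le h.one_le h.le (hx4.trans (by norm_num))
  set lam := (n:ℝ) * (n + 1) - (m:ℝ)^2 with hlam
  have hm2 : (m:ℝ)^2 ≤ (i:ℝ)^2 := by nlinarith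
  have hq : 11/64 * (i:ℝ)^2 ≤ |lam * (1 - x^2) - (m:ℝ)^2 * x^2| := by
    refine le_trans ?_ (le_abs_self _)
    have e1 : (i:ℝ)^2 / 4 * (15/16) ≤ lam * (1 - x^2) :=
      mul_le_mul (by linarith) hx2 (by norm_num) (by nlinarith)
    have e2 : (m:ℝ)^2 * x^2 ≤ (i:ℝ)^2 * (1/16) :=
      mul_le_mul hm2 (by linarith) (sq_nonneg x) (by positivity)
    linarith
  have hL : Real.sqrt ((n:ℝ) * (n + 1)) ≤ 1.415 * i := by
    rw [Real.sqrt_le_left (by positivity)]; nlinarith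
  have hq' : 0.414 * (i:ℝ) ≤ Real.sqrt |lam * (1 - x^2) - (m:ℝ)^2 * x^2| :=
    Real.le_sqrt_of_sq_le (by nlinarith)
  have e3 := mul_le_mul_of_nonneg_right hq' (sq_nonneg (tY n m x))
  have e4 : (i:ℝ) * (0.414 * tY n m x ^ 2) ≤ i * 104.71 := by nlinarith
  have := le_of_mul_le_mul_left e4 (by linarith)
  linarith

lemma gap_facts (h : InWindow i n m) (him : i ≤ m) (hk : k = 2 * ((n:ℝ) - m) + 1) :
    (n:ℝ) * (n + 1) - (m:ℝ)^2 = k * m + (k^2 - 1) / 4 ∧ 1 ≤ k ∧ k ≤ i ∧ k * m ≤ (i:ℝ)^2 ∧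
      (i:ℝ)^2 ≤ 5 * (k * m) := by
  have hi := h.one_le_window
  have h1 := h.sq_le_four_mul
  have h2 := h.eigen_le
  have h3 := h.le_real
  have him' : (i:ℝ) ≤ m := by exact_mod_cast him
  have e : (n:ℝ) * (n + 1) - (m:ℝ)^2 = k * m + (k^2 - 1) / 4 := by rw [hk]; ring
  have hk1 : 1 ≤ k := by linarith
  have hkm : k * m ≤ (i:ℝ)^2 := by nlinarith
  have hki : k ≤ i := by
    by_contra hcon
    push Not at hcon
    nlinarith
  refine ⟨e, hk1, hki, hkm, ?_⟩
  nlinarith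

lemma tY_sq_le_window (h : InWindow i n m) (him : i ≤ m) (hx : |x| ≤ 1) :
    tY n m x ^ 2 ≤ i := by
  have him' : (i:ℝ) ≤ m := by exact_mod_cast him
  have h2 := h.eigen_le
  have hi := h.one_le_window
  refine (tY_sq_le_sqrt_eigen h.one_le h.le hx (by nlinarith)).trans ?_
  rw [Real.sqrt_le_left (by linarith)]
  exact h2

lemma tY_sq_le_of_small_gap (h : InWindow i n m) (him : i ≤ m) (hk : k = 2 * ((n:ℝ) - m) + 1)
    (hx : |x| ≤ 1) (hD : 10 * k ≤ i * |x|) :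
    tY n m x ^ 2 ≤ i * (2500 * k^2 / (i * |x|)^3) := by
  obtain ⟨e, hk1, hki, hkm, hkm5⟩ := gap_facts h him hk
  have hi := h.one_le_window
  have h2 := h.eigen_le
  have h1 := h.one_le_real
  have hL : (m:ℝ)^2 ≤ (n:ℝ) * (n + 1) := by nlinarith
  have hDpos : 0 < (i:ℝ) * |x| := by linarith
  have hxpos : 0 < |x| := pos_of_mul_pos_right hDpos (by linarith)
  have hi4 : ((i:ℝ)^2)^2 ≤ 25 * (k^2 * (n * (n + 1))) := by
    have := pow_le_pow_left₀ (by positivity) hkm5 2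
    nlinarith [mul_le_mul_of_nonneg_left hL (sq_nonneg k)]
  have hk2 : 0 < k^2 := by positivity
  have hdec := tY_sq_decay h.one_le h.le hx (by
    have e1 := pow_le_pow_left₀ (by linarith) hD 2
    have e2 : 100 * k^2 * (i:ℝ)^2 ≤ 25 * (k^2 * (n * (n + 1))) * x^2 := by
      have := mul_le_mul_of_nonneg_right hi4 (sq_nonneg x)
      refine le_trans ?_ this
      have e3 := mul_le_mul_of_nonneg_right e1 (sq_nonneg (i:ℝ))
      rw [mul_pow, mul_pow, sq_abs] at e3
      linarith
    have e4 : k^2 * (4 * (i:ℝ)^2) ≤ k^2 * (n * (n + 1) * x^2) := by linarith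
    have e5 := le_of_mul_le_mul_left e4 hk2
    linarith)
  rw [← mul_div_assoc, le_div_iff₀ (by positivity)]
  set y := tY n m x ^ 2 with hy
  have hy0 : 0 ≤ y := sq_nonneg _
  have e6 := mul_le_mul_of_nonneg_right hi4 (by positivity : 0 ≤ |x|^3 * y)
  have e7 : k^2 * ((n:ℝ) * (n + 1) * |x|^3 * y) ≤ k^2 * (100 * (i:ℝ)^2) :=
    mul_le_mul_of_nonneg_left (hdec.trans (by linarith)) hk2.le
  have e8 : (i:ℝ) * (y * (i * |x|)^3) ≤ i * (i * (2500 * k^2)) := by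
    calc (i:ℝ) * (y * (i * |x|)^3) = ((i:ℝ)^2)^2 * (|x|^3 * y) := by ring
      _ ≤ 25 * (k^2 * (n * (n + 1))) * (|x|^3 * y) := e6
      _ = 25 * (k^2 * ((n:ℝ) * (n + 1) * |x|^3 * y)) := by ring
      _ ≤ 25 * (k^2 * (100 * (i:ℝ)^2)) := by linarith
      _ = _ := by ring
  exact le_of_mul_le_mul_left e8 (by linarith)

set_option maxHeartbeats 1000000 in
lemma tY_sq_le_off_root (h : InWindow i n m) (him : i ≤ m) (hk : k = 2 * ((n:ℝ) - m) + 1)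
    (hx4 : |x| ≤ 1/4) {r q : ℝ} (hr0 : 0 ≤ r)
    (hr : i * r * Real.sqrt (1 - |x|^2) = ((i:ℝ)^2 - (r^2 - 1) / 4) * |x|)
    (hkr : 5 ≤ |k - r|) (hq0 : 0 < q) (hq : q ≤ max k |k - r|) :
    tY n m x ^ 2 ≤ i * (220 / Real.sqrt (|k - r| * q)) := by
  obtain ⟨e, hk1, hki, hkm, hkm5⟩ := gap_facts h him hk
  have hi := h.one_le_window
  have h2 := h.eigen_le
  have h3 := h.lt_eigen
  have h1 := h.one_le_real
  have him' : (i:ℝ) ≤ m := by exact_mod_cast him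
  have h4 := h.sq_le_four_mul
  have hd := sqrt_abs_mul_tY_sq_le h.one_le h.le (hx4.trans (by norm_num))
  have hx2 := fifteen_sixteenths_le hx4
  set lam := (n:ℝ) * (n + 1) - (m:ℝ)^2 with hlam
  rw [← sq_abs x] at hd hx2
  set s := |x| with hs
  have hs0 : 0 ≤ s := abs_nonneg x
  set c := Real.sqrt (1 - s^2) with hc
  have hc2 : c^2 = 1 - s^2 := Real.sq_sqrt (by linarith)
  have hc1 : 0.968 ≤ c := Real.le_sqrt_of_sq_le (by linarith)
  set t := Real.sqrt lam with ht
  have hlam0 : 0 ≤ lam := by nlinarith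
  have ht2 : t^2 = lam := Real.sq_sqrt hlam0
  have hti : t ≤ i := by rw [ht, Real.sqrt_le_left (by linarith)]; exact h2
  have hti2 : (i:ℝ) - 1 ≤ t := Real.le_sqrt_of_sq_le h3.le
  have hti3 : (i:ℝ) / 2 ≤ t := Real.le_sqrt_of_sq_le (by nlinarith)
  set d := |k - r| with hdd
  set f := t * k * c - k * m * s with hf
  set w := t * k * c + k * m * s with hw
  have hfac : k^2 * (lam * (1 - s^2) - (m:ℝ)^2 * s^2) = f * w := by
    rw [← ht2, ← hc2, hf, hw]; ring
  have hg : |(k - r) * (i * c + s * (k + r) / 4)| ≤ |f| + 1.52 * (i * c) := by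
    have e1 : (k - r) * (i * c + s * (k + r) / 4) =
        f + ((i - t) * k * c - ((i:ℝ)^2 - lam) * s) := by
      rw [hf]
      have e3 : k * m = lam - (k^2 - 1) / 4 := by linarith
      rw [e3]; linear_combination (-1) * hr
    rw [e1]
    refine (abs_add_le _ _).trans (add_le_add le_rfl ?_)
    have f1 : 0 ≤ (i - t) * k * c :=
      mul_nonneg (mul_nonneg (by linarith) (by linarith)) (by linarith)
    have f2 : (i - t) * k * c ≤ i * c := by
      have : (i - t) * k ≤ 1 * i := mul_le_mul (by linarith) hki (by linarith) (by norm_num)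
      have := mul_le_mul_of_nonneg_right this (by linarith : 0 ≤ c)
      linarith
    have f3 : 0 ≤ ((i:ℝ)^2 - lam) * s := mul_nonneg (by linarith) hs0
    have f4 : ((i:ℝ)^2 - lam) * s ≤ 0.52 * (i * c) := by
      have g1 : (i:ℝ)^2 - lam ≤ 2 * i := by
        have : ((i:ℝ) - 1)^2 = (i:ℝ)^2 - 2 * i + 1 := by ring
        linarith
      have g2 := mul_le_mul g1 hx4 hs0 (by linarith)
      have g3 := mul_le_mul_of_nonneg_left hc1 (by linarith : (0:ℝ) ≤ i)
      linarith
    rw [abs_le]; constructor <;> linarith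
  have hic : 0 < i * c := mul_pos (by linarith) (by linarith)
  have hfd : 0.69 * (i * c) * d ≤ |f| := by
    rw [abs_mul, abs_of_nonneg (by positivity : 0 ≤ i * c + s * (k + r) / 4)] at hg
    have e1 : 0 ≤ d * (s * (k + r) / 4) := by positivity
    have e2 : i * c * 5 ≤ i * c * d := mul_le_mul_of_nonneg_left hkr hic.le
    rw [← hdd, mul_add] at hg
    linarith
  have hkms : 0 ≤ k * m * s := by positivity
  have htkc : 0 ≤ t * k * c := by positivity
  have hwq : 0.5 * (i * c) * q ≤ w := by
    rcases le_max_iff.1 hq with hq' | hq'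
    · have e1 : i / 2 * k * c ≤ t * k * c := by gcongr
      have e2 := mul_le_mul_of_nonneg_left hq' hic.le
      linarith
    · have e1 : |f| ≤ w := by rw [abs_le]; constructor <;> linarith
      have e2 := mul_le_mul_of_nonneg_left hq' hic.le
      have e3 : 0 ≤ i * c * d := by positivity
      linarith
  have hd0 : 0 < d := by linarith
  have hQ : 0.345 * (i * c / k)^2 * (d * q) ≤ |lam * (1 - s^2) - (m:ℝ)^2 * s^2| := by
    have e1 : k^2 * |lam * (1 - s^2) - (m:ℝ)^2 * s^2| = |f| * w := by
      rw [← abs_of_nonneg (sq_nonneg k), ← abs_mul, hfac, abs_mul,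
        abs_of_nonneg (by linarith : 0 ≤ w)]
    have e2 := mul_le_mul hfd hwq (by positivity) (abs_nonneg f)
    have hk2 : 0 < k^2 := by positivity
    refine le_of_mul_le_mul_left ?_ hk2
    rw [e1]
    refine le_trans (le_of_eq ?_) e2
    field_simp; norm_num
  have hsq : 0.5685 * (i / k) * Real.sqrt (d * q) ≤
      Real.sqrt |lam * (1 - s^2) - (m:ℝ)^2 * s^2| := by
    refine Real.le_sqrt_of_sq_le (le_trans ?_ hQ)
    rw [mul_pow, Real.sq_sqrt (by positivity), div_pow, mul_pow, div_pow, mul_pow]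
    have : (0.968:ℝ)^2 ≤ c^2 := pow_le_pow_left₀ (by norm_num) hc1 2
    refine mul_le_mul_of_nonneg_right ?_ (by positivity)
    rw [mul_div_assoc', mul_div_assoc']
    refine div_le_div_of_nonneg_right ?_ (sq_nonneg k)
    have := mul_le_mul_of_nonneg_left this (sq_nonneg (i:ℝ))
    linarith
  have hL : Real.sqrt ((n:ℝ) * (n + 1)) ≤ 1.4143 * (i * (i / k)) := by
    have e1 : (m:ℝ) ≤ i * (i / k) := by
      rw [← mul_div_assoc, le_div_iff₀ (by linarith)]; linarith
    have e2 : Real.sqrt ((n:ℝ) * (n + 1)) ≤ 1.4143 * m := by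
      have := pow_le_pow_left₀ (by linarith) him' 2
      rw [Real.sqrt_le_left (by positivity), mul_pow]
      linarith [sq_nonneg (m:ℝ)]
    linarith
  have hsp : 0 < Real.sqrt (d * q) := Real.sqrt_pos.2 (by positivity)
  rw [← mul_div_assoc, le_div_iff₀ hsp]
  have hik : 0 < (i:ℝ) / k := by positivity
  have e1 := mul_le_mul_of_nonneg_right hsq (sq_nonneg (tY n m x))
  have e2 : (i / k) * (tY n m x ^ 2 * Real.sqrt (d * q)) ≤ (i / k) * (i * 220) := by
    have e3 : 0 < (i:ℝ) * (i / k) := by positivity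
    linarith
  exact le_of_mul_le_mul_left e2 hik

end NearEquator

/-- The odd number `2 (n - m) + 1` attached to the pair `(n, m)`. -/
def pairGap (p : ℕ × ℕ) : ℕ := 2 * (p.1 - p.2) + 1

lemma cast_pairGap {p : ℕ × ℕ} (h : p.2 ≤ p.1) :
    (pairGap p : ℝ) = 2 * ((p.1:ℝ) - p.2) + 1 := by
  rw [pairGap]; push_cast [Nat.cast_sub h]; ring

section GapSums

variable {i : ℕ} {S : Finset (ℕ × ℕ)}

lemma card_pairGap_le (hS : ∀ p ∈ S, InWindow i p.1 p.2 ∧ i ≤ p.2) {k : ℕ}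
    (hk : ∀ p ∈ S, pairGap p = k) : (S.card : ℝ) ≤ 3 * i / k := by
  rcases S.eq_empty_or_nonempty with rfl | hne
  · simp; positivity
  have hcard : (S.image Prod.snd).card = S.card := Finset.card_image_of_injOn (by
    intro p hp q hq hpq
    refine Prod.ext ?_ hpq
    have := (hS p hp).1
    rw [hpq] at this
    exact this.unique (hS q hq).1)
  set T := S.image Prod.snd with hT
  have hTne : T.Nonempty := hne.image _
  set b := T.min' hTne with hb
  obtain ⟨q, hq, hqb⟩ := Finset.mem_image.1 (T.min'_mem hTne)
  rw [← hb] at hqb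
  obtain ⟨e, hk1, hki, -, -⟩ := gap_facts (hS q hq).1 (hS q hq).2
    (cast_pairGap (hS q hq).1.le)
  rw [hk q hq] at e hk1 hki
  have hsub : T ⊆ Finset.Icc b (b + ⌊(2 * (i:ℝ) - 1) / k⌋₊) := by
    intro m hm
    have hbm : b ≤ m := T.min'_le m hm
    obtain ⟨p, hp, rfl⟩ := Finset.mem_image.1 hm
    obtain ⟨e', -⟩ := gap_facts (hS p hp).1 (hS p hp).2 (cast_pairGap (hS p hp).1.le)
    rw [hk p hp] at e'
    refine Finset.mem_Icc.2 ⟨hbm, ?_⟩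
    have : p.2 - b ≤ ⌊(2 * (i:ℝ) - 1) / k⌋₊ := by
      refine Nat.le_floor ?_
      rw [Nat.cast_sub hbm, le_div_iff₀ (by linarith)]
      have h1 := (hS q hq).1.lt_eigen
      have h2 := (hS p hp).1.eigen_le
      rw [← hqb]
      linarith
    omega
  have h1 := Finset.card_le_card hsub
  rw [Nat.card_Icc] at h1
  have h2 : T.card ≤ ⌊(2 * (i:ℝ) - 1) / k⌋₊ + 1 := by omega
  have h3 : (T.card : ℝ) ≤ ⌊(2 * (i:ℝ) - 1) / k⌋₊ + 1 := by exact_mod_cast h2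
  have hi := (hS q hq).1.one_le_window
  have h4 := Nat.floor_le (div_nonneg (by linarith : (0:ℝ) ≤ 2 * i - 1) (by linarith : (0:ℝ) ≤ k))
  rw [← hcard]
  refine h3.trans ((add_le_add_left h4 1).trans ?_)
  rw [div_add_one (by linarith)]
  exact div_le_div_of_nonneg_right (by linarith) (by linarith)

lemma sum_pairGap_le (hS : ∀ p ∈ S, InWindow i p.1 p.2 ∧ i ≤ p.2) {y : ℕ × ℕ → ℝ} {f : ℕ → ℝ}
    (hf : ∀ k, 0 ≤ f k) (h : ∀ p ∈ S, y p ≤ f (pairGap p)) :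
    ∑ p ∈ S, y p ≤ ∑ k ∈ S.image pairGap, 3 * i / k * f k := by
  rw [← Finset.sum_fiberwise_of_maps_to (g := pairGap) (t := S.image pairGap)
    (fun p hp => Finset.mem_image_of_mem _ hp)]
  refine Finset.sum_le_sum fun k _ => ?_
  refine (Finset.sum_le_card_nsmul _ _ (f k) fun p hp => ?_).trans ?_
  · obtain ⟨h1, h2⟩ := Finset.mem_filter.1 hp
    rw [← h2]; exact h p h1
  · rw [nsmul_eq_mul]
    exact mul_le_mul_of_nonneg_right (card_pairGap_le
      (fun p hp => hS p (Finset.mem_filter.1 hp).1) fun p hp => (Finset.mem_filter.1 hp).2) (hf k)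

lemma mem_image_pairGap {k : ℕ} (hk : k ∈ S.image pairGap) : ∃ p ∈ S, pairGap p = k ∧ 1 ≤ k := by
  obtain ⟨p, hp, rfl⟩ := Finset.mem_image.1 hk
  exact ⟨p, hp, rfl, by simp [pairGap]⟩

variable {a K P : ℝ} {W : ℕ → ℝ}

lemma weight_le_of_window {p : ℕ × ℕ} (hp : InWindow i p.1 p.2) (hip : i ≤ p.2)
    (ha0 : 0 ≤ a) (ha1 : a < 1) (hP : 1 ≤ P) (hK : 0 < K) (hKP : 3/5 * (i:ℝ)^2 ≤ K * P) :
    5 * (1 + K / p.2) ^ a ≤ 34 * (K * P / (i:ℝ)^2) * (max 1 ((pairGap p : ℝ) / P)) ^ a := by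
  obtain ⟨-, hk1, -, -, hkm5⟩ := gap_facts hp hip (cast_pairGap hp.le)
  have hi := hp.one_le_window
  have hm := hp.one_le_real
  set k : ℝ := (pairGap p : ℝ) with hk
  set R := K * P / (i:ℝ)^2 with hR
  set u := max 1 (k / P) with hu
  have hi2 : 0 < (i:ℝ)^2 := by positivity
  have hR1 : 3/5 ≤ R := by rw [hR, le_div_iff₀ hi2]; exact hKP
  have hu1 : 1 ≤ u := le_max_left _ _
  have hkP : k ≤ u * P := by rw [← div_le_iff₀ (by linarith)]; exact le_max_right _ _
  have e1 : K / p.2 ≤ 5 * (R * u) := by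
    have e2 : 5 * (R * u) = 5 * (K * (u * P)) / (i:ℝ)^2 := by rw [hR]; field_simp
    rw [e2, div_le_div_iff₀ (by linarith) hi2]
    have e3 := mul_le_mul_of_nonneg_left hkm5 hK.le
    have e4 := mul_le_mul_of_nonneg_left hkP (by positivity : 0 ≤ 5 * (K * p.2))
    linarith
  have e2 : 1 ≤ 5/3 * (R * u) := by nlinarith
  have e3 : (1 + K / p.2) ^ a ≤ (20/3 * R) ^ a * u ^ a := by
    rw [← Real.mul_rpow (by linarith) (by linarith)]
    exact Real.rpow_le_rpow (by positivity) (by linarith) ha0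
  have e4 : (20/3 * R) ^ a ≤ 20/3 * R := by
    have := Real.rpow_le_rpow_of_exponent_le (by linarith : 1 ≤ 20/3 * R) ha1.le
    rwa [Real.rpow_one] at this
  have hua : 0 ≤ u ^ a := by positivity
  have e5 := mul_le_mul_of_nonneg_right e4 hua
  have e6 : 0 ≤ R * u ^ a := by positivity
  linarith

lemma weighted_sum_le (hS : ∀ p ∈ S, InWindow i p.1 p.2 ∧ i ≤ p.2)
    (ha0 : 0 ≤ a) (ha1 : a < 1) (hP : 1 ≤ P) (hK : 0 < K) (hKP : 3/5 * (i:ℝ)^2 ≤ K * P)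
    (hW : ∀ m, 1 ≤ m → W m ≤ 5 * (1 + K / m) ^ a) {y : ℕ × ℕ → ℝ} (hy : ∀ p, 0 ≤ y p)
    {V : ℕ → ℝ} (hV : ∀ k, 0 ≤ V k) (hyV : ∀ p ∈ S, y p ≤ i * V (pairGap p)) {B : ℝ}
    (hB : ∑ k ∈ S.image pairGap, (k:ℝ)⁻¹ * V k * (max 1 ((k:ℝ) / P)) ^ a ≤ B / P) :
    ∑ p ∈ S, W p.2 * y p ≤ 102 * B * K := by
  rcases S.eq_empty_or_nonempty with rfl | ⟨q, hq⟩
  · simp at hB ⊢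
    have : 0 ≤ B := by
      by_contra hcon
      push Not at hcon
      have := div_neg_of_neg_of_pos hcon (by linarith : 0 < P)
      linarith
    positivity
  have hi := (hS q hq).1.one_le_window
  refine (sum_pairGap_le hS (f := fun k => 34 * (K * P / (i:ℝ)^2) * (max 1 ((k : ℝ) / P)) ^ a *
    (i * V k)) (fun k => ?_) fun p hp => ?_).trans ?_
  · have := hV k
    positivity
  · refine mul_le_mul ((hW _ (hS p hp).1.one_le).trans
      (weight_le_of_window (hS p hp).1 (hS p hp).2 ha0 ha1 hP hK hKP)) (hyV p hp) (hy p) ?_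
    positivity
  · have e : ∀ k ∈ S.image pairGap, 3 * (i:ℝ) / k *
        (34 * (K * P / (i:ℝ)^2) * (max 1 ((k : ℝ) / P)) ^ a * (i * V k)) =
        102 * (K * P) * ((k:ℝ)⁻¹ * V k * (max 1 ((k:ℝ) / P)) ^ a) := by
      intro k hk
      obtain ⟨-, -, -, hk1⟩ := mem_image_pairGap hk
      have : (0:ℝ) < k := by exact_mod_cast hk1
      field_simp; ring
    rw [Finset.sum_congr rfl e, ← Finset.mul_sum]
    refine (mul_le_mul_of_nonneg_left hB (by positivity)).trans (le_of_eq ?_)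
    field_simp

end GapSums

section Zones

variable {S : Finset ℕ} {a D P r : ℝ}

lemma zone_small (hP : 1 ≤ P) (hDP : P = max 1 D) (hS : ∀ k ∈ S, 1 ≤ k ∧ 10 * (k:ℝ) ≤ D) :
    ∑ k ∈ S, (k:ℝ)⁻¹ * (2500 * (k:ℝ)^2 / D^3) * (max 1 ((k:ℝ) / P)) ^ a ≤ 25 / P := by
  rcases S.eq_empty_or_nonempty with rfl | ⟨q, hq⟩
  · rw [Finset.sum_empty]; exact div_nonneg (by norm_num) (by linarith)
  have hD : 10 ≤ D := by
    obtain ⟨h1, h2⟩ := hS q hq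
    have : (1:ℝ) ≤ q := by exact_mod_cast h1
    linarith
  have hPD : P = D := by rw [hDP]; exact max_eq_right (by linarith)
  have hcard : (S.card : ℝ) ≤ D / 10 := by
    have hsub : S ⊆ Finset.Icc 1 ⌊D / 10⌋₊ := fun k hk =>
      Finset.mem_Icc.2 ⟨(hS k hk).1, Nat.le_floor (by linarith [(hS k hk).2])⟩
    have := Finset.card_le_card hsub
    rw [Nat.card_Icc, Nat.add_sub_cancel] at this
    exact (Nat.cast_le.2 this).trans (Nat.floor_le (by linarith))
  have hterm : ∀ k ∈ S, (k:ℝ)⁻¹ * (2500 * (k:ℝ)^2 / D^3) * (max 1 ((k:ℝ) / P)) ^ a ≤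
      250 / D^2 := by
    intro k hk
    obtain ⟨h1, h2⟩ := hS k hk
    have hk0 : (0:ℝ) < k := by exact_mod_cast h1
    have : max 1 ((k:ℝ) / P) = 1 := max_eq_left (by
      rw [hPD, div_le_one (by linarith)]; linarith)
    rw [this, Real.one_rpow, mul_one]
    have e : (k:ℝ)⁻¹ * (2500 * (k:ℝ)^2 / D^3) = 2500 * k / D^3 := by field_simp
    rw [e, div_le_div_iff₀ (by positivity) (by positivity)]
    have : 0 ≤ D^2 := by positivity
    nlinarith
  refine (Finset.sum_le_card_nsmul _ _ _ hterm).trans ?_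
  rw [nsmul_eq_mul, hPD]
  refine (mul_le_mul_of_nonneg_right hcard (by positivity)).trans (le_of_eq ?_)
  field_simp; norm_num

lemma middle_factor_le (ha1 : a < 1) (hP : 1 ≤ P) (hDP : P = max 1 D)
    (hr : r ≤ 1.5 * D) {k : ℕ} (hk : 1 ≤ k ∧ D < 10 * (k:ℝ) ∧ (k:ℝ) ≤ 4 * r) :
    (k:ℝ)⁻¹ * (max 1 ((k:ℝ) / P)) ^ a ≤ 60 / P := by
  obtain ⟨h1, h2, h3⟩ := hk
  have hk0 : (1:ℝ) ≤ k := by exact_mod_cast h1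
  have e1 : (k:ℝ)⁻¹ ≤ 10 / P := by
    rw [inv_le_comm₀ (by linarith) (by positivity), inv_div, div_le_iff₀ (by norm_num), hDP]
    exact max_le (by linarith) (by linarith)
  have hDP' : D ≤ P := by rw [hDP]; exact le_max_right _ _
  have e2 : max 1 ((k:ℝ) / P) ≤ 6 := max_le (by norm_num) (by
    rw [div_le_iff₀ (by linarith)]; linarith)
  have e3 : (max 1 ((k:ℝ) / P)) ^ a ≤ 6 := by
    have := Real.rpow_le_rpow_of_exponent_le (le_max_left 1 ((k:ℝ) / P)) ha1.le
    rw [Real.rpow_one] at this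
    exact this.trans e2
  refine (mul_le_mul e1 e3 (by positivity) (by positivity)).trans (le_of_eq ?_)
  ring

lemma zone_near (ha1 : a < 1) (hP : 1 ≤ P) (hDP : P = max 1 D) (hr : r ≤ 1.5 * D)
    (hS : ∀ k ∈ S, (1 ≤ k ∧ D < 10 * (k:ℝ) ∧ (k:ℝ) ≤ 4 * r) ∧ |(k:ℝ) - r| < (5:ℕ)) :
    ∑ k ∈ S, (k:ℝ)⁻¹ * 1 * (max 1 ((k:ℝ) / P)) ^ a ≤ 600 / P := by
  have hc := card_abs_sub_lt_le fun k hk => (hS k hk).2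
  refine (Finset.sum_le_card_nsmul _ _ (60 / P) fun k hk => ?_).trans ?_
  · rw [mul_one]; exact middle_factor_le ha1 hP hDP hr (hS k hk).1
  · rw [nsmul_eq_mul]
    refine (mul_le_mul_of_nonneg_right hc (by positivity)).trans (le_of_eq ?_)
    push_cast; ring

lemma zone_middle (ha1 : a < 1) (hP : 1 ≤ P) (hDP : P = max 1 D) (hr : r ≤ 1.5 * D)
    (hS : ∀ k ∈ S, (1 ≤ k ∧ D < 10 * (k:ℝ) ∧ (k:ℝ) ≤ 4 * r) ∧ 5 ≤ |(k:ℝ) - r|) :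
    ∑ k ∈ S, (k:ℝ)⁻¹ * (220 / Real.sqrt (|(k:ℝ) - r| * (r / 15))) * (max 1 ((k:ℝ) / P)) ^ a ≤
      360000 / P := by
  rcases S.eq_empty_or_nonempty with rfl | ⟨q, hq⟩
  · rw [Finset.sum_empty]; exact div_nonneg (by norm_num) (by linarith)
  have hr0 : 0 < r := by
    obtain ⟨⟨h1, -, h2⟩, -⟩ := hS q hq
    have : (1:ℝ) ≤ q := by exact_mod_cast h1
    linarith
  have hsum := sum_inv_sqrt_abs_le (T := S) (c := r) (R := 3 * r) hr0.le (by linarith) (by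
    intro k hk
    obtain ⟨⟨h1, -, h2⟩, h3⟩ := hS k hk
    have : (1:ℝ) ≤ k := by exact_mod_cast h1
    exact ⟨h1, by linarith, abs_le.2 ⟨by linarith, by linarith⟩⟩)
  have hsr : 0 < Real.sqrt r := Real.sqrt_pos.2 hr0
  have hterm : ∀ k ∈ S, (k:ℝ)⁻¹ * (220 / Real.sqrt (|(k:ℝ) - r| * (r / 15))) *
      (max 1 ((k:ℝ) / P)) ^ a ≤
      60 / P * (220 * Real.sqrt 15 / Real.sqrt r) * (1 / Real.sqrt |(k:ℝ) - r|) := by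
    intro k hk
    have e1 := middle_factor_le ha1 hP hDP hr (hS k hk).1
    have e2 : 220 / Real.sqrt (|(k:ℝ) - r| * (r / 15)) =
        220 * Real.sqrt 15 / Real.sqrt r * (1 / Real.sqrt |(k:ℝ) - r|) := by
      rw [Real.sqrt_mul (abs_nonneg _), Real.sqrt_div hr0.le]
      have : 0 < Real.sqrt |(k:ℝ) - r| := Real.sqrt_pos.2 (by linarith [(hS k hk).2])
      field_simp
    rw [e2, mul_right_comm, mul_assoc (60 / P)]
    exact mul_le_mul_of_nonneg_right e1 (by positivity)
  refine (Finset.sum_le_sum hterm).trans ?_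
  rw [← Finset.mul_sum]
  refine (mul_le_mul_of_nonneg_left hsum (by positivity)).trans ?_
  have h45 : Real.sqrt 15 * Real.sqrt 3 ≤ 6.71 := by
    rw [← Real.sqrt_mul (by norm_num), Real.sqrt_le_left (by norm_num)]; norm_num
  rw [Real.sqrt_mul (by norm_num)]
  have e : 60 / P * (220 * Real.sqrt 15 / Real.sqrt r) * (4 * (Real.sqrt 3 * Real.sqrt r)) =
      52800 * (Real.sqrt 15 * Real.sqrt 3) / P := by field_simp; norm_num
  rw [e]
  exact div_le_div_of_nonneg_right (by linarith) (by linarith)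

lemma zone_large (ha0 : 0 ≤ a) (ha1 : a < 1) (hP : 1 ≤ P) (hDP : P = max 1 D)
    (hr : 0.86 * D ≤ r) (hS : ∀ k ∈ S, 1 ≤ k ∧ 4 * r < (k:ℝ)) (hD : 0 ≤ D) :
    ∑ k ∈ S, (k:ℝ)⁻¹ * (300 / k) * (max 1 ((k:ℝ) / P)) ^ a ≤ 1200 / (1 - a) / P := by
  have hP0 : 0 < P := by linarith
  have hkP : ∀ k ∈ S, P ≤ (k:ℝ) := by
    intro k hk
    obtain ⟨h1, h2⟩ := hS k hk
    rw [hDP]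
    exact max_le (by exact_mod_cast h1) (by linarith)
  have hterm : ∀ k ∈ S, (k:ℝ)⁻¹ * (300 / k) * (max 1 ((k:ℝ) / P)) ^ a =
      300 * P ^ (-a) * (k:ℝ) ^ (-1 - (1 - a)) := by
    intro k hk
    have hk0 : (0:ℝ) < k := hP0.trans_le (hkP k hk)
    rw [max_eq_right (by rw [le_div_iff₀ hP0]; linarith [hkP k hk]),
      Real.div_rpow hk0.le hP0.le, Real.rpow_neg hP0.le,
      show (-1 - (1 - a)) = a + (-1) + (-1) by ring, Real.rpow_add hk0, Real.rpow_add hk0,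
      Real.rpow_neg_one]
    have : 0 < P ^ a := by positivity
    field_simp
  rw [Finset.sum_congr rfl hterm, ← Finset.mul_sum]
  have := sum_rpow_neg_le (T := S) (b := 1 - a) (t := P) (by linarith) (by linarith) hP hkP
  refine (mul_le_mul_of_nonneg_left this (by positivity)).trans (le_of_eq ?_)
  have e : P ^ (-a) * P ^ (-(1 - a)) = P⁻¹ := by
    rw [← Real.rpow_add hP0, ← Real.rpow_neg_one]; congr 1; ring
  calc 300 * P ^ (-a) * (4 / (1 - a) * P ^ (-(1 - a))) =
      1200 / (1 - a) * (P ^ (-a) * P ^ (-(1 - a))) := by ring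
    _ = _ := by rw [e]; rfl

end Zones

section WeightedWindow

variable {i : ℕ} {S : Finset (ℕ × ℕ)} {x a K : ℝ} {W : ℕ → ℝ}

lemma weighted_sum_of_lt_window (hS : ∀ p ∈ S, InWindow i p.1 p.2 ∧ p.2 ≤ i) (hx4 : |x| ≤ 1/4)
    (ha0 : 0 ≤ a) (ha1 : a < 1) (hK : 3/5 * (i:ℝ) ≤ K)
    (hW : ∀ m, 1 ≤ m → W m ≤ 5 * (1 + K / m) ^ a) :
    ∑ p ∈ S, W p.2 * tY p.1 p.2 x ^ 2 ≤ 6000 / (1 - a) * K := by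
  have ha1' : 0 < 1 - a := by linarith
  have hK0 : 0 ≤ K := le_trans (by positivity) hK
  refine (sum_snd_le (fun p hp => (hS p hp).1)
    (f := fun m => 260 * (40/3 * K ^ a) * (m:ℝ) ^ (-a)) fun p hp => ?_).trans ?_
  · obtain ⟨hw, hmi⟩ := hS p hp
    have hm := hw.one_le_real
    have hmi' : (p.2:ℝ) ≤ i := by exact_mod_cast hmi
    have h1 : 1 + K / p.2 ≤ 8/3 * (K / p.2) := by
      have : 3/5 ≤ K / p.2 := by rw [le_div_iff₀ (by linarith)]; linarith
      linarith
    have h2 : (1 + K / p.2) ^ a ≤ 8/3 * (K ^ a * (p.2:ℝ) ^ (-a)) := by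
      refine (Real.rpow_le_rpow (by positivity) h1 ha0).trans ?_
      rw [Real.mul_rpow (by norm_num) (by positivity), Real.div_rpow hK0 (by linarith),
        Real.rpow_neg (by linarith), ← div_eq_mul_inv]
      refine mul_le_mul_of_nonneg_right ?_ (by positivity)
      have := Real.rpow_le_rpow_of_exponent_le (by norm_num : (1:ℝ) ≤ 8/3) ha1.le
      rwa [Real.rpow_one] at this
    have h3 := tY_sq_le_of_lt_window hw hmi hx4
    have h4 := hW p.2 hw.one_le
    have h5 : W p.2 ≤ 40/3 * (K ^ a * (p.2:ℝ) ^ (-a)) := by linarith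
    have := mul_le_mul h5 h3 (sq_nonneg _) (by positivity)
    linarith
  · rw [← Finset.mul_sum]
    have hs := sum_rpow_neg_Icc_le (T := S.image Prod.snd) (i := i) ha0 ha1 (by
      intro m hm
      obtain ⟨p, hp, rfl⟩ := Finset.mem_image.1 hm
      exact ⟨(hS p hp).1.one_le, (hS p hp).2⟩)
    have h1 : (i:ℝ) ^ (1 - a) ≤ 5/3 * K ^ (1 - a) := by
      have h2 : (i:ℝ) ≤ 5/3 * K := by linarith
      refine (Real.rpow_le_rpow (by positivity) h2 ha1'.le).trans ?_
      rw [Real.mul_rpow (by norm_num) hK0]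
      refine mul_le_mul_of_nonneg_right ?_ (by positivity)
      have := Real.rpow_le_rpow_of_exponent_le (by norm_num : (1:ℝ) ≤ 5/3)
        (by linarith : 1 - a ≤ 1)
      rwa [Real.rpow_one] at this
    have hs' := hs.trans (div_le_div_of_nonneg_right h1 ha1'.le)
    refine (mul_le_mul_of_nonneg_left hs' (by positivity)).trans ?_
    have e : K ^ a * K ^ (1 - a) = K := by
      rcases hK0.eq_or_lt with h | h
      · rw [← h, Real.zero_rpow ha1'.ne', mul_zero]
      · rw [← Real.rpow_add h, add_sub_cancel, Real.rpow_one]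
    have e2 : 260 * (40/3 * K ^ a) * (5/3 * K ^ (1 - a) / (1 - a)) =
        (260 * (40/3) * (5/3)) / (1 - a) * (K ^ a * K ^ (1 - a)) := by ring
    rw [e2, e]
    gcongr
    norm_num

lemma weighted_sum_of_window_le (hS : ∀ p ∈ S, InWindow i p.1 p.2 ∧ i ≤ p.2) (hx4 : |x| ≤ 1/4)
    (ha0 : 0 ≤ a) (ha1 : a < 1) (hK : 0 < K) (hKP : 3/5 * (i:ℝ)^2 ≤ K * max 1 (i * |x|))
    (hW : ∀ m, 1 ≤ m → W m ≤ 5 * (1 + K / m) ^ a) :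
    ∑ p ∈ S, W p.2 * tY p.1 p.2 x ^ 2 ≤ 37000000 / (1 - a) * K := by
  classical
  rcases S.eq_empty_or_nonempty with rfl | ⟨q, hq⟩
  · have : 0 < 1 - a := by linarith
    rw [Finset.sum_empty]; positivity
  have hi := (hS q hq).1.one_le_window
  have hx : |x| ≤ 1 := hx4.trans (by norm_num)
  set D := (i:ℝ) * |x| with hD
  have hD0 : 0 ≤ D := by positivity
  set P := max 1 D with hPdef
  have hP : 1 ≤ P := le_max_left _ _
  obtain ⟨r, hr1, hr2, hr⟩ := exists_gap_root hi (abs_nonneg x) hx4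
  have hr0 : 0 ≤ r := le_trans (by positivity) hr1
  have hyn : ∀ p : ℕ × ℕ, 0 ≤ tY p.1 p.2 x ^ 2 := fun p => sq_nonneg _
  set φ1 : ℕ × ℕ → Prop := fun p => 10 * (pairGap p : ℝ) ≤ D
  set φ2 : ℕ × ℕ → Prop := fun p => 4 * r < (pairGap p : ℝ)
  set φ3 : ℕ × ℕ → Prop := fun p => |(pairGap p : ℝ) - r| < (5:ℕ)
  set S1 := S.filter (fun p => ¬ φ1 p) with hS1
  set S2 := S1.filter (fun p => ¬ φ2 p) with hS2
  have b1 : ∑ p ∈ S.filter φ1, W p.2 * tY p.1 p.2 x ^ 2 ≤ 102 * 25 * K := by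
    refine weighted_sum_le (fun p hp => hS p (Finset.mem_filter.1 hp).1) ha0 ha1 hP hK hKP hW hyn
      (V := fun k => 2500 * (k:ℝ)^2 / D^3) (fun k => by positivity) (fun p hp => ?_)
      (zone_small hP rfl ?_)
    · obtain ⟨hp1, hp2⟩ := Finset.mem_filter.1 hp
      exact tY_sq_le_of_small_gap (hS p hp1).1 (hS p hp1).2 (cast_pairGap (hS p hp1).1.le) hx hp2
    · intro k hk
      obtain ⟨p, hp, rfl, hk1⟩ := mem_image_pairGap hk
      exact ⟨hk1, (Finset.mem_filter.1 hp).2⟩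
  have hS1w : ∀ p ∈ S1, InWindow i p.1 p.2 ∧ i ≤ p.2 := fun p hp => hS p (Finset.mem_filter.1 hp).1
  have hS2w : ∀ p ∈ S2, InWindow i p.1 p.2 ∧ i ≤ p.2 :=
    fun p hp => hS1w p (Finset.mem_filter.1 hp).1
  have b2 : ∑ p ∈ S1.filter φ2, W p.2 * tY p.1 p.2 x ^ 2 ≤ 102 * (1200 / (1 - a)) * K := by
    refine weighted_sum_le (fun p hp => hS1w p (Finset.mem_filter.1 hp).1) ha0 ha1 hP hK hKP hW hyn
      (V := fun k => 300 / (k:ℝ)) (fun k => by positivity) (fun p hp => ?_)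
      (zone_large ha0 ha1 hP rfl hr1 ?_ hD0)
    · obtain ⟨hp1, hp2⟩ := Finset.mem_filter.1 hp
      obtain ⟨hw, hip⟩ := hS1w p hp1
      have hg := cast_pairGap hw.le
      obtain ⟨-, hk1, -⟩ := gap_facts hw hip hg
      have hp2' : 4 * r < (pairGap p : ℝ) := hp2
      set k : ℝ := (pairGap p : ℝ)
      rcases lt_or_ge (|k - r|) 5 with h5 | h5
      · refine (tY_sq_le_window hw hip hx).trans ?_
        refine le_mul_of_one_le_right (by linarith) ?_
        rw [le_div_iff₀ (by linarith)]
        linarith [(abs_lt.1 h5).2]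
      · refine (tY_sq_le_off_root hw hip hg hx4 hr0 hr h5 (by linarith) (le_max_right _ _)).trans ?_
        rw [← sq, Real.sqrt_sq (abs_nonneg _)]
        refine mul_le_mul_of_nonneg_left ?_ (by linarith)
        rw [div_le_div_iff₀ (by linarith) (by linarith)]
        linarith [le_abs_self (k - r)]
    · intro k hk
      obtain ⟨p, hp, rfl, hk1⟩ := mem_image_pairGap hk
      exact ⟨hk1, (Finset.mem_filter.1 hp).2⟩
  have hmid : ∀ p ∈ S2, 1 ≤ pairGap p ∧ D < 10 * (pairGap p : ℝ) ∧ (pairGap p : ℝ) ≤ 4 * r := by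
    intro p hp
    obtain ⟨h1, h2⟩ := Finset.mem_filter.1 hp
    exact ⟨by simp [pairGap], not_le.1 (Finset.mem_filter.1 h1).2, not_lt.1 h2⟩
  have b3 : ∑ p ∈ S2.filter φ3, W p.2 * tY p.1 p.2 x ^ 2 ≤ 102 * 600 * K := by
    refine weighted_sum_le (fun p hp => hS2w p (Finset.mem_filter.1 hp).1) ha0 ha1 hP hK hKP hW hyn
      (V := fun _ => 1) (fun k => by positivity) (fun p hp => ?_)
      (zone_near ha1 hP rfl hr2 ?_)
    · obtain ⟨hp1, hp2⟩ := Finset.mem_filter.1 hp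
      rw [mul_one]
      exact tY_sq_le_window (hS2w p hp1).1 (hS2w p hp1).2 hx
    · intro k hk
      obtain ⟨p, hp, rfl, hk1⟩ := mem_image_pairGap hk
      obtain ⟨hp1, hp2⟩ := Finset.mem_filter.1 hp
      exact ⟨hmid p hp1, hp2⟩
  have b4 : ∑ p ∈ S2.filter (fun p => ¬ φ3 p), W p.2 * tY p.1 p.2 x ^ 2 ≤ 102 * 360000 * K := by
    have h5 : ∀ p ∈ S2.filter (fun p => ¬ φ3 p), 5 ≤ |(pairGap p : ℝ) - r| := by
      intro p hp
      have := not_lt.1 (Finset.mem_filter.1 hp).2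
      push_cast at this
      exact this
    refine weighted_sum_le (fun p hp => hS2w p (Finset.mem_filter.1 hp).1) ha0 ha1 hP hK hKP hW hyn
      (V := fun k => 220 / Real.sqrt (|(k:ℝ) - r| * (r / 15))) (fun k => by positivity)
      (fun p hp => ?_) (zone_middle ha1 hP rfl hr2 ?_)
    · have hp1 := (Finset.mem_filter.1 hp).1
      obtain ⟨hw, hip⟩ := hS2w p hp1
      obtain ⟨hk1, hk2, hk3⟩ := hmid p hp1
      have hk1' : (1:ℝ) ≤ pairGap p := by exact_mod_cast hk1
      exact tY_sq_le_off_root hw hip (cast_pairGap hw.le) hx4 hr0 hr (h5 p hp) (by linarith)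
        (le_max_of_le_left (by linarith))
    · intro k hk
      obtain ⟨p, hp, rfl, hk1⟩ := mem_image_pairGap hk
      exact ⟨hmid p (Finset.mem_filter.1 hp).1, h5 p hp⟩
  rw [← Finset.sum_filter_add_sum_filter_not S φ1, ← hS1,
    ← Finset.sum_filter_add_sum_filter_not S1 φ2, ← hS2,
    ← Finset.sum_filter_add_sum_filter_not S2 φ3]
  have ha : 1 ≤ 1 / (1 - a) := by rw [le_div_iff₀ (by linarith)]; linarith
  have hKa : K ≤ 1 / (1 - a) * K := le_mul_of_one_le_left hK.le ha
  have e1 : 102 * (1200 / (1 - a)) * K = 122400 * (1 / (1 - a) * K) := by ring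
  have e2 : 37000000 / (1 - a) * K = 37000000 * (1 / (1 - a) * K) := by ring
  rw [e2]
  rw [e1] at b2
  linarith

/-- The main estimate for the pairs `(n, m)` in one window. -/
lemma weighted_sum_window_le {N M : ℝ} (hS : ∀ p ∈ S, InWindow i p.1 p.2) (hx : |x| ≤ 1)
    (ha0 : 0 ≤ a) (ha1 : a < 1) (hiN : (i:ℝ) ≤ N) (hM : 3/5 ≤ M) (hMx : M * |x| ≤ 1)
    (hNM : 3/5 * N ≤ M ∨ 3/5 ≤ M * |x|)
    (hW : ∀ m, 1 ≤ m → W m ≤ 5 * (1 + N * M / m) ^ a) (hW' : ∀ m, 1 ≤ m → W m ≤ (1 + 2 * M) ^ a) :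
    ∑ p ∈ S, W p.2 * tY p.1 p.2 x ^ 2 ≤ 38000000 / (1 - a) * (N * M) := by
  classical
  have ha : 1 ≤ 1 / (1 - a) := by rw [le_div_iff₀ (by linarith)]; linarith
  rcases S.eq_empty_or_nonempty with rfl | ⟨q, hq⟩
  · rw [Finset.sum_empty]
    have : 0 < 1 - a := by linarith
    have : 0 ≤ N := le_trans (Nat.cast_nonneg i) hiN
    positivity
  have hi := (hS q hq).one_le_window
  have hK : 0 < N * M := mul_pos (by linarith) (by linarith)
  have e2 : 38000000 / (1 - a) * (N * M) = 38000000 * (1 / (1 - a) * (N * M)) := by ring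
  have hKa : N * M ≤ 1 / (1 - a) * (N * M) := le_mul_of_one_le_left hK.le ha
  have hiK : 3/5 * (i:ℝ) ≤ N * M := by nlinarith
  rcases le_total (|x|) (1/4) with hx4 | hx4
  · have hKP : 3/5 * (i:ℝ)^2 ≤ N * M * max 1 (i * |x|) := by
      rcases hNM with h | h
      · have h1 : N * M ≤ N * M * max 1 (i * |x|) :=
          le_mul_of_one_le_right hK.le (le_max_left _ _)
        nlinarith
      · have h1 : N * M * (i * |x|) ≤ N * M * max 1 (i * |x|) :=
          mul_le_mul_of_nonneg_left (le_max_right _ _) hK.le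
        have h2 : N * i * (3/5) ≤ N * i * (M * |x|) :=
          mul_le_mul_of_nonneg_left h (by nlinarith)
        nlinarith
    rw [← Finset.sum_filter_add_sum_filter_not S (fun p => p.2 ≤ i)]
    have b1 := weighted_sum_of_lt_window (S := S.filter (fun p => p.2 ≤ i)) (i := i)
      (fun p hp => ⟨hS p (Finset.mem_filter.1 hp).1, (Finset.mem_filter.1 hp).2⟩) hx4 ha0 ha1 hiK hW
    have b2 := weighted_sum_of_window_le (S := S.filter (fun p => ¬ p.2 ≤ i)) (i := i)
      (fun p hp => ⟨hS p (Finset.mem_filter.1 hp).1, (not_le.1 (Finset.mem_filter.1 hp).2).le⟩)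
      hx4 ha0 ha1 hK hKP hW
    have e1 : 6000 / (1 - a) * (N * M) = 6000 * (1 / (1 - a) * (N * M)) := by ring
    have e3 : 37000000 / (1 - a) * (N * M) = 37000000 * (1 / (1 - a) * (N * M)) := by ring
    rw [e2]
    rw [e1] at b1
    rw [e3] at b2
    linarith
  · have hM4 : M ≤ 4 := by nlinarith
    have hW9 : ∀ m, 1 ≤ m → W m ≤ 9 := by
      intro m hm
      refine (hW' m hm).trans ?_
      have := Real.rpow_le_rpow_of_exponent_le (by linarith : 1 ≤ 1 + 2 * M) ha1.le
      rw [Real.rpow_one] at this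
      linarith
    have b := sum_far_from_equator hS hx hx4
    have : ∑ p ∈ S, W p.2 * tY p.1 p.2 x ^ 2 ≤ 9 * ∑ p ∈ S, tY p.1 p.2 x ^ 2 := by
      rw [Finset.mul_sum]
      exact Finset.sum_le_sum fun p hp =>
        mul_le_mul_of_nonneg_right (hW9 _ (hS p hp).one_le) (sq_nonneg _)
    rw [e2]
    linarith

end WeightedWindow

lemma spt_zero (θ φ : ℝ) : spt θ φ 0 = Real.cos θ * Real.cos φ := rfl

lemma spt_one (θ φ : ℝ) : spt θ φ 1 = Real.cos θ * Real.sin φ := rfl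

lemma spt_two (θ φ : ℝ) : spt θ φ 2 = Real.sin θ := rfl

lemma Ylm_spt {θ : ℝ} (hθ : 0 < Real.cos θ) (φ : ℝ) (n : ℕ) (m : ℤ) :
    Ylm n m (spt θ φ) = Complex.exp (Complex.I * m * φ) * (tY n m (Real.sin θ) : ℂ) := by
  rw [Ylm, spt_two]
  congr 1
  have h1 : ((spt θ φ 0 : ℝ) : ℂ) + ((spt θ φ 1 : ℝ) : ℂ) * Complex.I =
      (Real.cos θ : ℂ) * Complex.exp (φ * Complex.I) := by
    rw [spt_zero, spt_one, Complex.exp_mul_I]; push_cast; ring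
  rw [h1]
  have h2 := Complex.norm_mul_exp_arg_mul_I ((Real.cos θ : ℂ) * Complex.exp (φ * Complex.I))
  rw [norm_mul, Complex.norm_exp_ofReal_mul_I, mul_one, Complex.norm_real,
    Real.norm_of_nonneg hθ.le] at h2
  have h3 := mul_left_cancel₀ (Complex.ofReal_ne_zero.2 hθ.ne') h2
  have e : ∀ z : ℂ, Complex.exp (Complex.I * m * z) = Complex.exp (z * Complex.I) ^ m := by
    intro z
    rw [← Complex.exp_int_mul]; congr 1; ring
  rw [e, e, h3]

lemma norm_Ylm_sq (n : ℕ) (m : ℤ) (z : E3) : ‖Ylm n m z‖ ^ 2 = tY n m (z 2) ^ 2 := by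
  rw [Ylm, norm_mul, Complex.norm_real, mul_pow, Real.norm_eq_abs, sq_abs]
  have : Complex.I * (m:ℂ) * (Complex.arg ((z 0 : ℂ) + (z 1 : ℂ) * Complex.I) : ℂ) =
      ((m * Complex.arg ((z 0 : ℂ) + (z 1 : ℂ) * Complex.I) : ℝ) : ℂ) * Complex.I := by
    push_cast; ring
  rw [this, Complex.norm_exp_ofReal_mul_I, one_pow, one_mul]

lemma tY_eq_sign_mul {n : ℕ} {m : ℤ} (hm : m.natAbs ≤ n) :
    ∃ e : ℝ, |e| = 1 ∧ ∀ x, tY n m x = e * tY n m.natAbs x := by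
  rcases Int.natAbs_eq m with h | h
  · exact ⟨1, abs_one, fun x => by rw [← h, one_mul]⟩
  · refine ⟨(-1)^m.natAbs, by simp, fun x => ?_⟩
    conv_lhs => rw [h]
    exact tY_neg n m.natAbs hm x

lemma tY_natAbs_sq {n : ℕ} {m : ℤ} (hm : m.natAbs ≤ n) (x : ℝ) :
    tY n m x ^ 2 = tY n m.natAbs x ^ 2 := by
  obtain ⟨e, he, h⟩ := tY_eq_sign_mul hm
  rw [h, mul_pow, ← sq_abs e, he, one_pow, one_mul]

lemma continuous_tY {n : ℕ} {m : ℤ} (hm : m.natAbs ≤ n) : Continuous (tY n m) := by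
  obtain ⟨e, -, h⟩ := tY_eq_sign_mul hm
  have : tY n m = fun x => e * (Real.sqrt (1 - x^2) ^ m.natAbs * (harmPoly n m.natAbs).eval x) := by
    funext x
    rw [h, tY_natCast n m.natAbs hm]
  rw [this]
  exact continuous_const.mul ((Continuous.pow (by fun_prop) _).mul (Polynomial.continuous _))

lemma integral_exp_int_mul (k : ℤ) :
    ∫ φ in (0:ℝ)..(2 * Real.pi), Complex.exp (Complex.I * k * φ) =
      if k = 0 then (2 * Real.pi : ℂ) else 0 := by
  split_ifs with hk
  · simp [hk]
  · have hc : Complex.I * (k:ℂ) ≠ 0 := mul_ne_zero Complex.I_ne_zero (Int.cast_ne_zero.2 hk)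
    rw [integral_exp_mul_complex hc]
    have : Complex.I * (k:ℂ) * ((2 * Real.pi : ℝ) : ℂ) = k * (2 * Real.pi * Complex.I) := by
      push_cast; ring
    rw [this, Complex.exp_int_mul_two_pi_mul_I]
    simp

lemma integral_norm_trig_sq (I : Finset ℤ) (A : ℤ → ℂ) :
    ∫ φ in (0:ℝ)..(2 * Real.pi), ‖∑ m ∈ I, A m * Complex.exp (Complex.I * m * φ)‖ ^ 2 =
      2 * Real.pi * ∑ m ∈ I, ‖A m‖ ^ 2 := by
  have hexp : ∀ φ : ℝ, ((‖∑ m ∈ I, A m * Complex.exp (Complex.I * m * φ)‖ ^ 2 : ℝ) : ℂ) =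
      ∑ m ∈ I, ∑ k ∈ I, A m * (starRingEnd ℂ) (A k) *
        Complex.exp (Complex.I * ((m - k : ℤ) : ℂ) * φ) := by
    intro φ
    rw [Complex.ofReal_pow, ← Complex.mul_conj', map_sum, Finset.sum_mul_sum]
    refine Finset.sum_congr rfl fun m _ => Finset.sum_congr rfl fun k _ => ?_
    rw [map_mul, ← Complex.exp_conj, mul_mul_mul_comm, ← Complex.exp_add]
    congr 2
    simp
    ring
  have hint : ∀ m k : ℤ, IntervalIntegrable (fun φ : ℝ => A m * (starRingEnd ℂ) (A k) *
        Complex.exp (Complex.I * ((m - k : ℤ) : ℂ) * φ)) volume 0 (2 * Real.pi) := fun m k =>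
    Continuous.intervalIntegrable (by fun_prop) _ _
  apply Complex.ofReal_injective
  rw [← intervalIntegral.integral_ofReal]
  simp_rw [hexp]
  have hint2 : ∀ m ∈ I, IntervalIntegrable (fun φ : ℝ => ∑ k ∈ I, A m * (starRingEnd ℂ) (A k) *
        Complex.exp (Complex.I * ((m - k : ℤ) : ℂ) * φ)) volume 0 (2 * Real.pi) := fun m _ =>
    Continuous.intervalIntegrable (by fun_prop) _ _
  rw [intervalIntegral.integral_finsetSum hint2]
  simp_rw [intervalIntegral.integral_finsetSum fun k _ => hint _ k,
    intervalIntegral.integral_const_mul, integral_exp_int_mul, sub_eq_zero]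
  rw [Complex.ofReal_mul, Complex.ofReal_sum, Finset.mul_sum]
  refine Finset.sum_congr rfl fun m hm => ?_
  simp_rw [mul_ite, mul_zero]
  rw [Finset.sum_ite_eq, if_pos hm, Complex.mul_conj']
  push_cast; ring

lemma lintegral_norm_trig_sq (I : Finset ℤ) (A : ℤ → ℂ) :
    ∫⁻ φ in Ico (0:ℝ) (2 * Real.pi),
        ENNReal.ofReal (‖∑ m ∈ I, A m * Complex.exp (Complex.I * m * φ)‖ ^ 2) =
      ENNReal.ofReal (2 * Real.pi * ∑ m ∈ I, ‖A m‖ ^ 2) := by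
  have hc : Continuous fun φ : ℝ => ‖∑ m ∈ I, A m * Complex.exp (Complex.I * m * φ)‖ ^ 2 := by
    fun_prop
  rw [restrict_Ico_eq_restrict_Ioc, ← integral_norm_trig_sq,
    intervalIntegral.integral_of_le (by positivity),
    ofReal_integral_eq_lintegral_ofReal]
  · exact (hc.intervalIntegrable 0 (2 * Real.pi)).1
  · exact Filter.Eventually.of_forall fun _ => by positivity

lemma lintegral_sphereMeasure_le (g : E3 → ℝ≥0∞) :
    ∫⁻ z, g z ∂sphereMeasure ≤ ∫⁻ θ in Ioc (-(Real.pi/2)) (Real.pi/2),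
      ∫⁻ φ in Ico (0:ℝ) (2 * Real.pi), ENNReal.ofReal (Real.cos θ) * g (spt θ φ) := by
  refine (lintegral_map_le _ _).trans ?_
  refine (lintegral_withDensity_le_lintegral_mul _ (by fun_prop) _).trans ?_
  rw [Measure.volume_eq_prod, ← Measure.prod_restrict]
  exact lintegral_prod_le _

/-- A bound for the weighted norm of the functions of angular frequency `m`. -/
def modeWeight (a N M : ℝ) (m : ℕ) : ℝ :=
  if m = 0 then (1 + 2 * M) ^ a else min (5 * (1 + N * M / m) ^ a) ((1 + 2 * M) ^ a)

lemma modeWeight_le (a N M : ℝ) (m : ℕ) : modeWeight a N M m ≤ (1 + 2 * M) ^ a := by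
  rw [modeWeight]; split_ifs
  · exact le_rfl
  · exact min_le_right _ _

lemma modeWeight_le_five_mul (a N M : ℝ) {m : ℕ} (hm : 1 ≤ m) :
    modeWeight a N M m ≤ 5 * (1 + N * M / m) ^ a := by
  rw [modeWeight, if_neg (by omega)]
  exact min_le_left _ _

lemma modeWeight_nonneg {a N M : ℝ} (hN : 0 ≤ N) (hM : 0 ≤ M) (m : ℕ) :
    0 ≤ modeWeight a N M m := by
  rw [modeWeight]; split_ifs
  · positivity
  · exact le_min (by positivity) (by positivity)

lemma lintegral_mode_le {s : Finset ℕ} {m : ℤ} (hs : ∀ n ∈ s, m.natAbs ≤ n) (c : ℕ → ℂ)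
    {a μ N : ℝ} (ha0 : 0 ≤ a) (ha2 : a ≤ 2) (hμ : 0 < μ) (hN : 0 ≤ N)
    (hsN : ∀ n ∈ s, eigenL n m ≤ N^2) :
    ∫⁻ t in Ioc (-(Real.pi/2)) (Real.pi/2), ENNReal.ofReal ((1 + |t| / μ) ^ a *
        ‖∑ n ∈ s, c n * (tY n m (Real.sin t) : ℂ)‖ ^ 2 * Real.cos t) ≤
      ENNReal.ofReal (modeWeight a N (1 / μ) m.natAbs * ∑ n ∈ s, ‖c n‖ ^ 2) := by
  have hnorm : ∀ t : ℝ, ‖∑ n ∈ s, c n * (tY n m (Real.sin t) : ℂ)‖ =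
      ‖∑ n ∈ s, c n * (tY n m.natAbs (Real.sin t) : ℂ)‖ := by
    intro t
    rcases Int.natAbs_eq m with h | h
    · rw [← h]
    · have : ∑ n ∈ s, c n * (tY n m (Real.sin t) : ℂ) =
          (-1)^m.natAbs * ∑ n ∈ s, c n * (tY n m.natAbs (Real.sin t) : ℂ) := by
        rw [Finset.mul_sum]
        refine Finset.sum_congr rfl fun n hn => ?_
        conv_lhs => rw [h]
        rw [tY_neg n m.natAbs (hs n hn)]
        push_cast; ring
      rw [this, norm_mul]
      simp
  simp_rw [hnorm]
  have hA : 0 ≤ (1 + 2 * (1 / μ)) ^ a := by positivity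
  have b1 := lintegral_sum_tY_le_of_weight_le (m := m.natAbs) hs c
    (fun t => (1 + |t| / μ) ^ a) hA (by
      intro t ht
      refine Real.rpow_le_rpow (by positivity) ?_ ha0
      have h1 : |t| ≤ 2 := abs_le.2 ⟨by linarith [ht.1, Real.pi_le_four],
        by linarith [ht.2, Real.pi_le_four]⟩
      rw [mul_one_div]
      gcongr)
  rw [modeWeight]
  split_ifs with h0
  · exact b1
  · have b2 := lintegral_weight_sum_tY_le (m := m.natAbs) (Nat.one_le_iff_ne_zero.2 h0) hs c ha0 ha2
      hμ hN (by
        intro n hn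
        have := hsN n hn
        rw [eigenL] at this
        rwa [Nat.cast_natAbs, Int.cast_abs, sq_abs])
    have e : N / (μ * (m.natAbs : ℝ)) = N * (1 / μ) / (m.natAbs : ℝ) := by
      rw [mul_one_div, div_div]
    rw [e] at b2
    rcases min_choice (5 * (1 + N * (1 / μ) / (m.natAbs : ℝ)) ^ a)
      ((1 + 2 * (1 / μ)) ^ a) with h | h
    · rw [h]; exact b2
    · rw [h]; exact b1

/-- The degrees of the spherical harmonics of angular frequency `m` with eigenvalue at
most `N ^ 2`. -/
def modeDegrees (N : ℕ) (m : ℤ) : Finset ℕ :=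
  (Finset.range (N ^ 2 + 1)).filter fun n => m.natAbs ≤ n ∧ eigenL n m ≤ (N : ℝ) ^ 2

lemma natCast_le_eigenL {n : ℕ} {m : ℤ} (h : m.natAbs ≤ n) : (n : ℝ) ≤ eigenL n m := by
  rw [eigenL]
  have h1 : (m : ℝ) ^ 2 ≤ (n : ℝ) ^ 2 := by
    rw [← sq_abs, ← Int.cast_abs, ← Nat.cast_natAbs]
    have : (m.natAbs : ℝ) ≤ n := by exact_mod_cast h
    gcongr
  nlinarith

lemma kernF_spt {F : ℝ → ℂ} {N : ℕ} (hF : Function.support F ⊆ Icc (0:ℝ) N) {θ : ℝ}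
    (hθ : 0 < Real.cos θ) (φ : ℝ) (z' : E3) :
    kernF F N (spt θ φ) z' = ∑ m ∈ Finset.Icc (-((N ^ 2 : ℕ) : ℤ)) ((N ^ 2 : ℕ) : ℤ),
      (∑ n ∈ modeDegrees N m, F (Real.sqrt (eigenL n m)) * (starRingEnd ℂ) (Ylm n m z') *
        (tY n m (Real.sin θ) : ℂ)) * Complex.exp (Complex.I * m * φ) := by
  have hL : kernF F N (spt θ φ) z' = ∑ n ∈ Finset.range (N ^ 2 + 1),
      ∑ m ∈ Finset.Icc (-((N ^ 2 : ℕ) : ℤ)) ((N ^ 2 : ℕ) : ℤ),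
        if m.natAbs ≤ n then
          F (Real.sqrt (eigenL n m)) * Ylm n m (spt θ φ) * (starRingEnd ℂ) (Ylm n m z')
        else 0 := by
    refine Finset.sum_congr rfl fun n hn => ?_
    rw [← Finset.sum_filter]
    refine Finset.sum_congr ?_ fun _ _ => rfl
    ext m
    simp only [Finset.mem_range, Finset.mem_filter, Finset.mem_Icc] at hn ⊢
    omega
  rw [hL, Finset.sum_comm]
  refine Finset.sum_congr rfl fun m _ => ?_
  rw [modeDegrees, Finset.sum_filter, Finset.sum_mul]
  refine Finset.sum_congr rfl fun n _ => ?_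
  by_cases h1 : m.natAbs ≤ n
  · by_cases h2 : eigenL n m ≤ (N : ℝ) ^ 2
    · rw [if_pos h1, if_pos ⟨h1, h2⟩, Ylm_spt hθ]
      ring
    · rw [if_pos h1, if_neg (fun h => h2 h.2)]
      have : F (Real.sqrt (eigenL n m)) = 0 := by
        by_contra h
        have h3 := (hF h).2
        exact h2 ((Real.sqrt_le_left (Nat.cast_nonneg N)).1 h3)
      simp [this]
  · rw [if_neg h1, if_neg (fun h => h1 h.1), zero_mul]

lemma lintegral_weight_kernF_le {F : ℝ → ℂ} {N : ℕ} (hF : Function.support F ⊆ Icc (0:ℝ) N)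
    (z' : E3) {a μ : ℝ} (ha0 : 0 ≤ a) (ha2 : a ≤ 2) (hμ : 0 < μ) :
    ∫⁻ z, ENNReal.ofReal ((1 + |Real.arcsin (z 2)| / μ) ^ a) *
        (‖kernF F N z z'‖₊ : ℝ≥0∞) ^ 2 ∂sphereMeasure ≤
      ∑ m ∈ Finset.Icc (-((N ^ 2 : ℕ) : ℤ)) ((N ^ 2 : ℕ) : ℤ),
        ENNReal.ofReal (2 * Real.pi * (modeWeight a N (1 / μ) m.natAbs *
          ∑ n ∈ modeDegrees N m, ‖F (Real.sqrt (eigenL n m))‖ ^ 2 * tY n m (z' 2) ^ 2)) := by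
  set I := Finset.Icc (-((N ^ 2 : ℕ) : ℤ)) ((N ^ 2 : ℕ) : ℤ)
  set c : ℤ → ℕ → ℂ := fun m n => F (Real.sqrt (eigenL n m)) * (starRingEnd ℂ) (Ylm n m z')
    with hc
  have hcn : ∀ m n, ‖c m n‖ ^ 2 = ‖F (Real.sqrt (eigenL n m))‖ ^ 2 * tY n m (z' 2) ^ 2 := by
    intro m n
    rw [hc]
    dsimp only
    rw [norm_mul, mul_pow, RCLike.norm_conj, norm_Ylm_sq]
  have hs : ∀ m, ∀ n ∈ modeDegrees N m, m.natAbs ≤ n := fun m n hn => by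
    rw [modeDegrees, Finset.mem_filter] at hn; exact hn.2.1
  have hsN : ∀ m, ∀ n ∈ modeDegrees N m, eigenL n m ≤ (N:ℝ) ^ 2 := fun m n hn => by
    rw [modeDegrees, Finset.mem_filter] at hn; exact hn.2.2
  set f : ℤ → ℝ → ℝ := fun m t => (1 + |t| / μ) ^ a *
    ‖∑ n ∈ modeDegrees N m, c m n * (tY n m (Real.sin t) : ℂ)‖ ^ 2 * Real.cos t with hf
  have hfm : ∀ m, Measurable (f m) := by
    intro m
    have h1 : Continuous fun t : ℝ => ∑ n ∈ modeDegrees N m, c m n * (tY n m (Real.sin t) : ℂ) :=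
      continuous_finsetSum _ fun n hn => continuous_const.mul
        (Complex.continuous_ofReal.comp ((continuous_tY (hs m n hn)).comp Real.continuous_sin))
    have h2 : Measurable fun t : ℝ => (1 + |t| / μ) ^ a := by fun_prop
    exact (h2.mul (h1.norm.pow 2).measurable).mul Real.continuous_cos.measurable
  refine (lintegral_sphereMeasure_le _).trans ?_
  have hinner : ∀ t ∈ Ioc (-(Real.pi/2)) (Real.pi/2),
      ∫⁻ φ in Ico (0:ℝ) (2 * Real.pi), ENNReal.ofReal (Real.cos t) *
        (ENNReal.ofReal ((1 + |Real.arcsin (spt t φ 2)| / μ) ^ a) *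
          (‖kernF F N (spt t φ) z'‖₊ : ℝ≥0∞) ^ 2) =
      ENNReal.ofReal (2 * Real.pi) * ∑ m ∈ I, ENNReal.ofReal (f m t) := by
    intro t ht
    have hcos : 0 ≤ Real.cos t := Real.cos_nonneg_of_mem_Icc ⟨ht.1.le, ht.2⟩
    rcases hcos.eq_or_lt with h0 | h0
    · simp [hf, ← h0]
    · have e : ∀ φ : ℝ, ENNReal.ofReal (Real.cos t) *
          (ENNReal.ofReal ((1 + |Real.arcsin (spt t φ 2)| / μ) ^ a) *
            (‖kernF F N (spt t φ) z'‖₊ : ℝ≥0∞) ^ 2) =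
          ENNReal.ofReal (Real.cos t * (1 + |t| / μ) ^ a) * ENNReal.ofReal
            (‖∑ m ∈ I, (∑ n ∈ modeDegrees N m, c m n * (tY n m (Real.sin t) : ℂ)) *
              Complex.exp (Complex.I * m * φ)‖ ^ 2) := by
        intro φ
        rw [spt_two, Real.arcsin_sin ht.1.le ht.2, kernF_spt hF h0, ENNReal.ofReal_mul hcos,
          mul_assoc, ENNReal.ofReal_pow (norm_nonneg _), ofReal_norm, enorm_eq_nnnorm]
      simp_rw [e]
      rw [lintegral_const_mul' _ _ ENNReal.ofReal_ne_top, lintegral_norm_trig_sq,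
        ← ENNReal.ofReal_mul (by positivity), ← ENNReal.ofReal_sum_of_nonneg
          (fun m _ => by rw [hf]; positivity), ← ENNReal.ofReal_mul (by positivity)]
      congr 1
      rw [mul_left_comm, Finset.mul_sum]
      congr 1
      refine Finset.sum_congr rfl fun m _ => ?_
      rw [hf]; ring
  rw [setLIntegral_congr_fun measurableSet_Ioc hinner,
    lintegral_const_mul' _ _ ENNReal.ofReal_ne_top,
    lintegral_finsetSum _ fun m _ => (hfm m).ennreal_ofReal, Finset.mul_sum]
  refine Finset.sum_le_sum fun m _ => ?_
  rw [ENNReal.ofReal_mul (p := 2 * Real.pi) (by positivity)]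
  simp_rw [← hcn]
  refine mul_le_mul' le_rfl ?_
  exact lintegral_mode_le (hs m) (c m) ha0 ha2 hμ (Nat.cast_nonneg N) (hsN m)

lemma inWindow_natAbs {i n : ℕ} {m : ℤ} (hm : m ≠ 0) (hmn : m.natAbs ≤ n)
    (h1 : ((i:ℝ) - 1) ^ 2 < eigenL n m) (h2 : eigenL n m ≤ (i:ℝ) ^ 2) :
    InWindow i n m.natAbs := by
  have e : (n:ℝ) * (n + 1) - (m.natAbs : ℝ) ^ 2 = eigenL n m := by
    rw [eigenL, Nat.cast_natAbs, Int.cast_abs, sq_abs]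
  exact ⟨Int.natAbs_pos.2 hm, hmn, by rw [e]; exact h1, by rw [e]; exact h2⟩

lemma sum_modeWeight_mul_le {i N : ℕ} (hi1 : 1 ≤ i) (hiN : i ≤ N) {T : Finset (ℕ × ℤ)}
    {a M x : ℝ} (hT : ∀ p ∈ T, p.2.natAbs ≤ p.1) (hT0 : ∀ p ∈ T, ((i:ℝ) - 1) ^ 2 ≤ eigenL p.1 p.2)
    (hT1 : ∀ p ∈ T, p.2 ≠ 0 → ((i:ℝ) - 1) ^ 2 < eigenL p.1 p.2)
    (hT2 : ∀ p ∈ T, eigenL p.1 p.2 ≤ (i:ℝ) ^ 2)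
    (hx : |x| ≤ 1) (ha0 : 0 ≤ a) (ha1 : a < 1) (hM : 3/5 ≤ M) (hMx : M * |x| ≤ 1)
    (hNM : 3/5 * (N:ℝ) ≤ M ∨ 3/5 ≤ M * |x|) :
    ∑ p ∈ T, modeWeight a N M p.2.natAbs * tY p.1 p.2 x ^ 2 ≤
      3 * (38000000 / (1 - a)) * (N * M) := by
  have hM0 : 0 < M := by linarith
  have hN0 : (0:ℝ) < N := by exact_mod_cast hi1.trans hiN
  have hC : 38000000 ≤ 38000000 / (1 - a) := by
    rw [le_div_iff₀ (by linarith)]; linarith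
  have hg : ∀ p : ℕ × ℕ, 0 ≤ modeWeight a N M p.2 * tY p.1 p.2 x ^ 2 := fun p =>
    mul_nonneg (modeWeight_nonneg hN0.le hM0.le _) (sq_nonneg _)
  have hpart : ∀ T' ⊆ T, (∀ p ∈ T', p.2 ≠ 0) →
      Set.InjOn (fun p : ℕ × ℤ => (p.1, p.2.natAbs)) T' →
      ∑ p ∈ T', modeWeight a N M p.2.natAbs * tY p.1 p.2 x ^ 2 ≤
        38000000 / (1 - a) * (N * M) := by
    intro T' hT' hne hinj
    have e : ∑ p ∈ T', modeWeight a N M p.2.natAbs * tY p.1 p.2 x ^ 2 =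
        ∑ q ∈ T'.image (fun p : ℕ × ℤ => (p.1, p.2.natAbs)),
          modeWeight a N M q.2 * tY q.1 q.2 x ^ 2 := by
      rw [Finset.sum_image hinj]
      refine Finset.sum_congr rfl fun p hp => ?_
      rw [tY_natAbs_sq (hT p (hT' hp))]
    rw [e]
    refine weighted_sum_window_le (i := i) ?_ hx ha0 ha1 (by exact_mod_cast hiN) hM hMx hNM
      (fun m hm => modeWeight_le_five_mul a N M hm) (fun m _ => modeWeight_le a N M m)
    intro q hq
    obtain ⟨p, hp, rfl⟩ := Finset.mem_image.1 hq
    exact inWindow_natAbs (hne p hp) (hT p (hT' hp)) (hT1 p (hT' hp) (hne p hp)) (hT2 p (hT' hp))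
  have hpos := hpart (T.filter fun p => 0 < p.2) (Finset.filter_subset _ _)
    (fun p hp => (Finset.mem_filter.1 hp).2.ne') (by
      rintro ⟨n, m⟩ hp ⟨n', m'⟩ hp' h
      simp only [Finset.coe_filter, Set.mem_ofPred_eq, Prod.mk.injEq] at hp hp' h ⊢
      omega)
  have hneg := hpart (T.filter fun p => p.2 < 0) (Finset.filter_subset _ _)
    (fun p hp => (Finset.mem_filter.1 hp).2.ne) (by
      rintro ⟨n, m⟩ hp ⟨n', m'⟩ hp' h
      simp only [Finset.coe_filter, Set.mem_ofPred_eq, Prod.mk.injEq] at hp hp' h ⊢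
      omega)
  have hzero : ∑ p ∈ T.filter (fun p => p.2 = 0), modeWeight a N M p.2.natAbs * tY p.1 p.2 x ^ 2 ≤
      38000000 / (1 - a) * (N * M) := by
    have hsub : T.filter (fun p => p.2 = 0) ⊆ {((i - 1 : ℕ), (0:ℤ))} := by
      rintro ⟨n, m⟩ hp
      simp only [Finset.mem_filter] at hp
      obtain ⟨hp, rfl⟩ := hp
      have h1 := hT0 _ hp
      have h2 := hT2 _ hp
      obtain ⟨j, rfl⟩ := Nat.exists_eq_add_of_le' hi1
      simp only [eigenL, Int.cast_zero] at h1 h2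
      push_cast at h1 h2
      have h1' : j ^ 2 ≤ n * (n + 1) := by
        have : (j:ℝ) ^ 2 ≤ n * (n + 1) := by linarith
        exact_mod_cast this
      have h2' : n * (n + 1) ≤ (j + 1) ^ 2 := by
        have : (n:ℝ) * (n + 1) ≤ (j + 1) ^ 2 := by linarith
        exact_mod_cast this
      have : n = j := by
        rcases lt_trichotomy n j with h | h | h
        · nlinarith
        · exact h
        · nlinarith
      simp [this]
    have hcast : ((i - 1 : ℕ) : ℝ) ≤ N - 1 := by
      rw [Nat.cast_sub hi1]
      have : (i:ℝ) ≤ N := by exact_mod_cast hiN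
      push_cast; linarith
    have ht : tY (i - 1) ((0:ℕ):ℤ) x ^ 2 ≤ N / 6 := by
      refine (tY_sq_le (Nat.zero_le _) (abs_le.1 hx)).trans ?_
      rw [div_le_div_iff₀ (by positivity) (by norm_num)]
      nlinarith [Real.pi_gt_three]
    have hw : modeWeight a N M 0 ≤ 4 * M := by
      refine (modeWeight_le a N M 0).trans ?_
      calc (1 + 2 * M) ^ a ≤ (1 + 2 * M) ^ (1:ℝ) :=
            Real.rpow_le_rpow_of_exponent_le (by linarith) ha1.le
        _ ≤ 4 * M := by rw [Real.rpow_one]; linarith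
    calc ∑ p ∈ T.filter (fun p => p.2 = 0), modeWeight a N M p.2.natAbs * tY p.1 p.2 x ^ 2
        ≤ ∑ p ∈ ({((i - 1 : ℕ), (0:ℤ))} : Finset (ℕ × ℤ)),
            modeWeight a N M p.2.natAbs * tY p.1 p.2 x ^ 2 :=
          Finset.sum_le_sum_of_subset_of_nonneg hsub fun p _ _ =>
            mul_nonneg (modeWeight_nonneg hN0.le hM0.le _) (sq_nonneg _)
      _ = modeWeight a N M 0 * tY (i - 1) ((0:ℕ):ℤ) x ^ 2 := by simp
      _ ≤ (4 * M) * (N / 6) := by gcongr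
      _ ≤ 38000000 * (N * M) := by nlinarith [mul_pos hN0 hM0]
      _ ≤ _ := by gcongr
  have hsplit : ∑ p ∈ T, modeWeight a N M p.2.natAbs * tY p.1 p.2 x ^ 2 =
      ∑ p ∈ T.filter (fun p => p.2 = 0), modeWeight a N M p.2.natAbs * tY p.1 p.2 x ^ 2 +
      (∑ p ∈ T.filter (fun p => 0 < p.2), modeWeight a N M p.2.natAbs * tY p.1 p.2 x ^ 2 +
      ∑ p ∈ T.filter (fun p => p.2 < 0), modeWeight a N M p.2.natAbs * tY p.1 p.2 x ^ 2) := by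
    simp only [Finset.sum_filter, ← Finset.sum_add_distrib]
    refine Finset.sum_congr rfl fun p _ => ?_
    rcases lt_trichotomy p.2 0 with h | h | h
    · simp [h, h.ne, h.not_gt]
    · simp [h]
    · simp [h, h.ne', h.not_gt]
  rw [hsplit]
  linarith

/-- The index of the unit interval containing `√λ`. -/
def windowIndex (p : ℕ × ℤ) : ℕ := max 1 ⌈Real.sqrt (eigenL p.1 p.2)⌉₊

lemma sum_mode_le {F : ℝ → ℂ} {N : ℕ} (hN : 1 ≤ N) {a M x : ℝ}
    (hx : |x| ≤ 1) (ha0 : 0 ≤ a) (ha1 : a < 1) (hM : 3/5 ≤ M) (hMx : M * |x| ≤ 1)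
    (hNM : 3/5 * (N:ℝ) ≤ M ∨ 3/5 ≤ M * |x|) :
    ∑ m ∈ Finset.Icc (-((N ^ 2 : ℕ) : ℤ)) ((N ^ 2 : ℕ) : ℤ),
        ENNReal.ofReal (2 * Real.pi * (modeWeight a N M m.natAbs *
          ∑ n ∈ modeDegrees N m, ‖F (Real.sqrt (eigenL n m))‖ ^ 2 * tY n m x ^ 2)) ≤
      ENNReal.ofReal (2 * Real.pi * (3 * (38000000 / (1 - a)) * (N * M))) *
        ∑ i ∈ Finset.Icc 1 N,
          (⨆ lam ∈ Set.Icc (((i:ℝ)-1)/(N:ℝ)) ((i:ℝ)/(N:ℝ)), (‖F ((N:ℝ) * lam)‖₊ : ℝ≥0∞))^2 := by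
  have hM0 : 0 < M := by linarith
  have hN0 : (0:ℝ) < N := by exact_mod_cast hN
  have hw : ∀ m, 0 ≤ modeWeight a N M m := modeWeight_nonneg hN0.le hM0.le
  set I := Finset.Icc (-((N ^ 2 : ℕ) : ℤ)) ((N ^ 2 : ℕ) : ℤ)
  set P : Finset (ℕ × ℤ) := (Finset.range (N ^ 2 + 1) ×ˢ I).filter fun p =>
    p.2.natAbs ≤ p.1 ∧ eigenL p.1 p.2 ≤ (N:ℝ) ^ 2 with hP
  set f : ℕ × ℤ → ℝ≥0∞ := fun p => ENNReal.ofReal (2 * Real.pi * (modeWeight a N M p.2.natAbs *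
    (‖F (Real.sqrt (eigenL p.1 p.2))‖ ^ 2 * tY p.1 p.2 x ^ 2))) with hf
  have e : ∑ m ∈ I, ENNReal.ofReal (2 * Real.pi * (modeWeight a N M m.natAbs *
          ∑ n ∈ modeDegrees N m, ‖F (Real.sqrt (eigenL n m))‖ ^ 2 * tY n m x ^ 2)) =
      ∑ p ∈ P, f p := by
    rw [hP, Finset.sum_filter, Finset.sum_product_right]
    refine Finset.sum_congr rfl fun m _ => ?_
    rw [← Finset.sum_filter, Finset.mul_sum, Finset.mul_sum, ENNReal.ofReal_sum_of_nonneg]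
    · rfl
    · intro n _
      have := hw m.natAbs
      positivity
  have hmaps : ∀ p ∈ P, windowIndex p ∈ Finset.Icc 1 N := by
    intro p hp
    have h2 := (Finset.mem_filter.1 hp).2.2
    rw [windowIndex, Finset.mem_Icc]
    refine ⟨le_max_left _ _, max_le hN (Nat.ceil_le.2 ?_)⟩
    exact (Real.sqrt_le_left hN0.le).2 h2
  rw [e, ← Finset.sum_fiberwise_of_maps_to hmaps, Finset.mul_sum]
  refine Finset.sum_le_sum fun i hi => ?_
  obtain ⟨hi1, hiN⟩ := Finset.mem_Icc.1 hi
  set T := P.filter fun p => windowIndex p = i with hTdef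
  have hT : ∀ p ∈ T, p.2.natAbs ≤ p.1 := fun p hp =>
    (Finset.mem_filter.1 (Finset.mem_filter.1 hp).1).2.1
  have hlow : ∀ p ∈ T, (i:ℝ) - 1 ≤ Real.sqrt (eigenL p.1 p.2) ∧
      (p.2 ≠ 0 → (i:ℝ) - 1 < Real.sqrt (eigenL p.1 p.2)) := by
    intro p hp
    have h1 : max 1 ⌈Real.sqrt (eigenL p.1 p.2)⌉₊ = i := (Finset.mem_filter.1 hp).2
    have h2 := Nat.ceil_lt_add_one (Real.sqrt_nonneg (eigenL p.1 p.2))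
    rcases max_choice 1 ⌈Real.sqrt (eigenL p.1 p.2)⌉₊ with h | h
    · rw [h] at h1
      rw [← h1]
      refine ⟨by simp, fun hne => ?_⟩
      have h3 : (0:ℝ) < eigenL p.1 p.2 := by
        refine lt_of_lt_of_le ?_ (natCast_le_eigenL (hT p hp))
        exact_mod_cast (Int.natAbs_pos.2 hne).trans_le (hT p hp)
      simpa using Real.sqrt_pos.2 h3
    · rw [h] at h1
      rw [h1] at h2
      exact ⟨by linarith, fun _ => by linarith⟩
  have hup : ∀ p ∈ T, Real.sqrt (eigenL p.1 p.2) ≤ i := by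
    intro p hp
    have h1 : max 1 ⌈Real.sqrt (eigenL p.1 p.2)⌉₊ = i := (Finset.mem_filter.1 hp).2
    rw [← h1]
    exact (Nat.le_ceil _).trans (by exact_mod_cast le_max_right _ _)
  have hi1' : (0:ℝ) ≤ (i:ℝ) - 1 := by
    have : (1:ℝ) ≤ i := by exact_mod_cast hi1
    linarith
  set S : ℝ≥0∞ :=
    ⨆ lam ∈ Set.Icc (((i:ℝ)-1)/(N:ℝ)) ((i:ℝ)/(N:ℝ)), (‖F ((N:ℝ) * lam)‖₊ : ℝ≥0∞) with hS
  have hFS : ∀ p ∈ T, (‖F (Real.sqrt (eigenL p.1 p.2))‖₊ : ℝ≥0∞) ≤ S := by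
    intro p hp
    have h : Real.sqrt (eigenL p.1 p.2) / N ∈ Set.Icc (((i:ℝ)-1)/(N:ℝ)) ((i:ℝ)/(N:ℝ)) :=
      ⟨by gcongr; exact (hlow p hp).1, by gcongr; exact hup p hp⟩
    have h2 := le_iSup₂ (f := fun (lam : ℝ) (_ : lam ∈ Set.Icc (((i:ℝ)-1)/(N:ℝ)) ((i:ℝ)/(N:ℝ))) =>
      (‖F ((N:ℝ) * lam)‖₊ : ℝ≥0∞)) _ h
    rwa [mul_div_cancel₀ _ hN0.ne'] at h2
  calc ∑ p ∈ T, f p ≤ ∑ p ∈ T, ENNReal.ofReal (2 * Real.pi *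
        (modeWeight a N M p.2.natAbs * tY p.1 p.2 x ^ 2)) * S ^ 2 := by
        refine Finset.sum_le_sum fun p hp => ?_
        have e2 : f p = ENNReal.ofReal (2 * Real.pi *
            (modeWeight a N M p.2.natAbs * tY p.1 p.2 x ^ 2)) *
              (‖F (Real.sqrt (eigenL p.1 p.2))‖₊ : ℝ≥0∞) ^ 2 := by
          have := hw p.2.natAbs
          rw [← enorm_eq_nnnorm, ← ofReal_norm, ← ENNReal.ofReal_pow (norm_nonneg _),
            ← ENNReal.ofReal_mul (by positivity)]
          exact congrArg ENNReal.ofReal (by ring)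
        rw [e2]
        gcongr
        exact hFS p hp
    _ = ENNReal.ofReal (2 * Real.pi *
        ∑ p ∈ T, modeWeight a N M p.2.natAbs * tY p.1 p.2 x ^ 2) * S ^ 2 := by
        rw [← Finset.sum_mul, Finset.mul_sum, ENNReal.ofReal_sum_of_nonneg]
        intro p _
        have := hw p.2.natAbs
        positivity
    _ ≤ _ := by
        gcongr
        refine sum_modeWeight_mul_le hi1 hiN hT (fun p hp => ?_) (fun p hp hne => ?_)
          (fun p hp => ?_) hx ha0 ha1 hM hMx hNM
        · have h := (hlow p hp).1
          rwa [Real.le_sqrt hi1' ((Nat.cast_nonneg _).trans (natCast_le_eigenL (hT p hp)))] at h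
        · have h := (hlow p hp).2 hne
          rwa [Real.lt_sqrt hi1'] at h
        · have h := hup p hp
          rwa [Real.sqrt_le_left (Nat.cast_nonneg i)] at h

end Auxiliary

/-- the weighted Plancherel-type estimate
`∫_{S²} (1 + w_{1/N}(z,z'))^{2α} |K_{F(√L)}(z,z')|² dσ(z) ≤ C_α N² min{N, 1/|θ'|} ‖F(N·)‖_{N,2}²`
for `α ∈ [0,1/2)`, `F` supported in `[0,N]` and `z' = ⟨θ',φ'⟩`, where
`w_{1/N}(z,z') = |θ(z)|/max{1/N,|θ'|}` with `θ(z) = arcsin z₃` (and `min{N,1/|θ'|}` is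
interpreted as `N` when `θ' = 0`, via the `ℝ≥0∞`-inverse). -/
theorem statement18 (α : ℝ) (hα : α ∈ Set.Ico (0:ℝ) (1/2)) :
    ∃ C : ℝ, 0 < C ∧
      ∀ N : ℕ, 1 ≤ N →
        ∀ F : ℝ → ℂ, Measurable F → Function.support F ⊆ Set.Icc (0:ℝ) (N:ℝ) →
          ∀ θ' : ℝ, θ' ∈ Set.Icc (-(Real.pi/2)) (Real.pi/2) → ∀ φ' : ℝ,
            ∫⁻ z, ENNReal.ofReal
                  ((1 + |Real.arcsin (z 2)| / max (1/(N:ℝ)) |θ'|) ^ (2*α)) *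
                (‖kernF F N z (spt θ' φ')‖₊ : ℝ≥0∞)^2 ∂sphereMeasure ≤
              ENNReal.ofReal C * (N : ℝ≥0∞)^2 * min ((N : ℝ≥0∞)) (ENNReal.ofReal |θ'|)⁻¹ *
                normN2Sq F N := by
  obtain ⟨hα0, hα1⟩ := hα
  have ha1 : 2 * α < 1 := by linarith
  have h1a : 0 < 1 - 2 * α := by linarith
  refine ⟨2 * Real.pi * (3 * (38000000 / (1 - 2 * α))), by positivity, ?_⟩
  intro N hN F _ hF θ' hθ' φ'
  have hN1 : (1:ℝ) ≤ N := by exact_mod_cast hN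
  have hN0 : (0:ℝ) < N := by linarith
  set μ : ℝ := max (1 / (N:ℝ)) |θ'| with hμdef
  have hμ : 0 < μ := lt_max_of_lt_left (by positivity)
  have habs : |θ'| ≤ Real.pi / 2 := abs_le.2 hθ'
  have hsin : |Real.sin θ'| ≤ |θ'| := Real.abs_sin_le_abs
  have hM : (3:ℝ) / 5 ≤ 1 / μ := by
    rw [le_div_iff₀ hμ]
    have : μ ≤ 5 / 3 := by
      refine max_le ?_ (by linarith [Real.pi_lt_d2])
      rw [div_le_iff₀ hN0]; linarith
    linarith
  have hMx : 1 / μ * |Real.sin θ'| ≤ 1 := by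
    rw [one_div, inv_mul_le_iff₀ hμ, mul_one]
    exact hsin.trans (le_max_right _ _)
  have hNM : 3 / 5 * (N:ℝ) ≤ 1 / μ ∨ 3 / 5 ≤ 1 / μ * |Real.sin θ'| := by
    rcases le_total |θ'| (1 / (N:ℝ)) with h | h
    · left
      rw [hμdef, max_eq_left h, one_div_one_div]
      linarith
    · right
      rw [hμdef, max_eq_right h, one_div, inv_mul_eq_div,
        le_div_iff₀ (lt_of_lt_of_le (by positivity) h)]
      have h1 := Real.mul_abs_le_abs_sin habs
      have h2 : (3:ℝ) / 5 ≤ 2 / Real.pi := by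
        rw [div_le_div_iff₀ (by norm_num) Real.pi_pos]
        linarith [Real.pi_lt_d2]
      exact (mul_le_mul_of_nonneg_right h2 (abs_nonneg _)).trans h1
  have hmin : min (N : ℝ≥0∞) (ENNReal.ofReal |θ'|)⁻¹ = ENNReal.ofReal (1 / μ) := by
    have e : (N : ℝ≥0∞) = (ENNReal.ofReal (1 / (N:ℝ)))⁻¹ := by
      rw [one_div, ENNReal.ofReal_inv_of_pos hN0, inv_inv, ENNReal.ofReal_natCast]
    rw [e, one_div μ, ENNReal.ofReal_inv_of_pos hμ, hμdef, ENNReal.ofReal_max]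
    exact (ENNReal.inv_strictAnti.antitone.map_max).symm
  refine (lintegral_weight_kernF_le hF (spt θ' φ') (by linarith) (by linarith) hμ).trans ?_
  rw [spt_two]
  refine (sum_mode_le hN (Real.abs_sin_le_one θ') (by linarith) ha1 hM hMx hNM).trans (le_of_eq ?_)
  rw [normN2Sq, hmin, ← mul_assoc (2 * Real.pi), ← mul_assoc, ← mul_assoc _ (N : ℝ≥0∞)⁻¹]
  congr 1
  rw [ENNReal.ofReal_mul (by positivity), ENNReal.ofReal_mul (by positivity),
    ENNReal.ofReal_natCast, mul_right_comm _ _ (N : ℝ≥0∞)⁻¹, ← mul_assoc]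
  congr 1
  rw [mul_assoc (ENNReal.ofReal _), sq, mul_assoc (N : ℝ≥0∞),
    ENNReal.mul_inv_cancel (by exact_mod_cast hN0.ne') (ENNReal.natCast_ne_top N), mul_one]
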